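/- Under the standing assumptions (α ∈ (1/3,1/2), T > 0, α-Hölder rough path 𝐗 = (X, X⁽²⁾), monotone family of interpolation spaces (B_η)_{η∈ℝ}, analytic C₀-semigroup S on the scale with |(S(t)−Id)x|_η ≲ t^σ|x|_{η+σ} and |S(t)x|_{η+σ} ≲ t^{−σ}|x|_η for σ ∈ [0,1], F satisfying assumption (F) and G satisfying assumption (G)), for every y₀ ∈ B_γ there exists a unique global-in-time solution (y, G(y)) ∈ D^{2α}_{X,γ}([0,T]) of the rough evolution equation dy_t = (Ay_t + F(y_t))dt + G(y_t)d𝐗_t with y(0) = y₀, i.e. a unique controlled rough path on the whole interval [0,T] satisfying the mild formulation y_t = S(t)y₀ + ∫₀ᵗ S(t−s)F(y_s)ds + ∫₀ᵗ S(t−s)G(y_s)d𝐗_s for all t ∈ [0,T]. -/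

import Mathlib

open Set

/-- A monotone family of interpolation spaces: a scale `(B_θ)_{θ ∈ ℝ}` of separable Banach
spaces realised inside a common ambient real vector space `E`; `Mem θ x` means `x ∈ B_θ`,
`N θ x` denotes the norm `|x|_θ`.  For `β₁ ≤ β₂` the space `B_{β₂}` is contained in `B_{β₁}`
with dense and continuous embedding, and the interpolation inequality holds. -/
structure BanachScale where
  E : Type
  [inst_add : AddCommGroup E]
  [inst_mod : Module ℝ E]
  Mem : ℝ → E → Prop
  N : ℝ → E → ℝ
  mem_zero : ∀ θ : ℝ, Mem θ 0
  mem_add : ∀ (θ : ℝ) (x y : E), Mem θ x → Mem θ y → Mem θ (x + y)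
  mem_neg : ∀ (θ : ℝ) (x : E), Mem θ x → Mem θ (-x)
  mem_smul : ∀ (θ c : ℝ) (x : E), Mem θ x → Mem θ (c • x)
  N_nonneg : ∀ (θ : ℝ) (x : E), 0 ≤ N θ x
  N_zero : ∀ θ : ℝ, N θ 0 = 0
  N_eq_zero : ∀ (θ : ℝ) (x : E), Mem θ x → N θ x = 0 → x = 0
  N_add : ∀ (θ : ℝ) (x y : E), Mem θ x → Mem θ y → N θ (x + y) ≤ N θ x + N θ y
  N_smul : ∀ (θ c : ℝ) (x : E), N θ (c • x) = |c| * N θ x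
  mem_mono : ∀ ⦃β₁ β₂ : ℝ⦄, β₁ ≤ β₂ → ∀ x : E, Mem β₂ x → Mem β₁ x
  embed_bound : ∀ ⦃β₁ β₂ : ℝ⦄, β₁ ≤ β₂ → ∃ C > (0:ℝ), ∀ x : E, Mem β₂ x → N β₁ x ≤ C * N β₂ x
  embed_dense : ∀ ⦃β₁ β₂ : ℝ⦄, β₁ ≤ β₂ → ∀ x : E, Mem β₁ x → ∀ ε > (0:ℝ),
    ∃ y : E, Mem β₂ y ∧ N β₁ (x - y) < ε
  complete : ∀ (θ : ℝ) (u : ℕ → E), (∀ n, Mem θ (u n)) →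
    (∀ ε > (0:ℝ), ∃ M : ℕ, ∀ m ≥ M, ∀ n ≥ M, N θ (u m - u n) < ε) →
    ∃ x : E, Mem θ x ∧ ∀ ε > (0:ℝ), ∃ M : ℕ, ∀ n ≥ M, N θ (u n - x) < ε
  separable : ∀ θ : ℝ, ∃ D : Set E, D.Countable ∧ (∀ x ∈ D, Mem θ x) ∧
    ∀ x : E, Mem θ x → ∀ ε > (0:ℝ), ∃ y ∈ D, N θ (x - y) < ε
  interp : ∀ ⦃θ β γ : ℝ⦄, θ ≤ β → β ≤ γ → ∃ C > (0:ℝ), ∀ x : E, Mem γ x →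
    N β x ^ (γ - θ) ≤ C * (N θ x ^ (γ - β) * N γ x ^ (β - θ))

attribute [instance] BanachScale.inst_add BanachScale.inst_mod

/-- An analytic `C₀`-semigroup `(S(t))_{t ≥ 0}` acting on a scale of Banach spaces,
together with the standard parabolic bounds
`|(S(t) - Id)x|_η ≲ t^σ |x|_{η+σ}` and `|S(t)x|_{η+σ} ≲ t^{-σ} |x|_η` for `σ ∈ [0,1]`,
with constants uniform on compact time intervals. -/
structure ScaleSemigroup (𝓑 : BanachScale) where
  S : ℝ → 𝓑.E →ₗ[ℝ] 𝓑.E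
  S_id : ∀ x : 𝓑.E, S 0 x = x
  S_comp : ∀ s t : ℝ, 0 ≤ s → 0 ≤ t → ∀ x : 𝓑.E, S (s + t) x = S s (S t x)
  S_mem : ∀ (t θ : ℝ) (x : 𝓑.E), 0 ≤ t → 𝓑.Mem θ x → 𝓑.Mem θ (S t x)
  S_bounded : ∀ θ Tm : ℝ, 0 < Tm → ∃ C > (0:ℝ), ∀ (t : ℝ) (x : 𝓑.E), 0 ≤ t → t ≤ Tm →
    𝓑.Mem θ x → 𝓑.N θ (S t x) ≤ C * 𝓑.N θ x
  S_strong_cont : ∀ (θ : ℝ) (x : 𝓑.E), 𝓑.Mem θ x → ∀ ε > (0:ℝ), ∃ δ > (0:ℝ),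
    ∀ t : ℝ, 0 < t → t < δ → 𝓑.N θ (S t x - x) < ε
  S_smoothing : ∀ η σ Tm : ℝ, 0 ≤ σ → σ ≤ 1 → 0 < Tm → ∃ C > (0:ℝ),
    ∀ (t : ℝ) (x : 𝓑.E), 0 < t → t ≤ Tm → 𝓑.Mem η x →
      𝓑.Mem (η + σ) (S t x) ∧ 𝓑.N (η + σ) (S t x) ≤ C * t ^ (-σ) * 𝓑.N η x
  S_holdId : ∀ η σ Tm : ℝ, 0 ≤ σ → σ ≤ 1 → 0 < Tm → ∃ C > (0:ℝ),
    ∀ (t : ℝ) (x : 𝓑.E), 0 < t → t ≤ Tm → 𝓑.Mem (η + σ) x →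
      𝓑.N η (S t x - x) ≤ C * t ^ σ * 𝓑.N (η + σ) x

/-- A (one-dimensional) `α`-Hölder rough path `𝐗 = (X, X⁽²⁾)` on `[0,T]`:
`X ∈ C^α`, `X₀ = 0`, `X⁽²⁾ ∈ C^{2α}` on the simplex, satisfying Chen's relation. -/
structure RoughPath (α T : ℝ) where
  X : ℝ → ℝ
  X2 : ℝ → ℝ → ℝ
  X_zero : X 0 = 0
  holderX : ∃ C : ℝ, ∀ s t : ℝ, 0 ≤ s → s ≤ t → t ≤ T → |X t - X s| ≤ C * (t - s) ^ α
  holderX2 : ∃ C : ℝ, ∀ s t : ℝ, 0 ≤ s → s ≤ t → t ≤ T → |X2 s t| ≤ C * (t - s) ^ (2 * α)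
  chen : ∀ s u t : ℝ, 0 ≤ s → s ≤ u → u ≤ t → t ≤ T →
    X2 s t - X2 s u - X2 u t = (X u - X s) * (X t - X u)

/-- The supremum norm `‖f‖_{∞, B_θ}` over `[0,T]`. -/
noncomputable def scaleSupNorm (𝓑 : BanachScale) (θ T : ℝ) (f : ℝ → 𝓑.E) : ℝ :=
  sSup {r : ℝ | ∃ t : ℝ, 0 ≤ t ∧ t ≤ T ∧ r = 𝓑.N θ (f t)}

/-- The `η`-Hölder seminorm (in `B_θ`) of a two-parameter function on `[0,T]`. -/
noncomputable def scaleHolderNorm2 (𝓑 : BanachScale) (θ η T : ℝ) (F : ℝ → ℝ → 𝓑.E) : ℝ :=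
  sSup {r : ℝ | ∃ s t : ℝ, 0 ≤ s ∧ s < t ∧ t ≤ T ∧ r = 𝓑.N θ (F s t) / (t - s) ^ η}

/-- The `η`-Hölder seminorm `‖f‖_{η, B_θ}` over `[0,T]`. -/
noncomputable def scaleHolderNorm (𝓑 : BanachScale) (θ η T : ℝ) (f : ℝ → 𝓑.E) : ℝ :=
  scaleHolderNorm2 𝓑 θ η T fun s t => f t - f s

/-- The `η`-Hölder seminorm of a real-valued path on `[0,T]`. -/
noncomputable def realHolderNorm (η T : ℝ) (X : ℝ → ℝ) : ℝ :=
  sSup {r : ℝ | ∃ s t : ℝ, 0 ≤ s ∧ s < t ∧ t ≤ T ∧ r = |X t - X s| / (t - s) ^ η}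

/-- `f : [0,T] → B_θ` is `η`-Hölder continuous. -/
def IsHolderOn (𝓑 : BanachScale) (θ η T : ℝ) (f : ℝ → 𝓑.E) : Prop :=
  ∃ C : ℝ, ∀ s t : ℝ, 0 ≤ s → s ≤ t → t ≤ T → 𝓑.N θ (f t - f s) ≤ C * (t - s) ^ η

/-- The remainder `R^y_{s,t} = y_t - y_s - y'_s X_{s,t}` of a controlled rough path. -/
def gubRemainder (𝓑 : BanachScale) (X : ℝ → ℝ) (y y' : ℝ → 𝓑.E) (s t : ℝ) : 𝓑.E :=
  y t - y s - (X t - X s) • y' s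

/-- `(y, y')` is a controlled rough path in `D^{2α}_{X,γ}([0,T])`:
`y ∈ C([0,T]; B_γ)`, `y' ∈ C([0,T]; B_{γ-α}) ∩ C^α([0,T]; B_{γ-2α})` and the remainder
`R^y ∈ C^α([0,T]; B_{γ-α}) ∩ C^{2α}([0,T]; B_{γ-2α})`. -/
structure IsControlledPath (𝓑 : BanachScale) (α γ T : ℝ) (X : ℝ → ℝ)
    (y y' : ℝ → 𝓑.E) : Prop where
  mem_y : ∀ t : ℝ, 0 ≤ t → t ≤ T → 𝓑.Mem γ (y t)
  mem_y' : ∀ t : ℝ, 0 ≤ t → t ≤ T → 𝓑.Mem (γ - α) (y' t)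
  cont_y : ∀ t : ℝ, 0 ≤ t → t ≤ T → ∀ ε > (0:ℝ), ∃ δ > (0:ℝ), ∀ s : ℝ, 0 ≤ s → s ≤ T →
    |s - t| < δ → 𝓑.N γ (y s - y t) < ε
  cont_y' : ∀ t : ℝ, 0 ≤ t → t ≤ T → ∀ ε > (0:ℝ), ∃ δ > (0:ℝ), ∀ s : ℝ, 0 ≤ s → s ≤ T →
    |s - t| < δ → 𝓑.N (γ - α) (y' s - y' t) < ε
  holder_y' : ∃ C : ℝ, ∀ s t : ℝ, 0 ≤ s → s ≤ t → t ≤ T →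
    𝓑.N (γ - 2 * α) (y' t - y' s) ≤ C * (t - s) ^ α
  rem_alpha : ∃ C : ℝ, ∀ s t : ℝ, 0 ≤ s → s ≤ t → t ≤ T →
    𝓑.N (γ - α) (gubRemainder 𝓑 X y y' s t) ≤ C * (t - s) ^ α
  rem_two_alpha : ∃ C : ℝ, ∀ s t : ℝ, 0 ≤ s → s ≤ t → t ≤ T →
    𝓑.N (γ - 2 * α) (gubRemainder 𝓑 X y y' s t) ≤ C * (t - s) ^ (2 * α)

/-- The norm `‖(y,y')‖_{X,2α,γ}` on `D^{2α}_{X,γ}([0,T])`. -/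
noncomputable def crpNorm (𝓑 : BanachScale) (α γ T : ℝ) (X : ℝ → ℝ)
    (y y' : ℝ → 𝓑.E) : ℝ :=
  scaleSupNorm 𝓑 γ T y + scaleSupNorm 𝓑 (γ - α) T y'
    + scaleHolderNorm 𝓑 (γ - 2 * α) α T y'
    + scaleHolderNorm2 𝓑 (γ - α) α T (gubRemainder 𝓑 X y y')
    + scaleHolderNorm2 𝓑 (γ - 2 * α) (2 * α) T (gubRemainder 𝓑 X y y')

/-- A partition `a = t_0 < t_1 < ⋯ < t_n = b` of the interval `[a,b]`. -/
structure RPartition (a b : ℝ) where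
  n : ℕ
  t : ℕ → ℝ
  n_pos : 0 < n
  strict : ∀ i : ℕ, i < n → t i < t (i + 1)
  first : t 0 = a
  last : t n = b

/-- The mesh `|π|` of a partition. -/
noncomputable def RPartition.mesh {a b : ℝ} (π : RPartition a b) : ℝ :=
  sSup {r : ℝ | ∃ i : ℕ, i < π.n ∧ r = π.t (i + 1) - π.t i}

/-- The compensated Riemann sum `Σ_{[u,v] ∈ π} S(b - u)[y_u X_{u,v} + y'_u X⁽²⁾_{u,v}]`. -/
noncomputable def convRiemannSum (𝓑 : BanachScale) (Sg : ScaleSemigroup 𝓑)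
    (X : ℝ → ℝ) (X2 : ℝ → ℝ → ℝ) (y y' : ℝ → 𝓑.E) {a b : ℝ} (π : RPartition a b) : 𝓑.E :=
  ∑ i ∈ Finset.range π.n,
    Sg.S (b - π.t i)
      ((X (π.t (i + 1)) - X (π.t i)) • y (π.t i) + X2 (π.t i) (π.t (i + 1)) • y' (π.t i))

/-- `I` is the rough convolution `∫_a^b S(b-r) y_r d𝐗_r`, i.e. the limit in `B_θ` of the
compensated Riemann sums over partitions of `[a,b]` with vanishing mesh. -/
def IsRoughConvolution (𝓑 : BanachScale) (Sg : ScaleSemigroup 𝓑) (X : ℝ → ℝ)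
    (X2 : ℝ → ℝ → ℝ) (y y' : ℝ → 𝓑.E) (θ a b : ℝ) (I : 𝓑.E) : Prop :=
  𝓑.Mem θ I ∧ ∀ ε > (0:ℝ), ∃ δ > (0:ℝ), ∀ π : RPartition a b, π.mesh < δ →
    𝓑.N θ (convRiemannSum 𝓑 Sg X X2 y y' π - I) ≤ ε

/-- Left Riemann sum of a `B`-valued function. -/
noncomputable def intRiemannSum (𝓑 : BanachScale) (f : ℝ → 𝓑.E) {a b : ℝ}
    (π : RPartition a b) : 𝓑.E :=
  ∑ i ∈ Finset.range π.n, (π.t (i + 1) - π.t i) • f (π.t i)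

/-- `I = ∫_a^b f(s) ds` as a `B_θ`-valued Riemann integral. -/
def IsRiemannIntegral (𝓑 : BanachScale) (θ : ℝ) (f : ℝ → 𝓑.E) (a b : ℝ) (I : 𝓑.E) : Prop :=
  𝓑.Mem θ I ∧ ∀ ε > (0:ℝ), ∃ δ > (0:ℝ), ∀ π : RPartition a b, π.mesh < δ →
    𝓑.N θ (intRiemannSum 𝓑 f π - I) ≤ ε

/-- Assumption (F): the drift `F : B_γ → B_{γ-δ}` is locally Lipschitz continuous and
satisfies a linear growth condition. -/
structure AssumptionF (𝓑 : BanachScale) (γ δ : ℝ) (F : 𝓑.E → 𝓑.E) : Prop where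
  maps : ∀ x : 𝓑.E, 𝓑.Mem γ x → 𝓑.Mem (γ - δ) (F x)
  locLip : ∀ R > (0:ℝ), ∃ L : ℝ, ∀ x y : 𝓑.E, 𝓑.Mem γ x → 𝓑.Mem γ y →
    𝓑.N γ x ≤ R → 𝓑.N γ y ≤ R → 𝓑.N (γ - δ) (F x - F y) ≤ L * 𝓑.N γ (x - y)
  linGrowth : ∃ C : ℝ, ∀ x : 𝓑.E, 𝓑.Mem γ x → 𝓑.N (γ - δ) (F x) ≤ C * (1 + 𝓑.N γ x)

/-- Assumption (G): for `θ ∈ {0, α, 2α}` the diffusion coefficient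
`G : B_{γ-θ} → B_{γ-θ-σ}` is three times continuously (Fréchet) differentiable with bounded
derivatives `DG`, `D²G`, `D³G`, and the derivative of `x ↦ DG(x)G(x) : B_{γ-α} → B_{γ-2α-σ}`
is bounded. -/
structure AssumptionG (𝓑 : BanachScale) (α σ γ : ℝ) (G : 𝓑.E → 𝓑.E)
    (DG : 𝓑.E → 𝓑.E →ₗ[ℝ] 𝓑.E)
    (D2G : 𝓑.E → 𝓑.E →ₗ[ℝ] 𝓑.E →ₗ[ℝ] 𝓑.E)
    (D3G : 𝓑.E → 𝓑.E →ₗ[ℝ] 𝓑.E →ₗ[ℝ] 𝓑.E →ₗ[ℝ] 𝓑.E) : Prop where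
  maps : ∀ θ ∈ ({0, α, 2 * α} : Set ℝ), ∀ x : 𝓑.E, 𝓑.Mem (γ - θ) x → 𝓑.Mem (γ - θ - σ) (G x)
  DG_maps : ∀ θ ∈ ({0, α, 2 * α} : Set ℝ), ∀ x h : 𝓑.E, 𝓑.Mem (γ - θ) x → 𝓑.Mem (γ - θ) h →
    𝓑.Mem (γ - θ - σ) (DG x h)
  DG_bound : ∀ θ ∈ ({0, α, 2 * α} : Set ℝ), ∃ C : ℝ, ∀ x h : 𝓑.E, 𝓑.Mem (γ - θ) x →
    𝓑.Mem (γ - θ) h → 𝓑.N (γ - θ - σ) (DG x h) ≤ C * 𝓑.N (γ - θ) h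
  DG_isDeriv : ∀ θ ∈ ({0, α, 2 * α} : Set ℝ), ∀ x : 𝓑.E, 𝓑.Mem (γ - θ) x → ∀ ε > (0:ℝ),
    ∃ δ > (0:ℝ), ∀ h : 𝓑.E, 𝓑.Mem (γ - θ) h → 𝓑.N (γ - θ) h < δ →
      𝓑.N (γ - θ - σ) (G (x + h) - G x - DG x h) ≤ ε * 𝓑.N (γ - θ) h
  D2G_maps : ∀ θ ∈ ({0, α, 2 * α} : Set ℝ), ∀ x h k : 𝓑.E, 𝓑.Mem (γ - θ) x →
    𝓑.Mem (γ - θ) h → 𝓑.Mem (γ - θ) k → 𝓑.Mem (γ - θ - σ) (D2G x h k)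
  D2G_bound : ∀ θ ∈ ({0, α, 2 * α} : Set ℝ), ∃ C : ℝ, ∀ x h k : 𝓑.E, 𝓑.Mem (γ - θ) x →
    𝓑.Mem (γ - θ) h → 𝓑.Mem (γ - θ) k →
    𝓑.N (γ - θ - σ) (D2G x h k) ≤ C * (𝓑.N (γ - θ) h * 𝓑.N (γ - θ) k)
  D2G_isDeriv : ∀ θ ∈ ({0, α, 2 * α} : Set ℝ), ∀ x : 𝓑.E, 𝓑.Mem (γ - θ) x → ∀ ε > (0:ℝ),
    ∃ δ > (0:ℝ), ∀ h : 𝓑.E, 𝓑.Mem (γ - θ) h → 𝓑.N (γ - θ) h < δ → ∀ k : 𝓑.E,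
      𝓑.Mem (γ - θ) k →
      𝓑.N (γ - θ - σ) (DG (x + h) k - DG x k - D2G x h k) ≤ ε * (𝓑.N (γ - θ) h * 𝓑.N (γ - θ) k)
  D3G_maps : ∀ θ ∈ ({0, α, 2 * α} : Set ℝ), ∀ x h k l : 𝓑.E, 𝓑.Mem (γ - θ) x →
    𝓑.Mem (γ - θ) h → 𝓑.Mem (γ - θ) k → 𝓑.Mem (γ - θ) l → 𝓑.Mem (γ - θ - σ) (D3G x h k l)
  D3G_bound : ∀ θ ∈ ({0, α, 2 * α} : Set ℝ), ∃ C : ℝ, ∀ x h k l : 𝓑.E, 𝓑.Mem (γ - θ) x →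
    𝓑.Mem (γ - θ) h → 𝓑.Mem (γ - θ) k → 𝓑.Mem (γ - θ) l →
    𝓑.N (γ - θ - σ) (D3G x h k l) ≤ C * (𝓑.N (γ - θ) h * (𝓑.N (γ - θ) k * 𝓑.N (γ - θ) l))
  D3G_isDeriv : ∀ θ ∈ ({0, α, 2 * α} : Set ℝ), ∀ x : 𝓑.E, 𝓑.Mem (γ - θ) x → ∀ ε > (0:ℝ),
    ∃ δ > (0:ℝ), ∀ h : 𝓑.E, 𝓑.Mem (γ - θ) h → 𝓑.N (γ - θ) h < δ → ∀ k l : 𝓑.E,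
      𝓑.Mem (γ - θ) k → 𝓑.Mem (γ - θ) l →
      𝓑.N (γ - θ - σ) (D2G (x + h) k l - D2G x k l - D3G x h k l)
        ≤ ε * (𝓑.N (γ - θ) h * (𝓑.N (γ - θ) k * 𝓑.N (γ - θ) l))
  D3G_cont : ∀ θ ∈ ({0, α, 2 * α} : Set ℝ), ∀ x : 𝓑.E, 𝓑.Mem (γ - θ) x → ∀ ε > (0:ℝ),
    ∃ δ > (0:ℝ), ∀ x' : 𝓑.E, 𝓑.Mem (γ - θ) x' → 𝓑.N (γ - θ) (x' - x) < δ →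
      ∀ h k l : 𝓑.E, 𝓑.Mem (γ - θ) h → 𝓑.Mem (γ - θ) k → 𝓑.Mem (γ - θ) l →
      𝓑.N (γ - θ - σ) (D3G x' h k l - D3G x h k l)
        ≤ ε * (𝓑.N (γ - θ) h * (𝓑.N (γ - θ) k * 𝓑.N (γ - θ) l))
  DGG_deriv_bounded : ∃ (L : 𝓑.E → 𝓑.E →ₗ[ℝ] 𝓑.E) (C : ℝ),
    (∀ x h : 𝓑.E, 𝓑.Mem (γ - α) x → 𝓑.Mem (γ - α) h →
      𝓑.Mem (γ - 2 * α - σ) (L x h) ∧ 𝓑.N (γ - 2 * α - σ) (L x h) ≤ C * 𝓑.N (γ - α) h) ∧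
    ∀ x : 𝓑.E, 𝓑.Mem (γ - α) x → ∀ ε > (0:ℝ), ∃ δ > (0:ℝ), ∀ h : 𝓑.E, 𝓑.Mem (γ - α) h →
      𝓑.N (γ - α) h < δ →
      𝓑.N (γ - 2 * α - σ) (DG (x + h) (G (x + h)) - DG x (G x) - L x h) ≤ ε * 𝓑.N (γ - α) h

/-- `y` is a (mild) solution on `[0,T']` of the rough evolution equation
`dy = (Ay + F(y))dt + G(y)d𝐗`, `y(0) = y₀`: the pair `(y, G(y))` is a controlled rough
path in `D^{2α}_{X,γ}([0,T'])` and the mild formulation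
`y_t = S(t)y₀ + ∫₀ᵗ S(t-s)F(y_s)ds + ∫₀ᵗ S(t-s)G(y_s)d𝐗_s` holds, the rough convolution
being the limit of the compensated Riemann sums
`Σ S(t-u)[G(y_u)X_{u,v} + DG(y_u)G(y_u)X⁽²⁾_{u,v}]`. -/
structure IsSolution (𝓑 : BanachScale) (Sg : ScaleSemigroup 𝓑) (α γ : ℝ)
    (X : ℝ → ℝ) (X2 : ℝ → ℝ → ℝ) (F G : 𝓑.E → 𝓑.E) (DG : 𝓑.E → 𝓑.E →ₗ[ℝ] 𝓑.E)
    (y₀ : 𝓑.E) (T' : ℝ) (y : ℝ → 𝓑.E) : Prop where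
  controlled : IsControlledPath 𝓑 α γ T' X y fun t => G (y t)
  init : y 0 = y₀
  mild : ∀ t : ℝ, 0 < t → t ≤ T' → ∃ D Z : 𝓑.E,
    IsRiemannIntegral 𝓑 γ (fun s => Sg.S (t - s) (F (y s))) 0 t D ∧
    IsRoughConvolution 𝓑 Sg X X2 (fun s => G (y s)) (fun s => DG (y s) (G (y s)))
      (γ - 2 * α) 0 t Z ∧
    y t = Sg.S t y₀ + D + Z

/-- The Borel σ-algebra of `B_θ`, generated by the `|·|_θ`-balls of `B_θ`,
as a σ-algebra on the ambient space. -/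
def scaleBorel (𝓑 : BanachScale) (θ : ℝ) : MeasurableSpace 𝓑.E :=
  MeasurableSpace.generateFrom
    {s : Set 𝓑.E | ∃ (c : 𝓑.E) (r : ℝ), s = {x | 𝓑.Mem θ x ∧ 𝓑.N θ (x - c) < r}}


namespace RPDE

/-! ### Bounded membership calculus -/

/-- `x ∈ B_θ` with `|x|_θ ≤ c`. -/
def Bd (𝓑 : BanachScale) (θ : ℝ) (x : 𝓑.E) (c : ℝ) : Prop := 𝓑.Mem θ x ∧ 𝓑.N θ x ≤ c

section Basic

variable {𝓑 : BanachScale} {θ : ℝ} {x y : 𝓑.E} {c d : ℝ}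

theorem Bd.nonneg (h : Bd 𝓑 θ x c) : 0 ≤ c := (𝓑.N_nonneg θ x).trans h.2

theorem Bd.add (h : Bd 𝓑 θ x c) (h2 : Bd 𝓑 θ y d) : Bd 𝓑 θ (x + y) (c + d) :=
  ⟨𝓑.mem_add _ _ _ h.1 h2.1, (𝓑.N_add _ _ _ h.1 h2.1).trans (add_le_add h.2 h2.2)⟩

theorem N_neg (θ : ℝ) (x : 𝓑.E) : 𝓑.N θ (-x) = 𝓑.N θ x := by
  have := 𝓑.N_smul θ (-1) x
  simpa using this

theorem Bd.neg (h : Bd 𝓑 θ x c) : Bd 𝓑 θ (-x) c :=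
  ⟨𝓑.mem_neg _ _ h.1, by rw [N_neg]; exact h.2⟩

theorem Bd.sub (h : Bd 𝓑 θ x c) (h2 : Bd 𝓑 θ y d) : Bd 𝓑 θ (x - y) (c + d) := by
  rw [sub_eq_add_neg]; exact h.add h2.neg

theorem Bd.mono (h : Bd 𝓑 θ x c) (hcd : c ≤ d) : Bd 𝓑 θ x d := ⟨h.1, h.2.trans hcd⟩

theorem Bd.congr (h : Bd 𝓑 θ x c) (hxy : y = x) : Bd 𝓑 θ y c := hxy ▸ h

theorem Bd.smul (h : Bd 𝓑 θ x c) {r : ℝ} (hr : |r| ≤ d) : Bd 𝓑 θ (r • x) (d * c) :=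
  ⟨𝓑.mem_smul _ _ _ h.1, by
    rw [𝓑.N_smul]
    exact mul_le_mul hr h.2 (𝓑.N_nonneg _ _) ((abs_nonneg _).trans hr)⟩

theorem Bd.zero (hc : 0 ≤ c) : Bd 𝓑 θ 0 c := ⟨𝓑.mem_zero θ, by rw [𝓑.N_zero]; exact hc⟩

theorem Bd.of_mem (h : 𝓑.Mem θ x) : Bd 𝓑 θ x (𝓑.N θ x) := ⟨h, le_rfl⟩

theorem Bd.symm (h : Bd 𝓑 θ (x - y) c) : Bd 𝓑 θ (y - x) c := h.neg.congr (by abel)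

theorem mem_sub (hx : 𝓑.Mem θ x) (hy : 𝓑.Mem θ y) : 𝓑.Mem θ (x - y) :=
  ((Bd.of_mem hx).sub (Bd.of_mem hy)).1

theorem Bd.sum {ι : Type*} (s : Finset ι) (f : ι → 𝓑.E) (g : ι → ℝ)
    (h : ∀ i ∈ s, Bd 𝓑 θ (f i) (g i)) : Bd 𝓑 θ (∑ i ∈ s, f i) (∑ i ∈ s, g i) := by
  classical
  induction s using Finset.induction_on with
  | empty => simpa using Bd.zero le_rfl
  | insert a s ha ih =>
    rw [Finset.sum_insert ha, Finset.sum_insert ha]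
    exact (h a (Finset.mem_insert_self a s)).add
      (ih fun i hi => h i (Finset.mem_insert_of_mem hi))

theorem Bd.eq_zero (h : ∀ ε > 0, Bd 𝓑 θ x ε) : x = 0 := by
  refine 𝓑.N_eq_zero θ x (h 1 one_pos).1 (le_antisymm ?_ (𝓑.N_nonneg _ _))
  exact le_of_forall_pos_le_add fun ε hε => by simpa using (h ε hε).2

theorem Bd.eq_zero' (h : Bd 𝓑 θ x 0) : x = 0 := Bd.eq_zero fun _ hε => h.mono hε.le

theorem Bd.eq_of_sub (h : ∀ ε > 0, Bd 𝓑 θ (x - y) ε) : x = y := sub_eq_zero.mp (Bd.eq_zero h)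

theorem Bd.of_forall (h : ∀ ε > 0, Bd 𝓑 θ x (c + ε)) : Bd 𝓑 θ x c :=
  ⟨(h 1 one_pos).1, le_of_forall_pos_le_add fun ε hε => (h ε hε).2⟩

theorem Bd.tendsto_zero {e : ℕ → ℝ} (he : Filter.Tendsto e Filter.atTop (nhds 0))
    (h : ∀ n, Bd 𝓑 θ x (e n)) : x = 0 :=
  Bd.eq_zero fun ε hε => by
    obtain ⟨n, hn⟩ := (he.eventually (gt_mem_nhds hε)).exists
    exact (h n).mono hn.le

theorem Bd.tendsto_le {e : ℕ → ℝ} (he : Filter.Tendsto e Filter.atTop (nhds c))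
    (h : ∀ n, Bd 𝓑 θ x (e n)) : Bd 𝓑 θ x c :=
  ⟨(h 0).1, ge_of_tendsto' he fun n => (h n).2⟩

theorem Bd.lim {e : ℕ → ℝ} {u : ℕ → 𝓑.E} (he : Filter.Tendsto e Filter.atTop (nhds 0))
    (hu : ∀ n, Bd 𝓑 θ (u n) c) (h : ∀ n, Bd 𝓑 θ (u n - x) (e n)) : Bd 𝓑 θ x c := by
  refine Bd.tendsto_le (e := fun n => c + e n) (by simpa using he.const_add c) fun n => ?_
  exact ((hu n).sub (h n)).congr (by abel)

theorem Bd.complete {e : ℕ → ℝ} {u : ℕ → 𝓑.E} (he : Filter.Tendsto e Filter.atTop (nhds 0))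
    (hm : ∀ n, 𝓑.Mem θ (u n))
    (h : ∀ n m, n ≤ m → Bd 𝓑 θ (u m - u n) (e n)) :
    ∃ x, 𝓑.Mem θ x ∧ ∀ n, Bd 𝓑 θ (u n - x) (e n) := by
  obtain ⟨x, hx, hl⟩ := 𝓑.complete θ u hm (by
    intro ε hε
    obtain ⟨M, hM⟩ := (he.eventually (gt_mem_nhds (half_pos hε))).exists
    refine ⟨M, fun m hm n hn => ?_⟩
    have := ((h M m hm).sub (h M n hn))
    have h3 : Bd 𝓑 θ (u m - u n) (e M + e M) := this.congr (by abel)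
    exact lt_of_le_of_lt h3.2 (by linarith))
  refine ⟨x, hx, fun n => Bd.of_forall fun ε hε => ?_⟩
  obtain ⟨M, hM⟩ := hl ε hε
  have h1 := h n (max n M) (le_max_left _ _)
  have h2 : Bd 𝓑 θ (u (max n M) - x) ε :=
    ⟨mem_sub (hm _) hx, (hM _ (le_max_right _ _)).le⟩
  exact (h2.sub h1).mono (by linarith) |>.congr (by abel)

theorem Bd.emb {θ₁ θ₂ : ℝ} (hle : θ₁ ≤ θ₂) (𝓑 : BanachScale) :
    ∃ C : ℝ, 1 ≤ C ∧ ∀ x c, Bd 𝓑 θ₂ x c → Bd 𝓑 θ₁ x (C * c) := by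
  obtain ⟨C, hC, h⟩ := 𝓑.embed_bound hle
  refine ⟨max C 1, le_max_right _ _, fun x c hx => ⟨𝓑.mem_mono hle x hx.1, ?_⟩⟩
  exact (h x hx.1).trans (mul_le_mul (le_max_left _ _) hx.2 (𝓑.N_nonneg _ _)
    (hC.le.trans (le_max_left _ _)))

/-- Sum of a geometric series converging in a weaker space. -/
theorem Bd.series {θ₁ θ₂ q : ℝ} (hle : θ₁ ≤ θ₂) (hq : 0 ≤ q) (hq1 : q < 1) {w : ℕ → 𝓑.E}
    (hw : ∀ k, Bd 𝓑 θ₂ (w k) (c * q ^ k)) {e : ℕ → ℝ}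
    (he : Filter.Tendsto e Filter.atTop (nhds 0))
    (hx : ∀ n, Bd 𝓑 θ₁ (x - ∑ k ∈ Finset.range n, w k) (e n)) :
    Bd 𝓑 θ₂ x (c / (1 - q)) := by
  have hc : 0 ≤ c := by simpa using (hw 0).nonneg
  have h1q : 0 < 1 - q := by linarith
  have key : ∀ n m, Bd 𝓑 θ₂ (∑ k ∈ Finset.range (n + m), w k - ∑ k ∈ Finset.range n, w k)
      (c / (1 - q) * q ^ n) := by
    intro n m
    rw [Finset.sum_range_add, add_sub_cancel_left]
    refine (Bd.sum _ _ _ fun k _ => hw (n + k)).mono ?_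
    have : ∑ k ∈ Finset.range m, c * q ^ (n + k) = c * q ^ n * ∑ k ∈ Finset.range m, q ^ k := by
      rw [Finset.mul_sum]; refine Finset.sum_congr rfl fun k _ => ?_; rw [pow_add]; ring
    rw [this]
    have hs : ∑ k ∈ Finset.range m, q ^ k ≤ 1 / (1 - q) := by
      rw [geom_sum_eq hq1.ne]
      rw [← neg_div_neg_eq, neg_sub, neg_sub]
      gcongr
      have := pow_nonneg hq m
      linarith
    calc c * q ^ n * ∑ k ∈ Finset.range m, q ^ k ≤ c * q ^ n * (1 / (1 - q)) := by gcongr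
      _ = _ := by ring
  have hlim : Filter.Tendsto (fun n : ℕ => c / (1 - q) * q ^ n) Filter.atTop (nhds 0) := by
    simpa using (tendsto_pow_atTop_nhds_zero_of_lt_one hq hq1).const_mul (c / (1 - q))
  obtain ⟨V, hV, hVl⟩ := Bd.complete (u := fun n => ∑ k ∈ Finset.range n, w k) hlim
    (fun n => (Bd.sum _ _ _ fun k _ => hw k).1)
    (fun n m hnm => by
      obtain ⟨p, rfl⟩ := Nat.exists_eq_add_of_le hnm
      exact key n p)
  obtain ⟨C, _, hC⟩ := Bd.emb hle 𝓑
  have hxV : x = V := by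
    refine sub_eq_zero.mp (Bd.tendsto_zero (θ := θ₁)
      (e := fun n => e n + C * (c / (1 - q) * q ^ n)) ?_ fun n => ?_)
    · simpa using he.add (hlim.const_mul C)
    · exact ((hx n).add (hC _ _ (hVl n))).congr (by abel)
  have := hVl 0
  rw [hxV]
  simp only [Finset.range_zero, Finset.sum_empty, zero_sub, pow_zero, mul_one] at this
  exact this.neg.congr (by abel)

end Basic

/-! ### The spaces as Mathlib Banach spaces -/

/-- `B_θ` as a submodule of the ambient space. -/
def sub (𝓑 : BanachScale) (θ : ℝ) : Submodule ℝ 𝓑.E where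
  carrier := {x | 𝓑.Mem θ x}
  add_mem' := fun {a b} ha hb => 𝓑.mem_add θ a b ha hb
  zero_mem' := 𝓑.mem_zero θ
  smul_mem' := fun c x hx => 𝓑.mem_smul θ c x hx

/-- `B_θ` as a type. -/
def Sp (𝓑 : BanachScale) (θ : ℝ) : Type := sub 𝓑 θ

/-- Element of `B_θ`. -/
def Sp.mk {𝓑 : BanachScale} {θ : ℝ} (x : 𝓑.E) (hx : 𝓑.Mem θ x) : Sp 𝓑 θ := ⟨x, hx⟩

noncomputable instance (𝓑 : BanachScale) (θ : ℝ) : AddCommGroup (Sp 𝓑 θ) :=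
  inferInstanceAs (AddCommGroup (sub 𝓑 θ))

noncomputable instance (𝓑 : BanachScale) (θ : ℝ) : Module ℝ (Sp 𝓑 θ) :=
  inferInstanceAs (Module ℝ (sub 𝓑 θ))

noncomputable instance (𝓑 : BanachScale) (θ : ℝ) : Norm (Sp 𝓑 θ) := ⟨fun x => 𝓑.N θ x.1⟩

theorem Sp.norm_def {𝓑 : BanachScale} {θ : ℝ} (x : Sp 𝓑 θ) : ‖x‖ = 𝓑.N θ x.1 := rfl

theorem Sp.core (𝓑 : BanachScale) (θ : ℝ) : NormedSpace.Core ℝ (Sp 𝓑 θ) where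
  norm_nonneg := fun x => 𝓑.N_nonneg θ x.1
  norm_smul := fun c x => 𝓑.N_smul θ c x.1
  norm_triangle := fun x y => 𝓑.N_add θ x.1 y.1 x.2 y.2
  norm_eq_zero_iff := fun x => by
    constructor
    · intro h; exact Subtype.ext (𝓑.N_eq_zero θ x.1 x.2 h)
    · rintro rfl; exact 𝓑.N_zero θ

noncomputable instance (𝓑 : BanachScale) (θ : ℝ) : NormedAddCommGroup (Sp 𝓑 θ) :=
  NormedAddCommGroup.ofCore (Sp.core 𝓑 θ)

noncomputable instance (𝓑 : BanachScale) (θ : ℝ) : NormedSpace ℝ (Sp 𝓑 θ) :=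
  NormedSpace.ofCore (Sp.core 𝓑 θ)

instance (𝓑 : BanachScale) (θ : ℝ) : CompleteSpace (Sp 𝓑 θ) := by
  refine Metric.complete_of_cauchySeq_tendsto fun u hu => ?_
  obtain ⟨x, hx, hl⟩ := 𝓑.complete θ (fun n => (u n).1) (fun n => (u n).2) (by
    intro ε hε
    obtain ⟨M, hM⟩ := Metric.cauchySeq_iff.mp hu ε hε
    refine ⟨M, fun m hm n hn => ?_⟩
    have := hM m hm n hn
    rw [dist_eq_norm] at this
    exact this)
  refine ⟨Sp.mk x hx, Metric.tendsto_atTop.mpr fun ε hε => ?_⟩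
  obtain ⟨M, hM⟩ := hl ε hε
  refine ⟨M, fun n hn => ?_⟩
  rw [dist_eq_norm]
  exact hM n hn

/-- The coercion to the ambient space as a linear map. -/
def Sp.val (𝓑 : BanachScale) (θ : ℝ) : Sp 𝓑 θ →ₗ[ℝ] 𝓑.E := (sub 𝓑 θ).subtype

theorem Sp.val_mem {𝓑 : BanachScale} {θ : ℝ} (x : Sp 𝓑 θ) : 𝓑.Mem θ (Sp.val 𝓑 θ x) := x.2

theorem Sp.norm_val {𝓑 : BanachScale} {θ : ℝ} (x : Sp 𝓑 θ) : 𝓑.N θ (Sp.val 𝓑 θ x) = ‖x‖ := rfl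

theorem Sp.val_mk {𝓑 : BanachScale} {θ : ℝ} (x : 𝓑.E) (hx : 𝓑.Mem θ x) :
    Sp.val 𝓑 θ (Sp.mk x hx) = x := rfl

theorem Sp.val_inj {𝓑 : BanachScale} {θ : ℝ} {x y : Sp 𝓑 θ}
    (h : Sp.val 𝓑 θ x = Sp.val 𝓑 θ y) : x = y := Subtype.ext h

/-- Mean value inequality. -/
theorem mean_value {𝓑 : BanachScale} {θ c : ℝ} {f f' : ℝ → 𝓑.E}
    (hf : ∀ r ∈ Icc (0:ℝ) 1, 𝓑.Mem θ (f r))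
    (hf' : ∀ r ∈ Icc (0:ℝ) 1, Bd 𝓑 θ (f' r) c)
    (hd : ∀ r ∈ Icc (0:ℝ) 1, ∀ ε > 0, ∃ η > 0, ∀ r' ∈ Icc (0:ℝ) 1, |r' - r| < η →
      𝓑.N θ (f r' - f r - (r' - r) • f' r) ≤ ε * |r' - r|) :
    Bd 𝓑 θ (f 1 - f 0) c := by
  classical
  have h0 : (0:ℝ) ∈ Icc (0:ℝ) 1 := by simp
  have h1 : (1:ℝ) ∈ Icc (0:ℝ) 1 := by simp
  let g : ℝ → Sp 𝓑 θ := fun r => if h : r ∈ Icc (0:ℝ) 1 then Sp.mk (f r) (hf r h) else 0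
  let g' : ℝ → Sp 𝓑 θ := fun r => if h : r ∈ Icc (0:ℝ) 1 then Sp.mk (f' r) (hf' r h).1 else 0
  have hg : ∀ r (h : r ∈ Icc (0:ℝ) 1), g r = Sp.mk (f r) (hf r h) := fun r h => dif_pos h
  have hg' : ∀ r (h : r ∈ Icc (0:ℝ) 1), g' r = Sp.mk (f' r) (hf' r h).1 := fun r h => dif_pos h
  have key := (convex_Icc (0:ℝ) 1).norm_image_sub_le_of_norm_hasDerivWithin_le
    (f := g) (f' := g') (C := c) (x := 0) (y := 1)
    (by
      intro r hr
      rw [hasDerivWithinAt_iff_isLittleO, Asymptotics.isLittleO_iff]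
      intro ε hε
      obtain ⟨η, hη, H⟩ := hd r hr ε hε
      filter_upwards [self_mem_nhdsWithin,
        mem_nhdsWithin_of_mem_nhds (Metric.ball_mem_nhds r hη)] with r' hr' hb
      rw [hg r hr, hg r' hr', hg' r hr]
      exact H r' hr' hb)
    (by
      intro r hr
      rw [hg' r hr]
      exact (hf' r hr).2)
    h0 h1
  rw [hg 0 h0, hg 1 h1] at key
  refine ⟨mem_sub (hf 1 h1) (hf 0 h0), ?_⟩
  rw [sub_zero, norm_one, mul_one] at key
  exact key

end RPDE


namespace RPDE

/-! ### Semigroup estimates and the context of uniform constants -/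

theorem finite_unif {ι : Type*} {s : Set ι} (hs : s.Finite) {P : ι → ℝ → Prop}
    (hmono : ∀ i, ∀ C C' : ℝ, 0 ≤ C → C ≤ C' → P i C → P i C')
    (h : ∀ i ∈ s, ∃ C : ℝ, 1 ≤ C ∧ P i C) : ∃ C : ℝ, 1 ≤ C ∧ ∀ i ∈ s, P i C := by
  induction s, hs using Set.Finite.induction_on with
  | empty => exact ⟨1, le_rfl, by simp⟩
  | @insert a s _ _ ih =>
    obtain ⟨C1, h1, hC1⟩ := h a (Set.mem_insert _ _)
    obtain ⟨C2, h2, hC2⟩ := ih fun i hi => h i (Set.mem_insert_of_mem _ hi)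
    refine ⟨max C1 C2, h1.trans (le_max_left _ _), fun i hi => ?_⟩
    rcases Set.mem_insert_iff.mp hi with rfl | hi
    · exact hmono _ _ _ (by linarith) (le_max_left _ _) hC1
    · exact hmono _ _ _ (by linarith) (le_max_right _ _) (hC2 i hi)

section Semi

variable {𝓑 : BanachScale} (Sg : ScaleSemigroup 𝓑)

theorem sb_exists (θ T : ℝ) (hT : 0 < T) : ∃ C : ℝ, 1 ≤ C ∧ ∀ t x c, 0 ≤ t → t ≤ T →
    Bd 𝓑 θ x c → Bd 𝓑 θ (Sg.S t x) (C * c) := by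
  obtain ⟨C, hC, h⟩ := Sg.S_bounded θ T hT
  refine ⟨max C 1, le_max_right _ _, fun t x c ht htT hx => ⟨Sg.S_mem _ _ _ ht hx.1, ?_⟩⟩
  exact (h t x ht htT hx.1).trans (mul_le_mul (le_max_left _ _) hx.2 (𝓑.N_nonneg _ _)
    (hC.le.trans (le_max_left _ _)))

theorem sm_exists1 (θ κ T : ℝ) (hT : 0 < T) (hκ : 0 ≤ κ) (hκ1 : κ ≤ 1) :
    ∃ C : ℝ, 1 ≤ C ∧ ∀ t x c, 0 < t → t ≤ T →
    Bd 𝓑 θ x c → Bd 𝓑 (θ + κ) (Sg.S t x) (C * t ^ (-κ) * c) := by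
  obtain ⟨C, hC, h⟩ := Sg.S_smoothing θ κ T hκ hκ1 hT
  refine ⟨max C 1, le_max_right _ _, fun t x c ht htT hx => ?_⟩
  obtain ⟨h1, h2⟩ := h t x ht htT hx.1
  refine ⟨h1, h2.trans ?_⟩
  have := Real.rpow_nonneg ht.le (-κ)
  have := hx.2
  have := 𝓑.N_nonneg θ x
  gcongr
  exact le_max_left _ _

theorem sm_exists (θ κ T : ℝ) (hT : 0 < T) (hκ : 0 ≤ κ) (hκ1 : κ ≤ 2) :
    ∃ C : ℝ, 1 ≤ C ∧ ∀ t x c, 0 < t → t ≤ T →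
    Bd 𝓑 θ x c → Bd 𝓑 (θ + κ) (Sg.S t x) (C * t ^ (-κ) * c) := by
  obtain ⟨C1, h1, H1⟩ := sm_exists1 Sg θ (κ / 2) T hT (by linarith) (by linarith)
  obtain ⟨C2, h2, H2⟩ := sm_exists1 Sg (θ + κ / 2) (κ / 2) T hT (by linarith) (by linarith)
  have h2κ : (1:ℝ) ≤ 2 ^ κ := Real.one_le_rpow (by norm_num) hκ
  refine ⟨C2 * C1 * 2 ^ κ, one_le_mul_of_one_le_of_one_le (one_le_mul_of_one_le_of_one_le h2 h1)
    h2κ, fun t x c ht htT hx => ?_⟩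
  have a1 := H1 (t / 2) x c (by linarith) (by linarith) hx
  have a2 := H2 (t / 2) _ _ (by linarith) (by linarith) a1
  rw [← Sg.S_comp _ _ (by linarith) (by linarith), add_halves] at a2
  rw [show θ + κ / 2 + κ / 2 = θ + κ by ring] at a2
  refine a2.mono (le_of_eq ?_)
  have e1 : (t / 2) ^ (-(κ / 2)) * (t / 2) ^ (-(κ / 2)) = t ^ (-κ) * 2 ^ κ := by
    rw [← Real.rpow_add (by linarith), Real.div_rpow ht.le (by norm_num),
      show -(κ / 2) + -(κ / 2) = -κ by ring, Real.rpow_neg (by norm_num : (0:ℝ) ≤ 2)]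
    field_simp
  calc _ = C2 * C1 * ((t / 2) ^ (-(κ / 2)) * (t / 2) ^ (-(κ / 2))) * c := by ring
    _ = _ := by rw [e1]; ring

theorem hd_exists (θ κ T : ℝ) (hT : 0 < T) (hκ : 0 ≤ κ) (hκ1 : κ ≤ 1) :
    ∃ C : ℝ, 1 ≤ C ∧ ∀ t x c, 0 ≤ t → t ≤ T →
    Bd 𝓑 (θ + κ) x c → Bd 𝓑 θ (Sg.S t x - x) (C * t ^ κ * c) := by
  obtain ⟨C, hC, h⟩ := Sg.S_holdId θ κ T hκ hκ1 hT
  refine ⟨max C 1, le_max_right _ _, fun t x c ht htT hx => ?_⟩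
  have hc := hx.nonneg
  have h5 : 0 ≤ C * t ^ κ * c := by have := Real.rpow_nonneg ht κ; positivity
  have h6 : 0 ≤ max C 1 * t ^ κ * c := by have := Real.rpow_nonneg ht κ; positivity
  have hxm := 𝓑.mem_mono (show θ ≤ θ + κ by linarith) x hx.1
  refine ⟨mem_sub (Sg.S_mem _ _ _ ht hxm) hxm, ?_⟩
  rcases ht.eq_or_lt with rfl | ht
  · rw [Sg.S_id, sub_self, 𝓑.N_zero]; exact h6
  · refine (h t x ht htT hx.1).trans ?_
    have := Real.rpow_nonneg ht.le κ
    have := hx.2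
    have := 𝓑.N_nonneg (θ + κ) x
    gcongr
    exact le_max_left _ _

end Semi

/-- The finite set of regularity levels. -/
def Lv (α γ δ σ : ℝ) : Set ℝ :=
  {γ, γ - σ, γ - α, γ - α - σ, γ - 2 * α, γ - 2 * α - σ, γ - δ}

theorem Lv_finite (α γ δ σ : ℝ) : (Lv α γ δ σ).Finite := by
  unfold Lv; exact Set.toFinite _

section
variable {α γ δ σ : ℝ}
theorem Lv.g : γ ∈ Lv α γ δ σ := by simp [Lv]
theorem Lv.gs : γ - σ ∈ Lv α γ δ σ := by simp [Lv]
theorem Lv.ga : γ - α ∈ Lv α γ δ σ := by simp [Lv]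
theorem Lv.gas : γ - α - σ ∈ Lv α γ δ σ := by simp [Lv]
theorem Lv.g2 : γ - 2 * α ∈ Lv α γ δ σ := by simp [Lv]
theorem Lv.g2s : γ - 2 * α - σ ∈ Lv α γ δ σ := by simp [Lv]
theorem Lv.gd : γ - δ ∈ Lv α γ δ σ := by simp [Lv]
end

/-- All standing data with one uniform constant `C`. -/
structure Ctx (𝓑 : BanachScale) (Sg : ScaleSemigroup 𝓑) (α β γ δ σ T : ℝ)
    (X : ℝ → ℝ) (X2 : ℝ → ℝ → ℝ) (C : ℝ) : Prop where
  hα : 1 / 3 < α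
  hα2 : α < 1 / 2
  hσ : 0 ≤ σ
  hσα : σ < α
  hT : 0 < T
  hδ : 2 * α ≤ δ
  hδ1 : δ < 1
  hβ : β < α
  hβ3 : 1 < 3 * β
  hβz : 2 * α + σ < 3 * β
  one_le : 1 ≤ C
  emb : ∀ θ₁ ∈ Lv α γ δ σ, ∀ θ₂ ∈ Lv α γ δ σ, θ₁ ≤ θ₂ → ∀ x c, Bd 𝓑 θ₂ x c → Bd 𝓑 θ₁ x (C * c)
  sb : ∀ θ ∈ Lv α γ δ σ, ∀ t x c, 0 ≤ t → t ≤ T → Bd 𝓑 θ x c → Bd 𝓑 θ (Sg.S t x) (C * c)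
  sm : ∀ θ₁ ∈ Lv α γ δ σ, ∀ θ₂ ∈ Lv α γ δ σ, ∀ κ, 0 ≤ κ → κ ≤ 2 → θ₂ = θ₁ + κ →
    ∀ t x c, 0 < t → t ≤ T → Bd 𝓑 θ₁ x c → Bd 𝓑 θ₂ (Sg.S t x) (C * t ^ (-κ) * c)
  hd : ∀ θ₁ ∈ Lv α γ δ σ, ∀ θ₂ ∈ Lv α γ δ σ, ∀ κ, 0 ≤ κ → κ ≤ 1 → θ₂ = θ₁ + κ →
    ∀ t x c, 0 ≤ t → t ≤ T → Bd 𝓑 θ₂ x c → Bd 𝓑 θ₁ (Sg.S t x - x) (C * t ^ κ * c)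
  hX : ∀ s t, 0 ≤ s → s ≤ t → t ≤ T → |X t - X s| ≤ C * (t - s) ^ α
  hX2 : ∀ s t, 0 ≤ s → s ≤ t → t ≤ T → |X2 s t| ≤ C * (t - s) ^ (2 * α)
  chen : ∀ s u t : ℝ, 0 ≤ s → s ≤ u → u ≤ t → t ≤ T →
    X2 s t - X2 s u - X2 u t = (X u - X s) * (X t - X u)
  pw : ∀ d e e' : ℝ, 0 ≤ d → d ≤ T → 0 ≤ e' → e' ≤ e → e ≤ 3 → d ^ e ≤ C * d ^ e'

theorem exists_ctx {𝓑 : BanachScale} (Sg : ScaleSemigroup 𝓑) {α β γ δ σ T : ℝ}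
    (RP : RoughPath α T) (hα : 1 / 3 < α) (hα2 : α < 1 / 2) (hσ : 0 ≤ σ) (hσα : σ < α)
    (hT : 0 < T) (hδ : 2 * α ≤ δ) (hδ1 : δ < 1) (hβ : β < α) (hβ3 : 1 < 3 * β)
    (hβz : 2 * α + σ < 3 * β) : ∃ C, Ctx 𝓑 Sg α β γ δ σ T RP.X RP.X2 C := by
  have hfin := Lv_finite α γ δ σ
  have hfin2 := hfin.prod hfin
  obtain ⟨C1, h1, H1⟩ := finite_unif hfin2 (P := fun p C => p.1 ≤ p.2 →
      ∀ x c, Bd 𝓑 p.2 x c → Bd 𝓑 p.1 x (C * c))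
    (fun p C C' _ hC h hle x c hx => (h hle x c hx).mono (by have := hx.nonneg; gcongr))
    (fun p _ => by
      by_cases hle : p.1 ≤ p.2
      · obtain ⟨C, hC, h⟩ := Bd.emb hle 𝓑
        exact ⟨C, hC, fun _ => h⟩
      · exact ⟨1, le_rfl, fun h => absurd h hle⟩)
  obtain ⟨C2, h2, H2⟩ := finite_unif hfin (P := fun θ C =>
      ∀ t x c, 0 ≤ t → t ≤ T → Bd 𝓑 θ x c → Bd 𝓑 θ (Sg.S t x) (C * c))
    (fun p C C' _ hC h t x c ht htT hx =>
      (h t x c ht htT hx).mono (by have := hx.nonneg; gcongr))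
    (fun p _ => sb_exists Sg p T hT)
  obtain ⟨C3, h3, H3⟩ := finite_unif hfin2 (P := fun p C => ∀ κ, 0 ≤ κ → κ ≤ 2 → p.2 = p.1 + κ →
      ∀ t x c, 0 < t → t ≤ T → Bd 𝓑 p.1 x c → Bd 𝓑 p.2 (Sg.S t x) (C * t ^ (-κ) * c))
    (fun p C C' _ hC h κ hκ hκ1 he t x c ht htT hx => (h κ hκ hκ1 he t x c ht htT hx).mono (by
      have := hx.nonneg
      have := Real.rpow_nonneg ht.le (-κ)
      gcongr))
    (fun p _ => by
      by_cases hle : 0 ≤ p.2 - p.1 ∧ p.2 - p.1 ≤ 2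
      · obtain ⟨C, hC, h⟩ := sm_exists Sg p.1 (p.2 - p.1) T hT hle.1 hle.2
        refine ⟨C, hC, fun κ hκ hκ1 he t x c ht htT hx => ?_⟩
        obtain rfl : κ = p.2 - p.1 := by linarith
        have := h t x c ht htT hx
        rwa [add_sub_cancel] at this
      · exact ⟨1, le_rfl, fun κ hκ hκ1 he => absurd ⟨by linarith, by linarith⟩ hle⟩)
  obtain ⟨C4, h4, H4⟩ := finite_unif hfin2 (P := fun p C => ∀ κ, 0 ≤ κ → κ ≤ 1 → p.2 = p.1 + κ →
      ∀ t x c, 0 ≤ t → t ≤ T → Bd 𝓑 p.2 x c → Bd 𝓑 p.1 (Sg.S t x - x) (C * t ^ κ * c))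
    (fun p C C' _ hC h κ hκ hκ1 he t x c ht htT hx => (h κ hκ hκ1 he t x c ht htT hx).mono (by
      have := hx.nonneg
      have := Real.rpow_nonneg ht κ
      gcongr))
    (fun p _ => by
      by_cases hle : 0 ≤ p.2 - p.1 ∧ p.2 - p.1 ≤ 1
      · obtain ⟨C, hC, h⟩ := hd_exists Sg p.1 (p.2 - p.1) T hT hle.1 hle.2
        refine ⟨C, hC, fun κ hκ hκ1 he t x c ht htT hx => ?_⟩
        obtain rfl : κ = p.2 - p.1 := by linarith
        rw [add_sub_cancel] at h
        exact h t x c ht htT hx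
      · exact ⟨1, le_rfl, fun κ hκ hκ1 he => absurd ⟨by linarith, by linarith⟩ hle⟩)
  obtain ⟨C5, H5⟩ := RP.holderX
  obtain ⟨C6, H6⟩ := RP.holderX2
  have hT1 : 1 ≤ max 1 T := le_max_left _ _
  have h7 : 1 ≤ (max 1 T) ^ (3:ℝ) := Real.one_le_rpow hT1 (by norm_num)
  set C7 := (max 1 T) ^ (3:ℝ) with hC7
  refine ⟨C1 + C2 + C3 + C4 + |C5| + |C6| + C7, hα, hα2, hσ, hσα, hT, hδ, hδ1, hβ, hβ3, hβz,
    ?_, ?_, ?_, ?_, ?_, ?_, ?_, RP.chen, ?_⟩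
  · linarith [abs_nonneg C5, abs_nonneg C6]
  · intro θ₁ m1 θ₂ m2 hle x c hx
    refine (H1 (θ₁, θ₂) ⟨m1, m2⟩ hle x c hx).mono ?_
    have := hx.nonneg
    gcongr
    linarith [abs_nonneg C5, abs_nonneg C6]
  · intro θ m t x c ht htT hx
    refine (H2 θ m t x c ht htT hx).mono ?_
    have := hx.nonneg
    gcongr
    linarith [abs_nonneg C5, abs_nonneg C6]
  · intro θ₁ m1 θ₂ m2 κ hκ hκ1 he t x c ht htT hx
    refine (H3 (θ₁, θ₂) ⟨m1, m2⟩ κ hκ hκ1 he t x c ht htT hx).mono ?_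
    have := hx.nonneg
    have := Real.rpow_nonneg ht.le (-κ)
    gcongr
    linarith [abs_nonneg C5, abs_nonneg C6]
  · intro θ₁ m1 θ₂ m2 κ hκ hκ1 he t x c ht htT hx
    refine (H4 (θ₁, θ₂) ⟨m1, m2⟩ κ hκ hκ1 he t x c ht htT hx).mono ?_
    have := hx.nonneg
    have := Real.rpow_nonneg ht κ
    gcongr
    linarith [abs_nonneg C5, abs_nonneg C6]
  · intro s t hs hst htT
    refine (H5 s t hs hst htT).trans ?_
    have := Real.rpow_nonneg (sub_nonneg.mpr hst) α
    gcongr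
    linarith [abs_nonneg C5, abs_nonneg C6, le_abs_self C5]
  · intro s t hs hst htT
    refine (H6 s t hs hst htT).trans ?_
    have := Real.rpow_nonneg (sub_nonneg.mpr hst) (2 * α)
    gcongr
    linarith [abs_nonneg C5, abs_nonneg C6, le_abs_self C6]
  · intro d e e' hd hdT he' hee he3
    have hd' := Real.rpow_nonneg hd e'
    refine le_trans (b := C7 * d ^ e') ?_ (by
      gcongr; linarith [abs_nonneg C5, abs_nonneg C6])
    rcases hd.eq_or_lt with rfl | hd
    · rcases he'.eq_or_lt with rfl | he'
      · rw [Real.rpow_zero, mul_one]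
        exact (Real.rpow_le_one le_rfl zero_le_one hee).trans h7
      · rw [Real.zero_rpow (by linarith), Real.zero_rpow he'.ne', mul_zero]
    · have : d ^ e = d ^ (e - e') * d ^ e' := by rw [← Real.rpow_add hd]; ring_nf
      rw [this]
      gcongr
      calc d ^ (e - e') ≤ (max 1 T) ^ (e - e') :=
            Real.rpow_le_rpow hd.le (hdT.trans (le_max_right _ _)) (by linarith)
        _ ≤ C7 := Real.rpow_le_rpow_of_exponent_le hT1 (by linarith)

end RPDE


namespace RPDE

/-! ### Abstract sewing -/

section Sewing

variable {𝓑 : BanachScale} {θ z c a b : ℝ} {A : ℝ → ℝ → 𝓑.E}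

/-- Almost additivity of a two-parameter map. -/
def AlmostAdd (𝓑 : BanachScale) (θ z c a b : ℝ) (A : ℝ → ℝ → 𝓑.E) : Prop :=
  ∀ u m v, a ≤ u → u ≤ m → m ≤ v → v ≤ b → Bd 𝓑 θ (A u v - A u m - A m v) (c * (v - u) ^ z)

theorem AlmostAdd.diag (h : AlmostAdd 𝓑 θ z c a b A) (hz : 1 < z) (u : ℝ) (hu : a ≤ u)
    (hub : u ≤ b) : A u u = 0 := by
  have := h u u u hu le_rfl le_rfl hub
  rw [sub_self (A u u), zero_sub, sub_self, Real.zero_rpow (by linarith), mul_zero] at this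
  exact neg_eq_zero.mp this.eq_zero'

/-- The sewing constant. -/
noncomputable def kap (z : ℝ) : ℝ := 2 / (1 - 2 ^ (1 - z))

theorem kap_pos_aux (hz : 1 < z) : (0:ℝ) < 1 - 2 ^ (1 - z) := by
  have : (2:ℝ) ^ (1 - z) < 1 := Real.rpow_lt_one_of_one_lt_of_neg (by norm_num) (by linarith)
  linarith

theorem kap_pos (hz : 1 < z) : 0 < kap z := div_pos two_pos (kap_pos_aux hz)

theorem AlmostAdd.seq_bound (h : AlmostAdd 𝓑 θ z c a b A) (hz : 1 < z) (hc : 0 ≤ c)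
    {p : ℕ → ℝ} (hp : Monotone p) (hpa : ∀ i, a ≤ p i) (hpb : ∀ i, p i ≤ b) (n i : ℕ) :
    Bd 𝓑 θ (∑ k ∈ Finset.range n, A (p (i + k)) (p (i + k + 1)) - A (p i) (p (i + n)))
      (kap z * c * (p (i + n) - p i) ^ z) := by
  have hk := kap_pos hz
  induction n using Nat.strong_induction_on generalizing i with
  | _ n ih =>
  rcases Nat.eq_zero_or_pos n with rfl | hn
  · simp only [Finset.range_zero, Finset.sum_empty, add_zero, sub_self, zero_sub]
    rw [h.diag hz _ (hpa i) (hpb i), Real.zero_rpow (by linarith)]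
    simpa using Bd.zero le_rfl
  · classical
    set L := p (i + n) - p i with hL
    have hL0 : 0 ≤ L := sub_nonneg.mpr (hp (by omega))
    set j := Nat.findGreatest (fun j => p (i + j) - p i ≤ L / 2) (n - 1) with hj
    have hj1 : j ≤ n - 1 := Nat.findGreatest_le _
    have hj2 : p (i + j) - p i ≤ L / 2 :=
      Nat.findGreatest_spec (P := fun j => p (i + j) - p i ≤ L / 2) (m := 0) (Nat.zero_le _)
        (by simp; linarith)
    obtain ⟨m, hm⟩ : ∃ m, n = j + 1 + m := ⟨n - (j + 1), by omega⟩
    have hj3 : p (i + n) - p (i + j + 1) ≤ L / 2 := by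
      rcases Nat.eq_zero_or_pos m with h0 | hm0
      · rw [hm, h0, show i + (j + 1 + 0) = i + j + 1 by omega, sub_self]; linarith
      · have := Nat.findGreatest_is_greatest (P := fun j => p (i + j) - p i ≤ L / 2)
          (n := n - 1) (k := j + 1) (by omega) (by omega)
        rw [not_le] at this
        rw [show i + j + 1 = i + (j + 1) by omega]
        linarith
    have b1 := ih j (by omega) i
    have b2 := ih m (by omega) (i + j + 1)
    have e1 : i + j + 1 + m = i + n := by omega
    rw [e1] at b2
    have b3 := h (p i) (p (i + j)) (p (i + n)) (hpa _) (hp (by omega)) (hp (by omega)) (hpb _)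
    have b4 := h (p (i + j)) (p (i + j + 1)) (p (i + n)) (hpa _) (hp (by omega))
      (hp (by omega)) (hpb _)
    have hsum : ∑ k ∈ Finset.range n, A (p (i + k)) (p (i + k + 1)) =
        ∑ k ∈ Finset.range j, A (p (i + k)) (p (i + k + 1)) + A (p (i + j)) (p (i + j + 1)) +
        ∑ k ∈ Finset.range m, A (p (i + j + 1 + k)) (p (i + j + 1 + k + 1)) := by
      rw [hm, Finset.sum_range_add, Finset.sum_range_succ]
      congr 1
      refine Finset.sum_congr rfl fun k _ => ?_
      rw [show i + (j + 1 + k) = i + j + 1 + k by omega]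
    have bb := ((b1.add b2).sub b3).sub b4
    refine (bb.congr ?_).mono ?_
    · rw [hsum]; abel
    · have hmono1 : p i ≤ p (i + j) := hp (by omega)
      have hmono2 : p (i + j + 1) ≤ p (i + n) := hp (by omega)
      have g1 : (p (i + j) - p i) ^ z ≤ (L / 2) ^ z :=
        Real.rpow_le_rpow (by linarith) hj2 (by linarith)
      have g2 : (p (i + n) - p (i + j + 1)) ^ z ≤ (L / 2) ^ z :=
        Real.rpow_le_rpow (by linarith) hj3 (by linarith)
      have g4 : (p (i + n) - p (i + j)) ^ z ≤ L ^ z :=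
        Real.rpow_le_rpow (sub_nonneg.mpr (hp (by omega))) (by linarith) (by linarith)
      have g5 : (L / 2) ^ z = L ^ z * (2 ^ (1 - z) / 2) := by
        rw [Real.div_rpow hL0 (by norm_num), Real.rpow_sub (by norm_num), Real.rpow_one]
        field_simp
      have hLz := Real.rpow_nonneg hL0 z
      have hkc : 0 ≤ kap z * c := by positivity
      have hkap : kap z * (1 - 2 ^ (1 - z)) = 2 := by
        rw [kap, div_mul_cancel₀ _ (kap_pos_aux hz).ne']
      calc _ ≤ kap z * c * (L / 2) ^ z + kap z * c * (L / 2) ^ z + c * L ^ z + c * L ^ z := by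
            gcongr
        _ = c * L ^ z * (kap z - kap z * (1 - 2 ^ (1 - z)) + 2) := by rw [g5]; ring
        _ = _ := by rw [hkap]; ring

theorem sum_double (f : ℕ → 𝓑.E) (N : ℕ) :
    ∑ k ∈ Finset.range (2 * N), f k = ∑ k ∈ Finset.range N, (f (2 * k) + f (2 * k + 1)) := by
  induction N with
  | zero => simp
  | succ N ih =>
    rw [show 2 * (N + 1) = 2 * N + 1 + 1 by ring, Finset.sum_range_succ, Finset.sum_range_succ, ih,
      Finset.sum_range_succ]
    abel

/-- Dyadic grid. -/
noncomputable def grid (a b : ℝ) (n k : ℕ) : ℝ := a + k * ((b - a) / 2 ^ n)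

theorem grid_mono (hab : a ≤ b) (n : ℕ) : Monotone (grid a b n) := by
  intro i j hij
  unfold grid
  have : (0:ℝ) ≤ (b - a) / 2 ^ n := div_nonneg (by linarith) (by positivity)
  have : (i:ℝ) ≤ j := by exact_mod_cast hij
  gcongr

theorem grid_succ (n k : ℕ) : grid a b n (k + 1) - grid a b n k = (b - a) / 2 ^ n := by
  unfold grid; push_cast; ring

theorem grid_zero (n : ℕ) : grid a b n 0 = a := by unfold grid; simp

theorem grid_ge (hab : a ≤ b) (n k : ℕ) : a ≤ grid a b n k := by
  have := grid_mono hab n (Nat.zero_le k); rwa [grid_zero] at this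

theorem grid_last (n : ℕ) : grid a b n (2 ^ n) = b := by
  unfold grid; push_cast; field_simp; ring

theorem grid_double (n k : ℕ) : grid a b (n + 1) (2 * k) = grid a b n k := by
  unfold grid; push_cast; rw [pow_succ]; field_simp

theorem min_sub_min_le {x y v : ℝ} (h : x ≤ y) : min y v - min x v ≤ y - x := by
  rcases le_total y v with h1 | h1 <;> rcases le_total x v with h2 | h2 <;>
    simp [h1, h2] <;> linarith

theorem rpow_split {x h z : ℝ} (hx : 0 ≤ x) (hxh : x ≤ h) (hz : 1 < z) :
    x ^ z ≤ h ^ (z - 1) * x := by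
  have : x ^ z = x ^ (z - 1) * x := by
    rcases hx.eq_or_lt with rfl | hx
    · rw [Real.zero_rpow (by linarith), mul_zero]
    · rw [← Real.rpow_add_one hx.ne', sub_add_cancel]
  rw [this]
  gcongr

/-- Dyadic approximations of the sewn path. -/
noncomputable def Jn (A : ℝ → ℝ → 𝓑.E) (a b : ℝ) (n : ℕ) (v : ℝ) : 𝓑.E :=
  ∑ k ∈ Finset.range (2 ^ n), A (min (grid a b n k) v) (min (grid a b n (k + 1)) v)

theorem sewing (h : AlmostAdd 𝓑 θ z c a b A) (hz : 1 < z) (hc : 0 ≤ c) (hab : a ≤ b)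
    (hA : ∀ u v, a ≤ u → u ≤ v → v ≤ b → 𝓑.Mem θ (A u v)) :
    ∃ J : ℝ → 𝓑.E, ∀ u v, a ≤ u → u ≤ v → v ≤ b →
      Bd 𝓑 θ (J v - J u - A u v) (kap z * c * (v - u) ^ z) := by
  set L := b - a with hL
  have hL0 : 0 ≤ L := by linarith
  have hq0 : (0:ℝ) ≤ (1 / 2) ^ (z - 1) := by positivity
  set q : ℝ := (1 / 2) ^ (z - 1) with hq
  have hq1 : q < 1 := Real.rpow_lt_one (by norm_num) (by norm_num) (by linarith)
  have h1q : 0 < 1 - q := by linarith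
  have hmesh : ∀ n : ℕ, (L / 2 ^ n) ^ (z - 1) = L ^ (z - 1) * q ^ n := by
    intro n
    rw [div_eq_mul_one_div, Real.mul_rpow hL0 (by positivity), ← one_div_pow, hq,
      ← Real.rpow_natCast, ← Real.rpow_natCast, ← Real.rpow_mul (by norm_num),
      ← Real.rpow_mul (by norm_num), mul_comm (z - 1)]
  have hLn : ∀ n : ℕ, (0:ℝ) ≤ L / 2 ^ n := fun n => by positivity
  have hmem : ∀ n v, a ≤ v → v ≤ b → 𝓑.Mem θ (Jn A a b n v) := by
    intro n v hv hvb
    refine (Bd.sum _ _ _ fun k _ => Bd.of_mem (hA _ _ (le_min ?_ hv) ?_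
      ((min_le_right _ _).trans hvb))).1
    · exact grid_ge hab n _
    · exact min_le_min_right _ (grid_mono hab n (Nat.le_succ _))
  have hlow : ∀ n k v, a ≤ v → a ≤ min (grid a b n k) v := fun n k v hv => by
    refine le_min ?_ hv
    exact grid_ge hab n _
  -- consecutive levels
  have hstep : ∀ n v, a ≤ v → v ≤ b →
      Bd 𝓑 θ (Jn A a b (n + 1) v - Jn A a b n v) (c * L * L ^ (z - 1) * q ^ n) := by
    intro n v hv hvb
    have e : Jn A a b (n + 1) v - Jn A a b n v = ∑ k ∈ Finset.range (2 ^ n),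
        -(A (min (grid a b n k) v) (min (grid a b n (k + 1)) v)
          - A (min (grid a b n k) v) (min (grid a b (n + 1) (2 * k + 1)) v)
          - A (min (grid a b (n + 1) (2 * k + 1)) v) (min (grid a b n (k + 1)) v)) := by
      unfold Jn
      rw [show 2 ^ (n + 1) = 2 * 2 ^ n by ring, sum_double, ← Finset.sum_sub_distrib]
      refine Finset.sum_congr rfl fun k _ => ?_
      rw [show 2 * k + 1 + 1 = 2 * (k + 1) by ring, grid_double, grid_double]
      abel
    refine Bd.congr ?_ e
    refine (Bd.sum _ _ (fun k => c * (L / 2 ^ n) ^ (z - 1) * (L / 2 ^ n)) fun k _ => ?_).mono ?_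
    · have m1 : grid a b n k ≤ grid a b (n + 1) (2 * k + 1) := by
        rw [← grid_double]; exact grid_mono hab _ (by omega)
      have m2 : grid a b (n + 1) (2 * k + 1) ≤ grid a b n (k + 1) := by
        rw [← grid_double (k := k + 1)]; exact grid_mono hab _ (by omega)
      refine (h _ _ _ (hlow n k v hv) (min_le_min_right _ m1) (min_le_min_right _ m2)
        ((min_le_right _ _).trans hvb)).neg.mono ?_
      rw [mul_assoc]
      refine mul_le_mul_of_nonneg_left ?_ hc
      have hd : min (grid a b n (k + 1)) v - min (grid a b n k) v ≤ L / 2 ^ n := by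
        have := min_sub_min_le (v := v) (m1.trans m2)
        rwa [grid_succ] at this
      have hd0 : 0 ≤ min (grid a b n (k + 1)) v - min (grid a b n k) v :=
        sub_nonneg.mpr (min_le_min_right _ (m1.trans m2))
      refine (rpow_split hd0 hd hz).trans ?_
      have := hLn n
      gcongr
    · rw [Finset.sum_const, Finset.card_range, nsmul_eq_mul, hmesh]
      push_cast
      apply le_of_eq
      field_simp
  -- limit
  have hex : ∀ v, ∃ x, a ≤ v → v ≤ b → 𝓑.Mem θ x ∧
      ∀ n, Bd 𝓑 θ (Jn A a b n v - x) (c * L * L ^ (z - 1) / (1 - q) * q ^ n) := by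
    intro v
    by_cases hv : a ≤ v ∧ v ≤ b
    · have hlim : Filter.Tendsto (fun n : ℕ => c * L * L ^ (z - 1) / (1 - q) * q ^ n)
          Filter.atTop (nhds 0) := by
        simpa using (tendsto_pow_atTop_nhds_zero_of_lt_one hq0 hq1).const_mul
          (c * L * L ^ (z - 1) / (1 - q))
      obtain ⟨x, hx, hxl⟩ := Bd.complete (u := fun n => Jn A a b n v) hlim
        (fun n => hmem n v hv.1 hv.2) (fun n m hnm => by
          obtain ⟨p, rfl⟩ := Nat.exists_eq_add_of_le hnm
          have : Jn A a b (n + p) v - Jn A a b n v =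
              ∑ k ∈ Finset.range p, (Jn A a b (n + k + 1) v - Jn A a b (n + k) v) := by
            exact (Finset.sum_range_sub (fun k => Jn A a b (n + k) v) p).symm
          refine (Bd.congr (Bd.sum _ _ _ fun k _ => hstep (n + k) v hv.1 hv.2) this).mono ?_
          have hs : ∑ k ∈ Finset.range p, q ^ k ≤ 1 / (1 - q) := by
            rw [geom_sum_eq hq1.ne, ← neg_div_neg_eq, neg_sub, neg_sub]
            gcongr
            have := pow_nonneg hq0 p
            linarith
          have hLz : 0 ≤ L ^ (z - 1) := Real.rpow_nonneg hL0 _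
          calc ∑ k ∈ Finset.range p, c * L * L ^ (z - 1) * q ^ (n + k)
              = c * L * L ^ (z - 1) * q ^ n * ∑ k ∈ Finset.range p, q ^ k := by
                rw [Finset.mul_sum]
                refine Finset.sum_congr rfl fun k _ => ?_
                rw [pow_add]; ring
            _ ≤ c * L * L ^ (z - 1) * q ^ n * (1 / (1 - q)) := by gcongr
            _ = _ := by ring)
      exact ⟨x, fun _ _ => ⟨hx, hxl⟩⟩
    · exact ⟨0, fun h1 h2 => absurd ⟨h1, h2⟩ hv⟩
  choose J hJ using hex
  refine ⟨J, fun u v hu huv hvb => ?_⟩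
  set D := c * L * L ^ (z - 1) with hD
  have hfin : ∀ n : ℕ, Bd 𝓑 θ (J v - J u - A u v)
      (kap z * c * (v - u) ^ z + (D / (1 - q) * q ^ n + D / (1 - q) * q ^ n + D * q ^ n)) := by
    intro n
    have hv1 := (hJ v (hu.trans huv) hvb).2 n
    have hu1 := (hJ u hu (huv.trans hvb)).2 n
    set p : ℕ → ℝ := fun k => max u (min (grid a b n k) v) with hp
    have hpm : Monotone p := fun i j hij =>
      max_le_max le_rfl (min_le_min_right _ (grid_mono hab n hij))
    have hpa : ∀ i, a ≤ p i := fun i => hu.trans (le_max_left _ _)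
    have hpb : ∀ i, p i ≤ b := fun i => max_le (huv.trans hvb) ((min_le_right _ _).trans hvb)
    have hs := h.seq_bound hz hc hpm hpa hpb (2 ^ n) 0
    have p0 : p 0 = u := by
      simp only [hp, grid_zero]
      exact max_eq_left ((min_le_left _ _).trans hu)
    have p1 : p (0 + 2 ^ n) = v := by
      simp only [hp, zero_add, grid_last]
      rw [min_eq_right hvb, max_eq_right huv]
    rw [p0, p1] at hs
    have hdiff : Bd 𝓑 θ (Jn A a b n v - Jn A a b n u -
        ∑ k ∈ Finset.range (2 ^ n), A (p (0 + k)) (p (0 + k + 1))) (D * q ^ n) := by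
      unfold Jn
      rw [← Finset.sum_sub_distrib, ← Finset.sum_sub_distrib]
      refine (Bd.sum _ _ (fun k => c * (L / 2 ^ n) ^ (z - 1) * (L / 2 ^ n))
        fun k _ => ?_).mono ?_
      · have hpos : 0 ≤ c * (L / 2 ^ n) ^ (z - 1) * (L / 2 ^ n) := by
          have := Real.rpow_nonneg (hLn n) (z - 1)
          have := hLn n
          positivity
        have hg : grid a b n k ≤ grid a b n (k + 1) := grid_mono hab n (Nat.le_succ _)
        simp only [hp, zero_add]
        rcases le_total (grid a b n (k + 1)) u with h1 | h1
        · have h1v := h1.trans huv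
          have h2 := hg.trans h1
          have h2v := h2.trans huv
          rw [min_eq_left h1v, min_eq_left h2v, min_eq_left h1, min_eq_left h2, max_eq_left h1,
            max_eq_left h2, h.diag hz u hu (huv.trans hvb), sub_self, sub_zero]
          exact Bd.zero hpos
        · rcases le_total u (grid a b n k) with h2 | h2
          · rw [min_eq_right h1, min_eq_right h2, h.diag hz u hu (huv.trans hvb), sub_zero,
              max_eq_right (le_min h2 huv), max_eq_right (le_min h1 huv), sub_self]
            exact Bd.zero hpos
          · rw [min_eq_left (h2.trans huv), min_eq_right h1, min_eq_left h2, max_eq_left h2,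
              max_eq_right (le_min h1 huv)]
            have hga : a ≤ grid a b n k := by
              exact grid_ge hab n _
            refine (h _ _ _ hga h2 (le_min h1 huv) ((min_le_right _ _).trans hvb)).mono ?_
            rw [mul_assoc]
            refine mul_le_mul_of_nonneg_left ?_ hc
            have hd : min (grid a b n (k + 1)) v - grid a b n k ≤ L / 2 ^ n := by
              have := grid_succ (a := a) (b := b) n k
              have := min_le_left (grid a b n (k + 1)) v
              linarith
            have hd0 : 0 ≤ min (grid a b n (k + 1)) v - grid a b n k :=
              sub_nonneg.mpr (le_min hg (h2.trans huv))
            refine (rpow_split hd0 hd hz).trans ?_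
            have := hLn n
            gcongr
      · rw [Finset.sum_const, Finset.card_range, nsmul_eq_mul, hmesh]
        push_cast
        apply le_of_eq
        rw [hD]
        field_simp
    refine ((((hs.add hdiff).sub hv1).add hu1).congr ?_).mono (by linarith)
    abel
  refine Bd.tendsto_le ?_ hfin
  have hl := tendsto_pow_atTop_nhds_zero_of_lt_one hq0 hq1
  have := ((hl.const_mul (D / (1 - q))).add (hl.const_mul (D / (1 - q)))).add (hl.const_mul D)
  simpa using this.const_add (kap z * c * (v - u) ^ z)

/-- A path with superlinear increments is constant. -/
theorem const_of_super {h : ℝ → 𝓑.E} {s u : ℝ} (hsu : s ≤ u) (hz : 1 < z)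
    (H : ∀ w v, s ≤ w → w ≤ v → v ≤ u → Bd 𝓑 θ (h v - h w) (c * (v - w) ^ z)) : h u = h s := by
  have hc : ∀ n : ℕ, Bd 𝓑 θ (h u - h s) (c * (u - s) * (u - s) ^ (z - 1) *
      ((1 / 2 : ℝ) ^ (z - 1)) ^ n) := by
    intro n
    have e : h u - h s = ∑ k ∈ Finset.range (2 ^ n),
        (h (grid s u n (k + 1)) - h (grid s u n k)) := by
      rw [Finset.sum_range_sub (fun k => h (grid s u n k)), grid_last, grid_zero]
    refine Bd.congr ?_ e
    have hd : (0:ℝ) ≤ u - s := by linarith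
    refine (Bd.sum _ _ (fun k => c * ((u - s) / 2 ^ n) ^ z) fun k hk => ?_).mono ?_
    · have := H (grid s u n k) (grid s u n (k + 1)) ?_ (grid_mono hsu n (Nat.le_succ _)) ?_
      · rwa [grid_succ] at this
      · have := grid_mono hsu n (Nat.zero_le k); rwa [grid_zero] at this
      · have := grid_mono hsu n (Finset.mem_range.mp hk); rwa [grid_last] at this
    · rw [Finset.sum_const, Finset.card_range, nsmul_eq_mul]
      push_cast
      apply le_of_eq
      have e1 : ((u - s) / 2 ^ n) ^ z = ((u - s) / 2 ^ n) ^ (z - 1) * ((u - s) / 2 ^ n) := by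
        rcases (div_nonneg hd (by positivity : (0:ℝ) ≤ 2 ^ n)).eq_or_lt with h0 | h0
        · rw [← h0, Real.zero_rpow (by linarith), mul_zero]
        · rw [← Real.rpow_add_one h0.ne', sub_add_cancel]
      have e2 : ((u - s) / 2 ^ n) ^ (z - 1) = (u - s) ^ (z - 1) * ((1 / 2 : ℝ) ^ (z - 1)) ^ n := by
        rw [div_eq_mul_one_div, Real.mul_rpow hd (by positivity), ← one_div_pow,
          ← Real.rpow_natCast, ← Real.rpow_natCast, ← Real.rpow_mul (by norm_num),
          ← Real.rpow_mul (by norm_num), mul_comm (z - 1)]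
      rw [e1, e2]
      field_simp
  refine sub_eq_zero.mp (Bd.tendsto_zero ?_ hc)
  have hq1 : ((1 / 2 : ℝ) ^ (z - 1)) < 1 :=
    Real.rpow_lt_one (by norm_num) (by norm_num) (by linarith)
  simpa using (tendsto_pow_atTop_nhds_zero_of_lt_one (by positivity) hq1).const_mul
    (c * (u - s) * (u - s) ^ (z - 1))

end Sewing

end RPDE


namespace RPDE

/-! ### Rough convolutions -/

/-- Integrand class. -/
structure IB (𝓑 : BanachScale) (α β γ σ : ℝ) (X : ℝ → ℝ) (a b : ℝ) (Y Y' : ℝ → 𝓑.E) (K : ℝ) :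
    Prop where
  y : ∀ t, a ≤ t → t ≤ b → Bd 𝓑 (γ - σ) (Y t) K
  y' : ∀ t, a ≤ t → t ≤ b → Bd 𝓑 (γ - α - σ) (Y' t) K
  hy' : ∀ s t, a ≤ s → s ≤ t → t ≤ b → Bd 𝓑 (γ - 2 * α - σ) (Y' t - Y' s) (K * (t - s) ^ β)
  r : ∀ s t, a ≤ s → s ≤ t → t ≤ b →
    Bd 𝓑 (γ - 2 * α - σ) (gubRemainder 𝓑 X Y Y' s t) (K * (t - s) ^ (2 * β))

/-- Local germ of the rough convolution. -/
noncomputable def cA {𝓑 : BanachScale} (Sg : ScaleSemigroup 𝓑) (X : ℝ → ℝ) (X2 : ℝ → ℝ → ℝ)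
    (Y Y' : ℝ → 𝓑.E) (t u v : ℝ) : 𝓑.E :=
  Sg.S (t - u) ((X v - X u) • Y u + X2 u v • Y' u)

/-- Defect of the germ. -/
noncomputable def cE {𝓑 : BanachScale} (Sg : ScaleSemigroup 𝓑) (X : ℝ → ℝ) (X2 : ℝ → ℝ → ℝ)
    (Y Y' : ℝ → 𝓑.E) (u m v : ℝ) : 𝓑.E :=
  Sg.S (m - u) ((X v - X m) • (Y u + (X m - X u) • Y' u) + X2 m v • Y' u)
    - (X v - X m) • Y m - X2 m v • Y' m

section Conv

variable {𝓑 : BanachScale} {Sg : ScaleSemigroup 𝓑} {α β γ δ σ T : ℝ}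
    {X : ℝ → ℝ} {X2 : ℝ → ℝ → ℝ} {C : ℝ} {a b K : ℝ} {Y Y' : ℝ → 𝓑.E}

theorem IB.nonneg (hI : IB 𝓑 α β γ σ X a b Y Y' K) (hab : a ≤ b) : 0 ≤ K :=
  (hI.y a le_rfl hab).nonneg

theorem Ctx.C0 (h : Ctx 𝓑 Sg α β γ δ σ T X X2 C) : 0 ≤ C := zero_le_one.trans h.one_le

theorem Ctx.β0 (h : Ctx 𝓑 Sg α β γ δ σ T X X2 C) : 0 < β := by linarith [h.hβ3]

/-- Product of powers. -/
theorem Ctx.pw2 (h : Ctx 𝓑 Sg α β γ δ σ T X X2 C) {d e1 e2 e' : ℝ} (hd : 0 ≤ d) (hdT : d ≤ T)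
    (h1 : 0 ≤ e1) (h2 : 0 ≤ e2) (h' : 0 ≤ e') (hle : e' ≤ e1 + e2) (h3 : e1 + e2 ≤ 3) :
    d ^ e1 * d ^ e2 ≤ C * d ^ e' := by
  rw [← Real.rpow_add_of_nonneg hd h1 h2]
  exact h.pw d _ _ hd hdT h' hle h3

theorem Ctx.hXd (h : Ctx 𝓑 Sg α β γ δ σ T X X2 C) {m v d : ℝ} (hm : 0 ≤ m) (hmv : m ≤ v)
    (hv : v ≤ T) (hd : v - m ≤ d) : |X v - X m| ≤ C * d ^ α := by
  refine (h.hX m v hm hmv hv).trans ?_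
  have := h.C0
  have := h.hα
  have := sub_nonneg.mpr hmv
  gcongr

theorem Ctx.hX2d (h : Ctx 𝓑 Sg α β γ δ σ T X X2 C) {m v d : ℝ} (hm : 0 ≤ m) (hmv : m ≤ v)
    (hv : v ≤ T) (hd : v - m ≤ d) : |X2 m v| ≤ C * d ^ (2 * α) := by
  refine (h.hX2 m v hm hmv hv).trans ?_
  have := h.C0
  have := h.hα
  have := sub_nonneg.mpr hmv
  gcongr

theorem Ctx.hdd (h : Ctx 𝓑 Sg α β γ δ σ T X X2 C) {θ₁ θ₂ κ : ℝ} (m1 : θ₁ ∈ Lv α γ δ σ)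
    (m2 : θ₂ ∈ Lv α γ δ σ) (h0 : 0 ≤ κ) (h1 : κ ≤ 1) (he : θ₂ = θ₁ + κ) {t d c : ℝ} {x : 𝓑.E}
    (ht : 0 ≤ t) (htd : t ≤ d) (htT : t ≤ T) (hx : Bd 𝓑 θ₂ x c) :
    Bd 𝓑 θ₁ (Sg.S t x - x) (C * d ^ κ * c) := by
  refine (h.hd θ₁ m1 θ₂ m2 κ h0 h1 he t x c ht htT hx).mono ?_
  have := h.C0
  have := hx.nonneg
  gcongr

theorem cA_delta (h : Ctx 𝓑 Sg α β γ δ σ T X X2 C) {t u m v : ℝ} (hu : 0 ≤ u) (hum : u ≤ m)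
    (hmv : m ≤ v) (hvt : v ≤ t) (hv : v ≤ T) :
    cA Sg X X2 Y Y' t u v - cA Sg X X2 Y Y' t u m - cA Sg X X2 Y Y' t m v =
      Sg.S (t - m) (cE Sg X X2 Y Y' u m v) := by
  unfold cA cE
  have e1 : ∀ x, Sg.S (t - u) x = Sg.S (t - m) (Sg.S (m - u) x) := fun x => by
    rw [← Sg.S_comp _ _ (by linarith) (by linarith)]; congr 2; ring
  have e2 : X2 u v = X2 u m + X2 m v + (X m - X u) * (X v - X m) := by
    have := h.chen u m v hu hum hmv hv; linarith
  rw [e1, e1, ← map_sub, ← map_sub, ← map_sub, e2]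
  congr 1
  rw [sub_sub]
  congr 2
  module

theorem cE_bd (h : Ctx 𝓑 Sg α β γ δ σ T X X2 C) (ha : 0 ≤ a) (hb : b ≤ T)
    (hI : IB 𝓑 α β γ σ X a b Y Y' K) {u m v : ℝ} (hu : a ≤ u) (hum : u ≤ m) (hmv : m ≤ v)
    (hv : v ≤ b) : Bd 𝓑 (γ - 2 * α - σ) (cE Sg X X2 Y Y' u m v)
      (5 * C ^ 4 * K * (v - u) ^ (3 * β)) := by
  have hK := hI.nonneg (by linarith : a ≤ b)
  have hC := h.C0
  have hC1 := h.one_le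
  have hα := h.hα
  have hα2 := h.hα2
  have hβ := h.hβ
  have hβ3 := h.hβ3
  have hσα := h.hσα
  set d := v - u with hd
  have hd0 : 0 ≤ d := by linarith
  have hdT : d ≤ T := by linarith
  have x1 := h.hXd (m := m) (v := v) (d := d) (by linarith) hmv (by linarith) (by linarith)
  have x2 := h.hX2d (m := m) (v := v) (d := d) (by linarith) hmv (by linarith) (by linarith)
  have x3 := h.hXd (m := u) (v := m) (d := d) (by linarith) hum (by linarith) (by linarith)
  have t1 := (hI.r u m hu hum (by linarith)).smul x1
  have t2 := (hI.hy' u m hu hum (by linarith)).smul x2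
  have yu := hI.y u hu (by linarith)
  have yu' := hI.y' u hu (by linarith)
  have t3 := h.hdd (κ := 2 * α) Lv.g2s Lv.gs (by linarith) (by linarith) (by ring)
    (t := m - u) (d := d) (by linarith) (by linarith) (by linarith) (yu.smul x1)
  have t4 := h.hdd (κ := α) Lv.g2s Lv.gas (by linarith) (by linarith) (by ring)
    (t := m - u) (d := d) (by linarith) (by linarith) (by linarith) ((yu'.smul x3).smul x1)
  have t5 := h.hdd (κ := α) Lv.g2s Lv.gas (by linarith) (by linarith) (by ring)
    (t := m - u) (d := d) (by linarith) (by linarith) (by linarith) (yu'.smul x2)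
  refine ((((t3.add t4).add t5).sub (t1.add t2)).congr ?_).mono ?_
  · unfold cE gubRemainder
    simp only [map_add, map_smul, smul_add, smul_sub]
    abel
  · have hz := Real.rpow_nonneg hd0 (3 * β)
    have m1 : (m - u) ^ (2 * β) ≤ d ^ (2 * β) :=
      Real.rpow_le_rpow (by linarith) (by linarith) (by linarith)
    have m2 : (m - u) ^ β ≤ d ^ β :=
      Real.rpow_le_rpow (by linarith) (by linarith) (by linarith)
    have p1 : d ^ α * d ^ (2 * β) ≤ C * d ^ (3 * β) := h.pw2 hd0 hdT (by linarith) (by linarith)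
      (by linarith) (by linarith) (by linarith)
    have p2 : d ^ (2 * α) * d ^ β ≤ C * d ^ (3 * β) := h.pw2 hd0 hdT (by linarith) (by linarith)
      (by linarith) (by linarith) (by linarith)
    have p3 : d ^ (2 * α) * d ^ α ≤ C * d ^ (3 * β) := h.pw2 hd0 hdT (by linarith) (by linarith)
      (by linarith) (by linarith) (by linarith)
    have p4 : d ^ α * (d ^ α * d ^ α) ≤ C * d ^ (3 * β) := by
      rw [← Real.rpow_add_of_nonneg hd0 (by linarith) (by linarith)]
      exact h.pw2 hd0 hdT (by linarith) (by linarith)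
        (by linarith) (by linarith) (by linarith)
    set Z := d ^ (3 * β)
    have dα := Real.rpow_nonneg hd0 α
    have dα2 := Real.rpow_nonneg hd0 (2 * α)
    have dβ := Real.rpow_nonneg hd0 β
    have dβ2 := Real.rpow_nonneg hd0 (2 * β)
    have c2 : C ^ 2 ≤ C ^ 4 := pow_le_pow_right₀ hC1 (by norm_num)
    have c3 : C ^ 3 ≤ C ^ 4 := pow_le_pow_right₀ hC1 (by norm_num)
    have hKZ : 0 ≤ K * Z := mul_nonneg hK hz
    calc _ ≤ C * d ^ (2 * α) * (C * d ^ α * K) + C * d ^ α * (C * d ^ α * (C * d ^ α * K)) +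
          C * d ^ α * (C * d ^ (2 * α) * K) +
          (C * d ^ α * (K * d ^ (2 * β)) + C * d ^ (2 * α) * (K * d ^ β)) := by gcongr
      _ = C ^ 2 * K * (d ^ (2 * α) * d ^ α) + C ^ 3 * K * (d ^ α * (d ^ α * d ^ α)) +
          C ^ 2 * K * (d ^ (2 * α) * d ^ α) +
          (C * K * (d ^ α * d ^ (2 * β)) + C * K * (d ^ (2 * α) * d ^ β)) := by ring
      _ ≤ C ^ 2 * K * (C * Z) + C ^ 3 * K * (C * Z) + C ^ 2 * K * (C * Z) +
          (C * K * (C * Z) + C * K * (C * Z)) := by gcongr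
      _ = (K * Z) * (2 * C ^ 3 + C ^ 4 + 2 * C ^ 2) := by ring
      _ ≤ (K * Z) * (5 * C ^ 4) := by gcongr; linarith
      _ = _ := by ring

theorem cA_mem (hI : IB 𝓑 α β γ σ X a b Y Y' K) (h : Ctx 𝓑 Sg α β γ δ σ T X X2 C) {t u v : ℝ}
    (hu : a ≤ u) (hub : u ≤ b) (hut : u ≤ t) :
    𝓑.Mem (γ - 2 * α - σ) (cA Sg X X2 Y Y' t u v) := by
  have hα := h.hα
  have m1 := 𝓑.mem_mono (by linarith : γ - 2 * α - σ ≤ γ - σ) _ (hI.y u hu hub).1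
  have m2 := 𝓑.mem_mono (by linarith : γ - 2 * α - σ ≤ γ - α - σ) _ (hI.y' u hu hub).1
  exact Sg.S_mem _ _ _ (by linarith) (𝓑.mem_add _ _ _ (𝓑.mem_smul _ _ _ m1) (𝓑.mem_smul _ _ _ m2))

theorem cA_S {t v u w : ℝ} (hu : w ≤ u) (hut : u ≤ t) :
    Sg.S (t - u) (cA Sg X X2 Y Y' u w v) = cA Sg X X2 Y Y' t w v := by
  unfold cA
  rw [← Sg.S_comp _ _ (by linarith) (by linarith)]; congr 2; ring

/-- Existence of the rough convolution as an abstract two-parameter object. -/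
theorem conv_exists (h : Ctx 𝓑 Sg α β γ δ σ T X X2 C) (ha : 0 ≤ a) (hab : a ≤ b) (hb : b ≤ T)
    (hI : IB 𝓑 α β γ σ X a b Y Y' K) : ∃ I : ℝ → ℝ → 𝓑.E,
      (∀ s u t, a ≤ s → s ≤ u → u ≤ t → t ≤ b → I s t = I u t + Sg.S (t - u) (I s u)) ∧
      (∀ s t, a ≤ s → s ≤ t → t ≤ b → Bd 𝓑 (γ - 2 * α - σ) (I s t - cA Sg X X2 Y Y' t s t)
        (kap (3 * β) * (5 * C ^ 5) * K * (t - s) ^ (3 * β))) := by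
  have hK := hI.nonneg hab
  have hC := h.C0
  have hz := h.hβ3
  have hk := kap_pos hz
  have hex : ∀ t, ∃ J : ℝ → 𝓑.E, a ≤ t → t ≤ b → ∀ u v, a ≤ u → u ≤ v → v ≤ t →
      Bd 𝓑 (γ - 2 * α - σ) (J v - J u - cA Sg X X2 Y Y' t u v)
        (kap (3 * β) * (5 * C ^ 5 * K) * (v - u) ^ (3 * β)) := by
    intro t
    by_cases ht : a ≤ t ∧ t ≤ b
    · obtain ⟨J, hJ⟩ := sewing (𝓑 := 𝓑) (θ := γ - 2 * α - σ) (z := 3 * β) (c := 5 * C ^ 5 * K)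
        (a := a) (b := t) (A := cA Sg X X2 Y Y' t) (by
          intro u m v hu hum hmv hvt
          rw [cA_delta h (by linarith) hum hmv hvt (by linarith)]
          refine (h.sb _ Lv.g2s (t - m) _ _ (by linarith) (by linarith)
            (cE_bd h ha hb hI hu hum hmv (by linarith))).mono (le_of_eq (by ring)))
        hz (by positivity) ht.1
        (fun u v hu huv hvt => cA_mem hI h hu (by linarith) (by linarith))
      exact ⟨J, fun _ _ => hJ⟩
    · exact ⟨0, fun h1 h2 => absurd ⟨h1, h2⟩ ht⟩
  choose J hJ using hex
  refine ⟨fun s t => J t t - J t s, ?_, ?_⟩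
  · intro s u t hs hsu hut htb
    have hconst := const_of_super (𝓑 := 𝓑) (θ := γ - 2 * α - σ) (z := 3 * β)
      (h := fun w => Sg.S (t - u) (J u w) - J t w) (s := s) (u := u)
      (c := C * (kap (3 * β) * (5 * C ^ 5 * K)) + kap (3 * β) * (5 * C ^ 5 * K)) hsu hz (by
        intro w v hw hwv hvu
        have b1 := hJ u (by linarith) (by linarith) w v (by linarith) hwv hvu
        have b2 := hJ t (by linarith) (by linarith) w v (by linarith) hwv (by linarith)
        have b3 := h.sb _ Lv.g2s (t - u) _ _ (by linarith) (by linarith) b1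
        refine ((b3.sub b2).congr ?_).mono (le_of_eq (by ring))
        rw [map_sub, cA_S (by linarith) hut, map_sub]
        abel)
    show J t t - J t s = J t t - J t u + Sg.S (t - u) (J u u - J u s)
    rw [map_sub]
    rw [sub_eq_iff_eq_add] at hconst
    rw [hconst]
    abel
  · intro s t hs hst htb
    exact (hJ t (by linarith) htb s t hs hst le_rfl).mono (le_of_eq (by ring))

/-- The defining algebraic properties of a rough convolution on `[a,b]`. -/
structure IsConv (𝓑 : BanachScale) (Sg : ScaleSemigroup 𝓑) (α β γ σ : ℝ) (X : ℝ → ℝ)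
    (X2 : ℝ → ℝ → ℝ) (a b : ℝ) (Y Y' : ℝ → 𝓑.E) (c : ℝ) (I : ℝ → ℝ → 𝓑.E) : Prop where
  add : ∀ s u t, a ≤ s → s ≤ u → u ≤ t → t ≤ b → I s t = I u t + Sg.S (t - u) (I s u)
  bd : ∀ s t, a ≤ s → s ≤ t → t ≤ b → Bd 𝓑 (γ - 2 * α - σ) (I s t - cA Sg X X2 Y Y' t s t)
        (c * (t - s) ^ (3 * β))

theorem IsConv.diag {I : ℝ → ℝ → 𝓑.E} {c : ℝ} (hc : IsConv 𝓑 Sg α β γ σ X X2 a b Y Y' c I) {s : ℝ}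
    (hs : a ≤ s) (hsb : s ≤ b) : I s s = 0 := by
  have := hc.add s s s hs le_rfl le_rfl hsb
  rw [sub_self, Sg.S_id] at this
  exact left_eq_add.mp this

/-- Lifting the regularity of the remainder along the scale. -/
theorem conv_lift (h : Ctx 𝓑 Sg α β γ δ σ T X X2 C) (c1 κ : ℝ) (hc1 : 0 ≤ c1) (hκ0 : 0 ≤ κ)
    (hκ : κ < 3 * β) (hL : γ - 2 * α - σ + κ ∈ Lv α γ δ σ) : ∃ C2, 0 ≤ C2 ∧
    ∀ a b Y Y' K I, 0 ≤ a → b ≤ T → IB 𝓑 α β γ σ X a b Y Y' K →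
      IsConv 𝓑 Sg α β γ σ X X2 a b Y Y' (c1 * K) I → ∀ s t, a ≤ s → s < t → t ≤ b →
      Bd 𝓑 (γ - 2 * α - σ + κ) (I s t - cA Sg X X2 Y Y' t s t)
        (C2 * K * (t - s) ^ (3 * β - κ)) := by
  have hC := h.C0
  have hβ := h.hβ
  have hα2 := h.hα2
  set q : ℝ := (1 / 2) ^ (3 * β - κ) with hq
  have hq0 : 0 ≤ q := by positivity
  have hq1 : q < 1 := Real.rpow_lt_one (by norm_num) (by norm_num) (by linarith)
  have h1q : 0 < 1 - q := by linarith
  refine ⟨C * (c1 + 5 * C ^ 4) * 2 ^ κ / (1 - q), by positivity, ?_⟩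
  intro a b Y Y' K I ha hb hI hc s t hs hst htb
  have hK := hI.nonneg (by linarith : a ≤ b)
  set d := t - s with hd
  have hd0 : 0 < d := by linarith
  set u : ℕ → ℝ := fun k => t - d * (1 / 2) ^ k with hu
  have hu0 : u 0 = s := by simp [hu, hd]
  have hum : ∀ k, u k ≤ u (k + 1) := fun k => by
    simp only [hu, pow_succ]
    have : 0 < d * (1 / 2) ^ k := by positivity
    nlinarith
  have hut : ∀ k, u k < t := fun k => by
    simp only [hu]
    have : 0 < d * (1 / 2) ^ k := by positivity
    linarith
  have hus : ∀ k, s ≤ u k := fun k => by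
    induction k with
    | zero => exact hu0.ge
    | succ k ih => exact ih.trans (hum k)
  set J : ℝ → ℝ → 𝓑.E := fun s t => I s t - cA Sg X X2 Y Y' t s t with hJ
  set w : ℕ → 𝓑.E := fun k => Sg.S (t - u (k + 1))
    (J (u k) (u (k + 1)) - cE Sg X X2 Y Y' (u k) (u (k + 1)) t) with hw
  have hrec : ∀ k, J (u k) t = J (u (k + 1)) t + w k := fun k => by
    have e1 := hc.add (u k) (u (k + 1)) t (hs.trans (hus k)) (hum k) (hut _).le htb
    have e2 := cA_delta (Y := Y) (Y' := Y') h (t := t) (u := u k) (m := u (k + 1)) (v := t)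
      (by linarith [hus k]) (hum k) (hut _).le le_rfl (by linarith)
    simp only [hJ, hw]
    rw [map_sub, map_sub, ← e2, cA_S (hum k) (hut _).le, e1]
    abel
  have hsum : ∀ n, J s t - ∑ k ∈ Finset.range n, w k = J (u n) t := fun n => by
    induction n with
    | zero => simp [hu0]
    | succ n ih =>
      rw [Finset.sum_range_succ, ← sub_sub, ih, hrec n]; abel
  have hbJ : ∀ u v, a ≤ u → u ≤ v → v ≤ b →
      Bd 𝓑 (γ - 2 * α - σ) (J u v) (c1 * K * (v - u) ^ (3 * β)) := hc.bd
  have hsz : ∀ k, d * (1 / 2 : ℝ) ^ k = t - u k := fun k => by simp [hu]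
  have hpow : ∀ (k : ℕ) (e : ℝ), (d * (1 / 2 : ℝ) ^ k) ^ e = d ^ e * ((1 / 2 : ℝ) ^ e) ^ k := by
    intro k e
    rw [Real.mul_rpow hd0.le (by positivity), ← Real.rpow_natCast, ← Real.rpow_natCast,
      ← Real.rpow_mul (by norm_num), ← Real.rpow_mul (by norm_num), mul_comm e]
  have hwb : ∀ k, Bd 𝓑 (γ - 2 * α - σ + κ) (w k)
      (C * (c1 + 5 * C ^ 4) * 2 ^ κ * K * d ^ (3 * β - κ) * q ^ k) := fun k => by
    have b1 := hbJ (u k) (u (k + 1)) (hs.trans (hus k)) (hum k) ((hut _).le.trans htb)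
    have b2 := cE_bd (Sg := Sg) h ha hb hI (hs.trans (hus k)) (hum k) (hut (k + 1)).le htb
    have b3 := h.sm _ Lv.g2s _ hL κ hκ0 (by linarith) rfl (t - u (k + 1)) _ _
      (by linarith [hut (k + 1)]) (by linarith [hus (k + 1)]) (b1.sub b2)
    refine b3.mono ?_
    have m1 : (u (k + 1) - u k) ^ (3 * β) ≤ (t - u k) ^ (3 * β) :=
      Real.rpow_le_rpow (by linarith [hum k]) (by linarith [hut (k + 1)]) (by linarith)
    have e1 : (t - u (k + 1)) ^ (-κ) = 2 ^ κ * (t - u k) ^ (-κ) := by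
      rw [← hsz, ← hsz, pow_succ, ← mul_assoc, Real.mul_rpow (by positivity) (by norm_num), mul_comm]
      congr 1
      rw [one_div, Real.inv_rpow (by norm_num), Real.rpow_neg (by norm_num), inv_inv]
    have hpos : 0 < t - u k := by linarith [hut k]
    have e2 : (t - u k) ^ (-κ) * (t - u k) ^ (3 * β) = d ^ (3 * β - κ) * q ^ k := by
      rw [← Real.rpow_add hpos, ← hsz, hpow]
      rw [show -κ + 3 * β = 3 * β - κ by ring]
    have hp1 := Real.rpow_nonneg hpos.le (-κ)
    rw [e1]
    calc _ ≤ C * (2 ^ κ * (t - u k) ^ (-κ)) *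
        (c1 * K * (t - u k) ^ (3 * β) + 5 * C ^ 4 * K * (t - u k) ^ (3 * β)) := by gcongr
      _ = C * (c1 + 5 * C ^ 4) * 2 ^ κ * K * ((t - u k) ^ (-κ) * (t - u k) ^ (3 * β)) := by ring
      _ = _ := by rw [e2]; ring
  have hser := Bd.series (θ₁ := γ - 2 * α - σ) (x := J s t) (by linarith) hq0 hq1 hwb
    (e := fun n => c1 * K * d ^ (3 * β) * ((1 / 2 : ℝ) ^ (3 * β)) ^ n) (by
      have hq1 : ((1 / 2 : ℝ) ^ (3 * β)) < 1 :=
        Real.rpow_lt_one (by norm_num) (by norm_num) (by linarith)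
      simpa using (tendsto_pow_atTop_nhds_zero_of_lt_one (by positivity) hq1).const_mul
        (c1 * K * d ^ (3 * β))) (fun n => by
      rw [hsum]
      refine (hbJ (u n) t (hs.trans (hus n)) (hut n).le htb).mono (le_of_eq ?_)
      rw [← hsz, hpow]; ring)
  refine hser.mono (le_of_eq ?_)
  ring

end Conv

end RPDE


namespace RPDE

/-! ### Partitions -/

section Part

variable {a b : ℝ}

theorem part_mono (π : RPartition a b) {i j : ℕ} (hij : i ≤ j) (hj : j ≤ π.n) : π.t i ≤ π.t j := by
  induction j, hij using Nat.le_induction with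
  | base => exact le_rfl
  | succ j hij ih => exact (ih (by omega)).trans (π.strict j (by omega)).le

theorem part_ge (π : RPartition a b) {i : ℕ} (hi : i ≤ π.n) : a ≤ π.t i := by
  have := part_mono π (Nat.zero_le i) hi; rwa [π.first] at this

theorem part_le (π : RPartition a b) {i : ℕ} (hi : i ≤ π.n) : π.t i ≤ b := by
  have := part_mono π hi le_rfl; rwa [π.last] at this

theorem part_lt (π : RPartition a b) {i : ℕ} (hi : i < π.n) : π.t i < b :=
  (π.strict i hi).trans_le (part_le π hi)

theorem part_le_mesh (π : RPartition a b) {i : ℕ} (hi : i < π.n) :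
    π.t (i + 1) - π.t i ≤ π.mesh := by
  refine le_csSup ?_ ⟨i, hi, rfl⟩
  have : {r : ℝ | ∃ i : ℕ, i < π.n ∧ r = π.t (i + 1) - π.t i} =
      (fun i => π.t (i + 1) - π.t i) '' (Set.Iio π.n) := by
    ext r; simp [eq_comm]
  rw [this]
  exact ((Set.finite_Iio _).image _).bddAbove

theorem mesh_nonneg (π : RPartition a b) : 0 ≤ π.mesh :=
  (sub_nonneg.mpr (π.strict 0 π.n_pos).le).trans (part_le_mesh π π.n_pos)

theorem part_sum (π : RPartition a b) :
    ∑ i ∈ Finset.range π.n, (π.t (i + 1) - π.t i) = b - a := by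
  rw [Finset.sum_range_sub, π.first, π.last]

/-- Uniform partition. -/
noncomputable def upart (hab : a < b) (N : ℕ) : RPartition a b where
  n := N + 1
  t := fun i => a + i * ((b - a) / (N + 1))
  n_pos := Nat.succ_pos N
  strict := fun i _ => by
    have : 0 < (b - a) / (N + 1) := div_pos (by linarith) (by positivity)
    push_cast
    linarith
  first := by simp
  last := by
    push_cast
    field_simp
    ring

theorem upart_mesh (hab : a < b) (N : ℕ) : (upart hab N).mesh ≤ (b - a) / (N + 1) := by
  refine csSup_le ⟨_, 0, (upart hab N).n_pos, rfl⟩ ?_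
  rintro r ⟨i, _, rfl⟩
  apply le_of_eq
  simp only [upart]
  push_cast
  ring

theorem exists_mesh_lt (hab : a < b) {ε : ℝ} (hε : 0 < ε) : ∃ π : RPartition a b, π.mesh < ε := by
  obtain ⟨N, hN⟩ := exists_nat_gt ((b - a) / ε)
  refine ⟨upart hab N, (upart_mesh hab N).trans_lt ?_⟩
  rw [div_lt_iff₀ (by positivity)]
  rw [div_lt_iff₀ hε] at hN
  nlinarith

theorem lim_unique {𝓑 : BanachScale} {θ : ℝ} {P : RPartition a b → 𝓑.E} {I I' : 𝓑.E} (hab : a < b)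
    (hP : ∀ π, 𝓑.Mem θ (P π))
    (hI : 𝓑.Mem θ I ∧ ∀ ε > (0:ℝ), ∃ δ > (0:ℝ), ∀ π : RPartition a b, π.mesh < δ →
      𝓑.N θ (P π - I) ≤ ε)
    (hI' : 𝓑.Mem θ I' ∧ ∀ ε > (0:ℝ), ∃ δ > (0:ℝ), ∀ π : RPartition a b, π.mesh < δ →
      𝓑.N θ (P π - I') ≤ ε) : I = I' := by
  refine Bd.eq_of_sub (θ := θ) fun ε hε => ?_
  obtain ⟨d1, hd1, h1⟩ := hI.2 (ε / 2) (half_pos hε)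
  obtain ⟨d2, hd2, h2⟩ := hI'.2 (ε / 2) (half_pos hε)
  obtain ⟨π, hπ⟩ := exists_mesh_lt hab (lt_min hd1 hd2)
  have b1 : Bd 𝓑 θ (P π - I) (ε / 2) := ⟨mem_sub (hP π) hI.1, h1 π (hπ.trans_le (min_le_left _ _))⟩
  have b2 : Bd 𝓑 θ (P π - I') (ε / 2) :=
    ⟨mem_sub (hP π) hI'.1, h2 π (hπ.trans_le (min_le_right _ _))⟩
  exact ((b2.sub b1).congr (by abel)).mono (by linarith)

theorem bern {p q e : ℝ} (hp : 0 < p) (hq : 0 ≤ q) (he : 0 ≤ e) (he1 : e < 1) :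
    (p - q) * p ^ (-e) ≤ (p ^ (1 - e) - q ^ (1 - e)) / (1 - e) := by
  have h1 : 0 < 1 - e := by linarith
  rw [le_div_iff₀ h1]
  have hb := rpow_one_add_le_one_add_mul_self (s := q / p - 1)
    (by have : 0 ≤ q / p := by positivity
        linarith) (p := 1 - e) h1.le (by linarith)
  rw [add_sub_cancel, Real.div_rpow hq hp.le] at hb
  have hpe : 0 < p ^ (1 - e) := Real.rpow_pos_of_pos hp _
  rw [div_le_iff₀ hpe] at hb
  have e1 : p ^ (1 - e) = p * p ^ (-e) := by
    rw [sub_eq_add_neg, Real.rpow_add hp, Real.rpow_one]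
  have e2 : (1 + (1 - e) * (q / p - 1)) * p ^ (1 - e) =
      p ^ (1 - e) + (1 - e) * (q - p) * p ^ (-e) := by
    rw [e1]; field_simp
  rw [e2] at hb
  nlinarith

theorem part_sum_sing (π : RPartition a b) {e : ℝ} (he : 0 ≤ e) (he1 : e < 1) :
    ∑ i ∈ Finset.range π.n, (π.t (i + 1) - π.t i) * (b - π.t i) ^ (-e) ≤
      (b - a) ^ (1 - e) / (1 - e) := by
  have h1 : 0 < 1 - e := by linarith
  calc _ ≤ ∑ i ∈ Finset.range π.n,
        (-((b - π.t (i + 1)) ^ (1 - e) / (1 - e)) - -((b - π.t i) ^ (1 - e) / (1 - e))) := by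
        refine Finset.sum_le_sum fun i hi => ?_
        have hi := Finset.mem_range.mp hi
        have := bern (p := b - π.t i) (q := b - π.t (i + 1)) (by linarith [part_lt π hi])
          (by linarith [part_le π (i := i + 1) hi]) he he1
        calc _ = (b - π.t i - (b - π.t (i + 1))) * (b - π.t i) ^ (-e) := by ring
          _ ≤ _ := this
          _ = _ := by ring
    _ = _ := by
        rw [Finset.sum_range_sub (fun i => -((b - π.t i) ^ (1 - e) / (1 - e))), π.first, π.last,
          sub_self, Real.zero_rpow h1.ne']
        ring

end Part

section Conv

variable {𝓑 : BanachScale} {Sg : ScaleSemigroup 𝓑} {α β γ δ σ T : ℝ}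
    {X : ℝ → ℝ} {X2 : ℝ → ℝ → ℝ} {C : ℝ} {a b K : ℝ} {Y Y' : ℝ → 𝓑.E}

theorem IsConv.telescope {I : ℝ → ℝ → 𝓑.E} {c : ℝ} (hc : IsConv 𝓑 Sg α β γ σ X X2 a b Y Y' c I)
    {s t : ℝ} (hs : a ≤ s) (ht : t ≤ b) (π : RPartition s t) :
    I s t = ∑ i ∈ Finset.range π.n, Sg.S (t - π.t (i + 1)) (I (π.t i) (π.t (i + 1))) := by
  have key : ∀ k ≤ π.n, I s t = I (π.t k) t +
      ∑ i ∈ Finset.range k, Sg.S (t - π.t (i + 1)) (I (π.t i) (π.t (i + 1))) := by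
    intro k hk
    induction k with
    | zero => simp [π.first]
    | succ k ih =>
      rw [ih (by omega), Finset.sum_range_succ,
        hc.add (π.t k) (π.t (k + 1)) t (hs.trans (part_ge π (by omega))) (π.strict k hk).le
          (part_le π hk) ht]
      abel
  have hst : s ≤ t := (part_ge π le_rfl).trans (part_le π le_rfl)
  have := key π.n le_rfl
  rwa [π.last, hc.diag (by linarith) ht, zero_add] at this

theorem conv_sum_mem (h : Ctx 𝓑 Sg α β γ δ σ T X X2 C) (hI : IB 𝓑 α β γ σ X a b Y Y' K)
    {s t : ℝ} (hs : a ≤ s) (ht : t ≤ b) (π : RPartition s t) :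
    𝓑.Mem (γ - 2 * α) (convRiemannSum 𝓑 Sg X X2 Y Y' π) := by
  have hα := h.hα
  have hσα := h.hσα
  refine (Bd.sum _ _ _ fun i hi => Bd.of_mem ?_).1
  have hi := (Finset.mem_range.mp hi).le
  have h1 := part_ge π hi
  have h2 := part_le π hi
  have m1 := 𝓑.mem_mono (by linarith : γ - 2 * α ≤ γ - σ) _ (hI.y (π.t i) (by linarith)
    (by linarith)).1
  have m2 := 𝓑.mem_mono (by linarith : γ - 2 * α ≤ γ - α - σ) _ (hI.y' (π.t i) (by linarith)
    (by linarith)).1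
  exact Sg.S_mem _ _ _ (by linarith) (𝓑.mem_add _ _ _ (𝓑.mem_smul _ _ _ m1) (𝓑.mem_smul _ _ _ m2))

theorem half_pow {x y e : ℝ} (hx : 0 < x) (hy : 0 < y) (hxy : x ≤ 2 * y) (he : 0 ≤ e)
    (he1 : e ≤ 1) : y ^ (-e) ≤ 2 * x ^ (-e) := by
  have h1 : (2 * y) ^ (-e) ≤ x ^ (-e) := Real.rpow_le_rpow_of_nonpos hx hxy (by linarith)
  rw [Real.mul_rpow (by norm_num) hy.le] at h1
  have h2 : (1:ℝ) / 2 ≤ 2 ^ (-e) := by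
    rw [one_div, ← Real.rpow_neg_one]
    exact Real.rpow_le_rpow_of_exponent_le (by norm_num) (by linarith)
  have := Real.rpow_nonneg hy.le (-e)
  nlinarith

/-- Riemann sums converge to the abstract rough convolution. -/
theorem conv_riemann (h : Ctx 𝓑 Sg α β γ δ σ T X X2 C) (c1 : ℝ) (hc1 : 0 ≤ c1) : ∃ C3, 0 ≤ C3 ∧
    ∀ a b Y Y' K I, 0 ≤ a → b ≤ T → IB 𝓑 α β γ σ X a b Y Y' K →
      IsConv 𝓑 Sg α β γ σ X X2 a b Y Y' (c1 * K) I → ∀ s t, a ≤ s → s < t → t ≤ b →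
      ∀ π : RPartition s t, Bd 𝓑 (γ - 2 * α) (convRiemannSum 𝓑 Sg X X2 Y Y' π - I s t)
        (C3 * K * π.mesh ^ (3 * β - 1)) := by
  have hC := h.C0
  have hβ := h.hβ
  have hα2 := h.hα2
  have hα := h.hα
  have hσ := h.hσ
  have hσα := h.hσα
  have hβ3 := h.hβ3
  have hT := h.hT
  have e0 : γ - 2 * α - σ + σ = γ - 2 * α := by ring
  obtain ⟨C2, hC2, hl⟩ := conv_lift h c1 σ hc1 hσ (by linarith) (by rw [e0]; exact Lv.g2)
  rw [e0] at hl
  refine ⟨(2 * C * c1 + 2 * C * C2) * (T ^ (1 - σ) / (1 - σ)), by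
    have : 0 < 1 - σ := by linarith
    positivity, ?_⟩
  intro a b Y Y' K I ha hb hI hc s t hs hst htb π
  have hK := hI.nonneg (by linarith : a ≤ b)
  have term : ∀ u v, s ≤ u → u < v → v ≤ t → Bd 𝓑 (γ - 2 * α)
      (Sg.S (t - v) (I u v - cA Sg X X2 Y Y' v u v))
      ((2 * C * c1 + 2 * C * C2) * K * ((v - u) ^ (3 * β) * (t - u) ^ (-σ))) := by
    intro u v hu huv hvt
    have hp1 : 0 ≤ (v - u) ^ (3 * β) := Real.rpow_nonneg (by linarith) _
    have hp2 : 0 ≤ (t - u) ^ (-σ) := Real.rpow_nonneg (by linarith) _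
    have hp : 0 ≤ K * ((v - u) ^ (3 * β) * (t - u) ^ (-σ)) := by positivity
    rcases le_total (v - u) (t - v) with hcase | hcase
    · have b1 := hc.bd u v (by linarith) huv.le (by linarith)
      have b2 := h.sm _ Lv.g2s _ Lv.g2 σ hσ (by linarith) (by ring) (t - v) _ _
        (by linarith) (by linarith) b1
      refine b2.mono ?_
      have := half_pow (x := t - u) (y := t - v) (e := σ) (by linarith) (by linarith)
        (by linarith) hσ (by linarith)
      calc _ ≤ C * (2 * (t - u) ^ (-σ)) * (c1 * K * (v - u) ^ (3 * β)) := by gcongr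
        _ = (2 * C * c1) * (K * ((v - u) ^ (3 * β) * (t - u) ^ (-σ))) := by ring
        _ ≤ (2 * C * c1 + 2 * C * C2) * (K * ((v - u) ^ (3 * β) * (t - u) ^ (-σ))) := by
          gcongr
          have := mul_nonneg hC hC2
          linarith
        _ = _ := by ring
    · have b1 := hl a b Y Y' K I ha hb hI hc u v (by linarith) huv (by linarith)
      have b2 := h.sb _ Lv.g2 (t - v) _ _ (by linarith) (by linarith) b1
      refine b2.mono ?_
      have := half_pow (x := t - u) (y := v - u) (e := σ) (by linarith) (by linarith)
        (by linarith) hσ (by linarith)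
      have e1 : (v - u) ^ (3 * β - σ) = (v - u) ^ (3 * β) * (v - u) ^ (-σ) := by
        rw [← Real.rpow_add (by linarith)]; ring_nf
      rw [e1]
      calc _ ≤ C * (C2 * K * ((v - u) ^ (3 * β) * (2 * (t - u) ^ (-σ)))) := by gcongr
        _ = (2 * C * C2) * (K * ((v - u) ^ (3 * β) * (t - u) ^ (-σ))) := by ring
        _ ≤ (2 * C * c1 + 2 * C * C2) * (K * ((v - u) ^ (3 * β) * (t - u) ^ (-σ))) := by
          gcongr
          have := mul_nonneg hC hc1
          linarith
        _ = _ := by ring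
  rw [hc.telescope hs htb π]
  unfold convRiemannSum
  rw [← Finset.sum_sub_distrib]
  have hm := mesh_nonneg π
  refine (Bd.sum _ _ (fun i => (2 * C * c1 + 2 * C * C2) * K * π.mesh ^ (3 * β - 1) *
    ((π.t (i + 1) - π.t i) * (t - π.t i) ^ (-σ))) fun i hi => ?_).mono ?_
  · have hi := Finset.mem_range.mp hi
    have h1 := part_ge π hi.le
    have h2 := part_lt π hi
    have h3 := part_le π (i := i + 1) hi
    have h4 := π.strict i hi
    have e1 := cA_S (Sg := Sg) (X := X) (X2 := X2) (Y := Y) (Y' := Y') (t := t) (u := π.t (i + 1))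
      (w := π.t i) (v := π.t (i + 1)) h4.le h3
    have := (term (π.t i) (π.t (i + 1)) h1 h4 h3).neg
    rw [map_sub, e1] at this
    refine (this.congr ?_).mono ?_
    · unfold cA; abel
    · have := rpow_split (z := 3 * β) (sub_nonneg.mpr h4.le) (part_le_mesh π hi) hβ3
      have hp2 : 0 ≤ (t - π.t i) ^ (-σ) := Real.rpow_nonneg (by linarith) _
      calc _ ≤ (2 * C * c1 + 2 * C * C2) * K *
          ((π.mesh ^ (3 * β - 1) * (π.t (i + 1) - π.t i)) * (t - π.t i) ^ (-σ)) := by gcongr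
        _ = _ := by ring
  · rw [← Finset.mul_sum]
    have := part_sum_sing π hσ (by linarith)
    have h1σ : 0 < 1 - σ := by linarith
    have h2 : (t - s) ^ (1 - σ) ≤ T ^ (1 - σ) :=
      Real.rpow_le_rpow (by linarith) (by linarith) (by linarith)
    have hpm := Real.rpow_nonneg hm (3 * β - 1)
    calc _ ≤ (2 * C * c1 + 2 * C * C2) * K * π.mesh ^ (3 * β - 1) * (T ^ (1 - σ) / (1 - σ)) := by
          gcongr
          exact this.trans (by gcongr)
      _ = _ := by ring

theorem IsConv.isRough {I : ℝ → ℝ → 𝓑.E} {c1 : ℝ} (h : Ctx 𝓑 Sg α β γ δ σ T X X2 C)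
    (hc1 : 0 ≤ c1) (ha : 0 ≤ a) (hb : b ≤ T) (hI : IB 𝓑 α β γ σ X a b Y Y' K)
    (hc : IsConv 𝓑 Sg α β γ σ X X2 a b Y Y' (c1 * K) I) {s t : ℝ} (hs : a ≤ s) (hst : s < t)
    (ht : t ≤ b) : IsRoughConvolution 𝓑 Sg X X2 Y Y' (γ - 2 * α) s t (I s t) := by
  obtain ⟨C3, hC3, H⟩ := conv_riemann h c1 hc1
  have H := H a b Y Y' K I ha hb hI hc s t hs hst ht
  have hβ3 := h.hβ3
  constructor
  · have m1 := (H (upart hst 0)).1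
    have m2 := conv_sum_mem h hI hs ht (upart hst 0)
    have := mem_sub m2 m1
    rwa [sub_sub_cancel] at this
  · intro ε hε
    have hcont : Filter.Tendsto (fun x : ℝ => C3 * K * x ^ (3 * β - 1)) (nhds 0) (nhds 0) := by
      have := (Real.continuousAt_rpow_const (0:ℝ) (3 * β - 1) (Or.inr (by linarith))).tendsto
      rw [Real.zero_rpow (by linarith)] at this
      simpa using this.const_mul (C3 * K)
    obtain ⟨η, hη, hlt⟩ := Metric.eventually_nhds_iff.mp (hcont.eventually (gt_mem_nhds hε))
    refine ⟨η, hη, fun π hπ => (H π).2.trans (hlt ?_).le⟩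
    rw [Real.dist_eq, sub_zero, abs_of_nonneg (mesh_nonneg π)]
    exact hπ

/-- Regularity of the rough convolution. -/
theorem conv_bounds (h : Ctx 𝓑 Sg α β γ δ σ T X X2 C) (c1 ρ : ℝ) (hc1 : 0 ≤ c1)
    (hρ0 : 0 ≤ ρ) (hρ : ρ ≤ 3 * β - 2 * α - σ) : ∃ C4, 0 ≤ C4 ∧
    ∀ a b Y Y' K I, 0 ≤ a → b ≤ T → IB 𝓑 α β γ σ X a b Y Y' K →
      IsConv 𝓑 Sg α β γ σ X X2 a b Y Y' (c1 * K) I → ∀ s t, a ≤ s → s < t → t ≤ b →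
      Bd 𝓑 γ (I s t) (C4 * K * (t - s) ^ ρ) ∧
      Bd 𝓑 (γ - α) (I s t - (X t - X s) • Y s) (C4 * K * (t - s) ^ α) ∧
      Bd 𝓑 (γ - 2 * α) (I s t - (X t - X s) • Y s) (C4 * K * (t - s) ^ (2 * α)) := by
  have hC := h.C0
  have hβ := h.hβ
  have hα2 := h.hα2
  have hα := h.hα
  have hσ := h.hσ
  have hσα := h.hσα
  have hβ3 := h.hβ3
  have hβz := h.hβz
  have hT := h.hT
  have e0 : γ - 2 * α - σ + σ = γ - 2 * α := by ring
  have e1 : γ - 2 * α - σ + (α + σ) = γ - α := by ring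
  have e2 : γ - 2 * α - σ + (2 * α + σ) = γ := by ring
  obtain ⟨D0, hD0, l0⟩ := conv_lift h c1 σ hc1 hσ (by linarith) (by rw [e0]; exact Lv.g2)
  obtain ⟨D1, hD1, l1⟩ := conv_lift h c1 (α + σ) hc1 (by linarith) (by linarith)
    (by rw [e1]; exact Lv.ga)
  obtain ⟨D2, hD2, l2⟩ := conv_lift h c1 (2 * α + σ) hc1 (by linarith) (by linarith)
    (by rw [e2]; exact Lv.g)
  rw [e0] at l0; rw [e1] at l1; rw [e2] at l2
  have hCC : 0 ≤ C * C * C := by positivity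
  refine ⟨C * D0 + C * D1 + C * D2 + 2 * (C * C * C), by positivity, ?_⟩
  intro a b Y Y' K I ha hb hI hc s t hs hst htb
  have hK := hI.nonneg (by linarith : a ≤ b)
  have l0 := l0 a b Y Y' K I ha hb hI hc s t hs hst htb
  have l1 := l1 a b Y Y' K I ha hb hI hc s t hs hst htb
  have l2 := l2 a b Y Y' K I ha hb hI hc s t hs hst htb
  have yb := hI.y s hs (by linarith)
  have yb' := hI.y' s hs (by linarith)
  set d := t - s with hd
  have hd0 : 0 < d := by linarith
  have hdT : d ≤ T := by linarith
  have x1 := h.hXd (m := s) (v := t) (d := d) (by linarith) hst.le (by linarith) le_rfl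
  have x2 := h.hX2d (m := s) (v := t) (d := d) (by linarith) hst.le (by linarith) le_rfl
  have n0 : 0 ≤ C * D0 * K := by positivity
  have n1 : 0 ≤ C * D1 * K := by positivity
  have n2 : 0 ≤ C * D2 * K := by positivity
  have n3 : 0 ≤ C * C * C * K := by positivity
  have conv : ∀ e1 e2 e' : ℝ, 0 ≤ e' → e' ≤ e1 + e2 → e1 + e2 ≤ 3 →
      C * d ^ e1 * (C * d ^ e2 * K) ≤ C * C * C * K * d ^ e' := by
    intro e1 e2 e' h1 h2 h3
    have := h.pw d (e1 + e2) e' hd0.le hdT h1 h2 h3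
    calc _ = C * C * K * d ^ (e1 + e2) := by rw [Real.rpow_add hd0]; ring
      _ ≤ C * C * K * (C * d ^ e') := by gcongr
      _ = _ := by ring
  have hAeq : ∀ x : 𝓑.E, x = (x - cA Sg X X2 Y Y' t s t) +
      Sg.S d ((X t - X s) • Y s) + Sg.S d (X2 s t • Y' s) := fun x => by
    unfold cA; rw [← hd, map_add]; abel
  have hAeq2 : ∀ x : 𝓑.E, x - (X t - X s) • Y s = (x - cA Sg X X2 Y Y' t s t) +
      (Sg.S d ((X t - X s) • Y s) - (X t - X s) • Y s) + Sg.S d (X2 s t • Y' s) := fun x => by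
    unfold cA; rw [← hd, map_add]; abel
  refine ⟨?_, ?_, ?_⟩
  · have a1 := h.sm _ Lv.gs _ Lv.g σ hσ (by linarith) (by ring) d _ _ hd0 hdT (yb.smul x1)
    have a2 := h.sm _ Lv.gas _ Lv.g (α + σ) (by linarith) (by linarith) (by ring) d _ _ hd0 hdT
      (yb'.smul x2)
    refine (((l2.add a1).add a2).congr (hAeq _)).mono ?_
    have p0 := h.pw d (3 * β - (2 * α + σ)) ρ hd0.le hdT hρ0 (by linarith) (by linarith)
    have p1 := conv (-σ) α ρ hρ0 (by linarith) (by linarith)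
    have p2 := conv (-(α + σ)) (2 * α) ρ hρ0 (by linarith) (by linarith)
    have hq := Real.rpow_nonneg hd0.le ρ
    calc _ ≤ D2 * K * (C * d ^ ρ) + C * C * C * K * d ^ ρ + C * C * C * K * d ^ ρ := by gcongr
      _ = (C * D2 * K + 2 * (C * C * C * K)) * d ^ ρ := by ring
      _ ≤ (C * D0 * K + C * D1 * K + C * D2 * K + 2 * (C * C * C * K)) * d ^ ρ := by
        gcongr; linarith
      _ = _ := by ring
  · have a1 := h.hdd (κ := α - σ) Lv.ga Lv.gs (by linarith) (by linarith) (by ring) hd0.le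
      (le_refl d) hdT (yb.smul x1)
    have a2 := h.sm _ Lv.gas _ Lv.ga σ (by linarith) (by linarith) (by ring) d _ _ hd0 hdT
      (yb'.smul x2)
    refine (((l1.add a1).add a2).congr (hAeq2 _)).mono ?_
    have p0 := h.pw d (3 * β - (α + σ)) α hd0.le hdT (by linarith) (by linarith) (by linarith)
    have p1 := conv (α - σ) α α (by linarith) (by linarith) (by linarith)
    have p2 := conv (-σ) (2 * α) α (by linarith) (by linarith) (by linarith)
    have hq := Real.rpow_nonneg hd0.le α
    calc _ ≤ D1 * K * (C * d ^ α) + C * C * C * K * d ^ α + C * C * C * K * d ^ α := by gcongr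
      _ = (C * D1 * K + 2 * (C * C * C * K)) * d ^ α := by ring
      _ ≤ (C * D0 * K + C * D1 * K + C * D2 * K + 2 * (C * C * C * K)) * d ^ α := by
        gcongr; linarith
      _ = _ := by ring
  · have a1 := h.hdd (κ := 2 * α - σ) Lv.g2 Lv.gs (by linarith) (by linarith) (by ring) hd0.le
      (le_refl d) hdT (yb.smul x1)
    have a2 := h.sb _ Lv.g2 d _ _ hd0.le hdT
      (h.emb _ Lv.g2 _ Lv.gas (by linarith) _ _ (yb'.smul x2))
    refine (((l0.add a1).add a2).congr (hAeq2 _)).mono ?_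
    have p0 := h.pw d (3 * β - σ) (2 * α) hd0.le hdT (by linarith) (by linarith) (by linarith)
    have p1 := conv (2 * α - σ) α (2 * α) (by linarith) (by linarith) (by linarith)
    have hq := Real.rpow_nonneg hd0.le (2 * α)
    calc _ ≤ D0 * K * (C * d ^ (2 * α)) + C * C * C * K * d ^ (2 * α) +
          C * (C * (C * d ^ (2 * α) * K)) := by gcongr
      _ = (C * D0 * K + 2 * (C * C * C * K)) * d ^ (2 * α) := by ring
      _ ≤ (C * D0 * K + C * D1 * K + C * D2 * K + 2 * (C * C * C * K)) * d ^ (2 * α) := by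
        gcongr; linarith
      _ = _ := by ring

end Conv

end RPDE


namespace RPDE

section Sing

variable {V : Type*} [NormedAddCommGroup V] [NormedSpace ℝ V] [CompleteSpace V]

theorem sing_int {t u v δ : ℝ} (huv : u ≤ v) (hvt : v ≤ t) (hδ1 : δ < 1) :
    IntervalIntegrable (fun r => (t - r) ^ (-δ)) MeasureTheory.volume u v ∧
    ∫ r in u..v, (t - r) ^ (-δ) = (t - u) ^ (1 - δ) / (1 - δ) - (t - v) ^ (1 - δ) / (1 - δ) := by
  constructor
  · have := (intervalIntegral.intervalIntegrable_rpow' (a := t - u) (b := t - v)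
      (r := -δ) (by linarith)).comp_sub_left t
    simpa using this
  · rw [intervalIntegral.integral_comp_sub_left (fun x => x ^ (-δ)) t,
      integral_rpow (Or.inl (by linarith))]
    rw [show -δ + 1 = 1 - δ by ring]
    ring

theorem riemann_sing {g : ℝ → V} {s t M δ : ℝ} (hst : s < t) (hδ0 : 0 ≤ δ) (hδ1 : δ < 1)
    (hM : 0 ≤ M) (hg : ContinuousOn g (Ico s t))
    (hb : ∀ r ∈ Ico s t, ‖g r‖ ≤ M * (t - r) ^ (-δ)) :
    IntervalIntegrable g MeasureTheory.volume s t ∧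
    ∀ ε > 0, ∃ η > 0, ∀ π : RPartition s t, π.mesh < η →
      ‖∑ i ∈ Finset.range π.n, (π.t (i + 1) - π.t i) • g (π.t i) - ∫ r in s..t, g r‖ ≤ ε := by
  have h1δ : 0 < 1 - δ := by linarith
  have hintg : IntervalIntegrable g MeasureTheory.volume s t := by
    have h1 := (sing_int hst.le le_rfl hδ1).1.const_mul M
    rw [intervalIntegrable_iff_integrableOn_Ico_of_le hst.le] at h1 ⊢
    refine MeasureTheory.Integrable.mono' h1 (hg.aestronglyMeasurable measurableSet_Ico) ?_
    exact (MeasureTheory.ae_restrict_iff' measurableSet_Ico).mpr (Filter.Eventually.of_forall hb)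
  refine ⟨hintg, fun ε hε => ?_⟩
  -- choose the cut-off
  obtain ⟨η0, hη0, hη0s⟩ : ∃ η0 > 0, 2 * M * ((2 * η0) ^ (1 - δ) / (1 - δ)) < ε / 2 := by
    have hcont : Filter.Tendsto (fun x : ℝ => 2 * M * ((2 * x) ^ (1 - δ) / (1 - δ)))
        (nhds 0) (nhds 0) := by
      have h0 : Filter.Tendsto (fun x : ℝ => (2 * x) ^ (1 - δ)) (nhds 0) (nhds 0) := by
        have := (Real.continuousAt_rpow_const (2 * 0:ℝ) (1 - δ) (Or.inr h1δ.le)).comp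
          (f := fun x : ℝ => 2 * x) (x := 0) (by fun_prop)
        have h2 := this.tendsto
        simp only [Function.comp_def, mul_zero, Real.zero_rpow h1δ.ne'] at h2
        exact h2
      simpa using (h0.div_const (1 - δ)).const_mul (2 * M)
    obtain ⟨η, hη, hlt⟩ := Metric.eventually_nhds_iff.mp (hcont.eventually (gt_mem_nhds
      (half_pos hε)))
    refine ⟨η / 2, by positivity, hlt ?_⟩
    rw [Real.dist_eq, sub_zero, abs_of_pos (by positivity)]
    linarith
  have hε' : 0 < ε / 2 / (t - s) := div_pos (half_pos hε) (by linarith)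
  have huc : UniformContinuousOn g (Icc s (t - η0)) :=
    isCompact_Icc.uniformContinuousOn_of_continuous (hg.mono fun x hx => ⟨hx.1, by
      have := hx.2; linarith⟩)
  obtain ⟨η1, hη1, hu⟩ := Metric.uniformContinuousOn_iff.mp huc _ hε'
  refine ⟨min η0 η1, lt_min hη0 hη1, fun π hπ => ?_⟩
  have hπ0 := hπ.trans_le (min_le_left _ _)
  have hπ1 := hπ.trans_le (min_le_right _ _)
  set Ψ : ℝ → ℝ := fun r => (min (2 * η0) (t - r)) ^ (1 - δ) / (1 - δ) with hΨ
  have hΨmono : ∀ u v, u ≤ v → v ≤ t → Ψ v ≤ Ψ u := fun u v huv hvt => by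
    simp only [hΨ]
    gcongr
  have hsub : ∀ u v, s ≤ u → u ≤ v → v ≤ t → IntervalIntegrable g MeasureTheory.volume u v :=
    fun u v h1 h2 h3 => hintg.mono_set (by
      rw [uIcc_of_le h2, uIcc_of_le hst.le]; exact Icc_subset_Icc h1 h3)
  have cell : ∀ u v, s ≤ u → u < v → v ≤ t → v - u ≤ π.mesh →
      ‖(v - u) • g u - ∫ r in u..v, g r‖ ≤ ε / 2 / (t - s) * (v - u) + 2 * M * (Ψ u - Ψ v) := by
    intro u v hsu huv hvt hm
    have hΨ0 : 0 ≤ 2 * M * (Ψ u - Ψ v) :=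
      mul_nonneg (by positivity) (sub_nonneg.mpr (hΨmono u v huv.le hvt))
    rcases le_or_gt v (t - η0) with hv | hv
    · have e1 : (v - u) • g u - ∫ r in u..v, g r = ∫ r in u..v, (g u - g r) := by
        rw [intervalIntegral.integral_sub (by simp) (hsub u v hsu huv.le hvt)]
        simp
      rw [e1]
      have := intervalIntegral.norm_integral_le_of_norm_le_const (a := u) (b := v)
        (f := fun r => g u - g r) (C := ε / 2 / (t - s)) (fun r hr => by
          rw [uIoc_of_le huv.le] at hr
          rw [← dist_eq_norm]
          refine (hu u ⟨hsu, by linarith⟩ r ⟨by linarith [hr.1], by linarith [hr.2]⟩ ?_).le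
          rw [Real.dist_eq, abs_sub_comm, abs_of_pos (by linarith [hr.1])]
          linarith [hr.2])
      rw [abs_of_pos (by linarith)] at this
      linarith
    · have hsi := sing_int huv.le hvt hδ1
      have b1 : ‖∫ r in u..v, g r‖ ≤ ∫ r in u..v, M * (t - r) ^ (-δ) := by
        refine intervalIntegral.norm_integral_le_of_norm_le huv.le ?_ (hsi.1.const_mul M)
        have hne : ∀ᵐ r : ℝ, r ≠ t := by
          simp [MeasureTheory.ae_iff]
        filter_upwards [hne] with r hr hr2
        exact hb r ⟨by linarith [hr2.1], lt_of_le_of_ne (by linarith [hr2.2]) hr⟩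
      rw [intervalIntegral.integral_const_mul, hsi.2] at b1
      have b2 : ‖(v - u) • g u‖ ≤ M * ((t - u) ^ (1 - δ) / (1 - δ) - (t - v) ^ (1 - δ) / (1 - δ)) := by
        rw [norm_smul, Real.norm_eq_abs, abs_of_pos (by linarith)]
        have h1 := hb u ⟨hsu, by linarith⟩
        have h2 := bern (p := t - u) (q := t - v) (by linarith) (by linarith) hδ0 hδ1
        calc (v - u) * ‖g u‖ ≤ (v - u) * (M * (t - u) ^ (-δ)) := by
              gcongr
          _ = M * ((t - u - (t - v)) * (t - u) ^ (-δ)) := by ring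
          _ ≤ M * (((t - u) ^ (1 - δ) - (t - v) ^ (1 - δ)) / (1 - δ)) := by gcongr
          _ = _ := by ring
      have e1 : Ψ u = (t - u) ^ (1 - δ) / (1 - δ) := by
        simp only [hΨ]; rw [min_eq_right (by linarith)]
      have e2 : Ψ v = (t - v) ^ (1 - δ) / (1 - δ) := by
        simp only [hΨ]; rw [min_eq_right (by linarith)]
      rw [← e1, ← e2] at b1 b2
      have := norm_sub_le ((v - u) • g u) (∫ r in u..v, g r)
      have h3 : 0 ≤ ε / 2 / (t - s) * (v - u) := mul_nonneg hε'.le (by linarith)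
      linarith
  have hsum : ∫ r in s..t, g r = ∑ i ∈ Finset.range π.n, ∫ r in (π.t i)..(π.t (i + 1)), g r := by
    rw [intervalIntegral.sum_integral_adjacent_intervals, π.first, π.last]
    exact fun k hk => hsub _ _ (part_ge π hk.le) (π.strict k hk).le (part_le π hk)
  rw [hsum, ← Finset.sum_sub_distrib]
  refine (norm_sum_le_of_le _ fun i hi => ?_).trans (b := ∑ i ∈ Finset.range π.n,
    (ε / 2 / (t - s) * (π.t (i + 1) - π.t i) + 2 * M * (Ψ (π.t i) - Ψ (π.t (i + 1))))) ?_
  · have hi := Finset.mem_range.mp hi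
    exact cell _ _ (part_ge π hi.le) (π.strict i hi) (part_le π hi) (part_le_mesh π hi)
  · rw [Finset.sum_add_distrib, ← Finset.mul_sum, ← Finset.mul_sum, part_sum,
      Finset.sum_range_sub' (fun i => Ψ (π.t i)), π.first, π.last, div_mul_cancel₀ _ (by linarith)]
    have h1 : Ψ t = 0 := by
      simp only [hΨ, sub_self]
      rw [min_eq_right (by positivity), Real.zero_rpow h1δ.ne', zero_div]
    have h2 : Ψ s ≤ (2 * η0) ^ (1 - δ) / (1 - δ) := by
      simp only [hΨ]
      have : 0 ≤ min (2 * η0) (t - s) := le_min (by positivity) (by linarith)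
      gcongr
      exact min_le_left _ _
    rw [h1, sub_zero]
    have : 2 * M * Ψ s ≤ 2 * M * ((2 * η0) ^ (1 - δ) / (1 - δ)) := by gcongr
    linarith

end Sing

end RPDE


namespace RPDE

/-- Continuity in `B_θ` on `[a,b]`. -/
def CtsOn (𝓑 : BanachScale) (θ a b : ℝ) (f : ℝ → 𝓑.E) : Prop :=
  ∀ t, a ≤ t → t ≤ b → ∀ ε > 0, ∃ η > 0, ∀ s, a ≤ s → s ≤ b → |s - t| < η → Bd 𝓑 θ (f s - f t) ε

section Drift

variable {𝓑 : BanachScale} {Sg : ScaleSemigroup 𝓑} {α β γ δ σ T : ℝ}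
    {X : ℝ → ℝ} {X2 : ℝ → ℝ → ℝ} {C : ℝ} {a b K : ℝ} {f : ℝ → 𝓑.E}

theorem Ctx.δ0 (h : Ctx 𝓑 Sg α β γ δ σ T X X2 C) : 0 < δ := by linarith [h.hδ, h.hα]

theorem orbit_small (h : Ctx 𝓑 Sg α β γ δ σ T X X2 C) {θ : ℝ} {x : 𝓑.E}
    (hx : 𝓑.Mem θ x) {ε : ℝ} (hε : 0 < ε) :
    ∃ η > 0, ∀ p, 0 ≤ p → p < η → Bd 𝓑 θ (Sg.S p x - x) ε := by
  obtain ⟨η, hη, hl⟩ := Sg.S_strong_cont θ x hx ε hε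
  refine ⟨η, hη, fun p hp hpη => ?_⟩
  rcases hp.eq_or_lt with rfl | hp0
  · rw [Sg.S_id, sub_self]; exact Bd.zero hε.le
  · exact ⟨mem_sub (Sg.S_mem _ _ _ hp hx) hx, (hl p hp0 hpη).le⟩

theorem orbit_cont (h : Ctx 𝓑 Sg α β γ δ σ T X X2 C) {θ : ℝ} (hθ : θ ∈ Lv α γ δ σ) {x : 𝓑.E}
    (hx : 𝓑.Mem θ x) {ε : ℝ} (hε : 0 < ε) :
    ∃ η > 0, ∀ p q, 0 ≤ p → p ≤ T → 0 ≤ q → q ≤ T → |p - q| < η →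
      Bd 𝓑 θ (Sg.S p x - Sg.S q x) ε := by
  have hC : 0 < C := by linarith [h.one_le]
  obtain ⟨η, hη, hl⟩ := orbit_small h hx (div_pos hε hC)
  have key : ∀ p q, 0 ≤ p → p ≤ q → q ≤ T → q - p < η → Bd 𝓑 θ (Sg.S q x - Sg.S p x) ε := by
    intro p q hp hpq hq hlt
    have h1 := h.sb θ hθ p _ _ hp (by linarith) (hl (q - p) (by linarith) hlt)
    rw [mul_div_cancel₀ _ hC.ne'] at h1
    refine h1.congr ?_
    rw [map_sub, ← Sg.S_comp p (q - p) hp (by linarith), add_sub_cancel]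
  refine ⟨η, hη, fun p q hp hpT hq hqT hlt => ?_⟩
  rw [abs_lt] at hlt
  rcases le_total p q with hpq | hpq
  · exact (key p q hp hpq hqT (by linarith)).symm
  · exact key q p hq hpq hpT (by linarith)

/-- The integrand as a function into `B_γ`. -/
noncomputable def dg (𝓑 : BanachScale) (Sg : ScaleSemigroup 𝓑) (γ : ℝ) (f : ℝ → 𝓑.E) (t r : ℝ) :
    Sp 𝓑 γ :=
  open Classical in
  if hm : 𝓑.Mem γ (Sg.S (t - r) (f r)) then Sp.mk _ hm else 0

theorem dg_val {t r : ℝ} (hm : 𝓑.Mem γ (Sg.S (t - r) (f r))) :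
    Sp.val 𝓑 γ (dg 𝓑 Sg γ f t r) = Sg.S (t - r) (f r) := by
  simp only [dg, hm, dif_pos, Sp.val_mk]

theorem drift_bd (h : Ctx 𝓑 Sg α β γ δ σ T X X2 C) (ha : 0 ≤ a) (hb : b ≤ T)
    (hf : ∀ r, a ≤ r → r ≤ b → Bd 𝓑 (γ - δ) (f r) K) {t r : ℝ} (har : a ≤ r) (hrt : r < t)
    (htb : t ≤ b) : Bd 𝓑 γ (Sg.S (t - r) (f r)) (C * (t - r) ^ (-δ) * K) :=
  h.sm _ Lv.gd _ Lv.g δ h.δ0.le (by linarith [h.hδ1]) (by ring) _ _ _ (by linarith) (by linarith)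
    (hf r har (by linarith))

theorem dg_cont (h : Ctx 𝓑 Sg α β γ δ σ T X X2 C) (ha : 0 ≤ a) (hb : b ≤ T)
    (hf : ∀ r, a ≤ r → r ≤ b → Bd 𝓑 (γ - δ) (f r) K) (hc : CtsOn 𝓑 (γ - δ) a b f)
    {t : ℝ} (htb : t ≤ b) : ContinuousOn (dg 𝓑 Sg γ f t) (Ico a t) := by
  rw [Metric.continuousOn_iff]
  intro r0 hr0 ε hε
  obtain ⟨har0, hr0t⟩ := hr0
  have hC : 0 < C := by linarith [h.one_le]
  set τ := (t - r0) / 2 with hτ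
  have hτ0 : 0 < τ := by simp only [hτ]; linarith
  set A := C * τ ^ (-δ) with hA
  have hA0 : 0 < A := by positivity
  set ε1 := ε / 2 / A / (C + 1) with hε1
  have hε1p : 0 < ε1 := by positivity
  obtain ⟨η1, hη1, h1⟩ := hc r0 har0 (by linarith) ε1 hε1p
  obtain ⟨η2, hη2, h2⟩ := orbit_cont h Lv.gd (hf r0 har0 (by linarith)).1 hε1p
  refine ⟨min τ (min η1 η2), by positivity, fun r hr hd => ?_⟩
  obtain ⟨har, hrt⟩ := hr
  rw [Real.dist_eq] at hd
  have hd1 := hd.trans_le (min_le_left _ _)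
  have hd2 := hd.trans_le ((min_le_right _ _).trans (min_le_left _ _))
  have hd3 := hd.trans_le ((min_le_right _ _).trans (min_le_right _ _))
  have hp : 0 ≤ t - r - τ := by
    have := (abs_lt.mp hd1).2
    simp only [hτ] at this ⊢; linarith
  have hp0 : 0 ≤ t - r0 - τ := by simp only [hτ]; linarith
  have e1 := h.sb _ Lv.gd (t - r - τ) _ _ hp (by linarith) (h1 r har (by linarith) hd2)
  have e2 := h2 (t - r - τ) (t - r0 - τ) hp (by linarith) hp0 (by linarith) (by
    rw [show t - r - τ - (t - r0 - τ) = -(r - r0) by ring, abs_neg]; exact hd3)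
  have e3 := h.sm _ Lv.gd _ Lv.g δ h.δ0.le (by linarith [h.hδ1]) (by ring) τ _ _ hτ0 (by linarith)
    (e1.add e2)
  have m1 := (drift_bd h ha hb hf har hrt htb).1
  have m2 := (drift_bd h ha hb hf har0 hr0t htb).1
  rw [dist_eq_norm, ← Sp.norm_val, map_sub, dg_val m1, dg_val m2]
  have e4 : Sg.S (t - r) (f r) - Sg.S (t - r0) (f r0) = Sg.S τ (Sg.S (t - r - τ) (f r - f r0) +
      (Sg.S (t - r - τ) (f r0) - Sg.S (t - r0 - τ) (f r0))) := by
    rw [map_sub (Sg.S (t - r - τ)), sub_add_sub_cancel, map_sub, ← Sg.S_comp _ _ hτ0.le hp,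
      ← Sg.S_comp _ _ hτ0.le hp0, add_sub_cancel, add_sub_cancel]
  rw [e4]
  refine e3.2.trans_lt ?_
  have : C * τ ^ (-δ) * (C * ε1 + ε1) = ε / 2 := by
    rw [← hA, hε1]; field_simp
  rw [this]; linarith

theorem S_clm (h : Ctx 𝓑 Sg α β γ δ σ T X X2 C) {p : ℝ} (hp : 0 ≤ p) (hpT : p ≤ T) :
    ∃ L : Sp 𝓑 γ →L[ℝ] Sp 𝓑 γ, ∀ x, Sp.val 𝓑 γ (L x) = Sg.S p (Sp.val 𝓑 γ x) := by
  refine ⟨LinearMap.mkContinuous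
    { toFun := fun x => Sp.mk (Sg.S p (Sp.val 𝓑 γ x)) (Sg.S_mem p γ _ hp x.val_mem)
      map_add' := fun x y => Sp.val_inj (by
        rw [map_add (Sp.val 𝓑 γ) (Sp.mk _ _), Sp.val_mk, Sp.val_mk, Sp.val_mk, map_add, map_add])
      map_smul' := fun c x => Sp.val_inj (by
        rw [map_smul (Sp.val 𝓑 γ) _ (Sp.mk _ _), Sp.val_mk, Sp.val_mk, map_smul, map_smul,
          RingHom.id_apply]) } C
    (fun x => (h.sb _ Lv.g p _ _ hp hpT ⟨x.val_mem, x.norm_val.le⟩).2), fun x => rfl⟩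

theorem intSum_val {g : ℝ → Sp 𝓑 γ} {F : ℝ → 𝓑.E} {s t : ℝ} (π : RPartition s t)
    (hg : ∀ r, s ≤ r → r < t → Sp.val 𝓑 γ (g r) = F r) :
    Sp.val 𝓑 γ (∑ i ∈ Finset.range π.n, (π.t (i + 1) - π.t i) • g (π.t i)) =
      intRiemannSum 𝓑 F π := by
  rw [map_sum, intRiemannSum]
  refine Finset.sum_congr rfl fun i hi => ?_
  have hi := Finset.mem_range.mp hi
  rw [map_smul, hg _ (part_ge π hi.le) (part_lt π hi)]

theorem drift_exists (h : Ctx 𝓑 Sg α β γ δ σ T X X2 C) (ha : 0 ≤ a) (hb : b ≤ T)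
    (hf : ∀ r, a ≤ r → r ≤ b → Bd 𝓑 (γ - δ) (f r) K) (hc : CtsOn 𝓑 (γ - δ) a b f) :
    ∃ D : ℝ → ℝ → 𝓑.E,
      (∀ s u t, a ≤ s → s ≤ u → u ≤ t → t ≤ b → D s t = D u t + Sg.S (t - u) (D s u)) ∧
      (∀ s t, a ≤ s → s < t → t ≤ b →
        IsRiemannIntegral 𝓑 γ (fun r => Sg.S (t - r) (f r)) s t (D s t)) ∧
      (∀ s, D s s = 0) := by
  have rs : ∀ s t, a ≤ s → s < t → t ≤ b → _ := fun s t has hst htb =>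
    riemann_sing (g := dg 𝓑 Sg γ f t) (M := C * K) hst h.δ0.le h.hδ1
      (mul_nonneg h.C0 (hf s has (by linarith)).nonneg)
      ((dg_cont h ha hb hf hc htb).mono (Ico_subset_Ico_left has)) (fun r hr => by
        have := drift_bd h ha hb hf (has.trans hr.1) hr.2 htb
        rw [← Sp.norm_val, dg_val this.1]
        exact this.2.trans_eq (by ring))
  refine ⟨fun s t => Sp.val 𝓑 γ (∫ r in s..t, dg 𝓑 Sg γ f t r), ?_, ?_, ?_⟩
  · intro s u t has hsu hut htb
    rcases hut.eq_or_lt with rfl | hut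
    · simp [Sg.S_id]
    rcases hsu.eq_or_lt with rfl | hsu
    · simp
    obtain ⟨L, hL⟩ := S_clm h (p := t - u) (by linarith) (by linarith)
    have i1 := (rs s u has hsu (by linarith)).1
    have i2 := (rs s t has (by linarith) htb).1
    have i3 : IntervalIntegrable (dg 𝓑 Sg γ f t) MeasureTheory.volume s u := i2.mono_set (by
      rw [uIcc_of_le hsu.le, uIcc_of_le (by linarith)]; exact Icc_subset_Icc le_rfl hut.le)
    have i4 := (rs u t (by linarith) hut htb).1
    have e1 : ∫ r in s..u, dg 𝓑 Sg γ f t r = L (∫ r in s..u, dg 𝓑 Sg γ f u r) := by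
      rw [← L.intervalIntegral_comp_comm i1]
      have hne : ∀ᵐ r : ℝ, r ≠ u := by simp [MeasureTheory.ae_iff]
      refine intervalIntegral.integral_congr_ae ?_
      filter_upwards [hne] with r hr hr2
      rw [uIoc_of_le hsu.le] at hr2
      have hru : r < u := lt_of_le_of_ne hr2.2 hr
      apply Sp.val_inj
      rw [hL, dg_val (drift_bd h ha hb hf (by linarith [hr2.1]) (by linarith) htb).1,
        dg_val (drift_bd h ha hb hf (by linarith [hr2.1]) hru (by linarith)).1,
        ← Sg.S_comp _ _ (by linarith) (by linarith)]
      congr 2; ring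
    rw [← hL, ← e1, ← map_add, add_comm, intervalIntegral.integral_add_adjacent_intervals i3 i4]
  · intro s t has hst htb
    refine ⟨Sp.val_mem _, fun ε hε => ?_⟩
    obtain ⟨η, hη, hl⟩ := (rs s t has hst htb).2 ε hε
    refine ⟨η, hη, fun π hπ => ?_⟩
    have := hl π hπ
    rw [← Sp.norm_val, map_sub, intSum_val π (F := fun r => Sg.S (t - r) (f r))
      (fun r hr hrt => dg_val (drift_bd h ha hb hf (has.trans hr) hrt htb).1)] at this
    exact this
  · intro s; simp

theorem drift_sum_bd (h : Ctx 𝓑 Sg α β γ δ σ T X X2 C) (ha : 0 ≤ a) (hb : b ≤ T)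
    (hf : ∀ r, a ≤ r → r ≤ b → Bd 𝓑 (γ - δ) (f r) K) {θ κ s t : ℝ} (hθ : θ ∈ Lv α γ δ σ)
    (hκ0 : 0 ≤ κ) (hκ1 : κ < 1) (hθκ : θ = γ - δ + κ) (has : a ≤ s) (htb : t ≤ b) (hst : s < t)
    (π : RPartition s t) : Bd 𝓑 θ (intRiemannSum 𝓑 (fun r => Sg.S (t - r) (f r)) π)
      (C * K * ((t - s) ^ (1 - κ) / (1 - κ))) := by
  have hK := (hf s has (by linarith)).nonneg
  have h1 := Bd.sum (𝓑 := 𝓑) (θ := θ) (Finset.range π.n)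
    (fun i => (π.t (i + 1) - π.t i) • Sg.S (t - π.t i) (f (π.t i)))
    (fun i => (π.t (i + 1) - π.t i) * (C * (t - π.t i) ^ (-κ) * K)) (fun i hi => by
      have hi := Finset.mem_range.mp hi
      have p1 := part_ge π hi.le
      have p2 := part_lt π hi
      refine Bd.smul (h.sm _ Lv.gd _ hθ κ hκ0 (by linarith) hθκ _ _ _ (by linarith) (by linarith)
        (hf _ (by linarith) (by linarith))) ?_
      rw [abs_of_pos (by linarith [π.strict i hi])])
  refine h1.mono ?_
  have h2 := part_sum_sing π hκ0 hκ1
  calc _ = C * K * ∑ i ∈ Finset.range π.n, (π.t (i + 1) - π.t i) * (t - π.t i) ^ (-κ) := by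
        rw [Finset.mul_sum]; exact Finset.sum_congr rfl fun i _ => by ring
    _ ≤ _ := by gcongr; exact mul_nonneg h.C0 hK

theorem riemann_bd {F : ℝ → 𝓑.E} {θ θ' s t c : ℝ} {I : 𝓑.E} (hst : s < t) (hle : θ ≤ θ')
    (hI : IsRiemannIntegral 𝓑 θ' F s t I)
    (hm : ∀ π : RPartition s t, 𝓑.Mem θ' (intRiemannSum 𝓑 F π))
    (hb : ∀ π : RPartition s t, Bd 𝓑 θ (intRiemannSum 𝓑 F π) c) : Bd 𝓑 θ I c := by
  obtain ⟨C, hC1, hC⟩ := Bd.emb hle 𝓑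
  have hC0 : 0 < C := by linarith
  refine Bd.of_forall fun ε hε => ?_
  obtain ⟨η, hη, hl⟩ := hI.2 (ε / C) (by positivity)
  obtain ⟨π, hπ⟩ := exists_mesh_lt hst hη
  have h1 : Bd 𝓑 θ (intRiemannSum 𝓑 F π - I) ε :=
    (hC _ _ ⟨mem_sub (hm π) hI.1, hl π hπ⟩).mono (by rw [mul_div_cancel₀ _ hC0.ne'])
  exact ((hb π).sub h1).congr (by abel)

/-- Bounds for the drift term. -/
theorem drift_bounds (h : Ctx 𝓑 Sg α β γ δ σ T X X2 C) : ∃ C5, 0 ≤ C5 ∧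
    ∀ (a b : ℝ) (f : ℝ → 𝓑.E) (K s t : ℝ) (D : 𝓑.E), 0 ≤ a → b ≤ T →
      (∀ r, a ≤ r → r ≤ b → Bd 𝓑 (γ - δ) (f r) K) → a ≤ s → s < t → t ≤ b →
      IsRiemannIntegral 𝓑 γ (fun r => Sg.S (t - r) (f r)) s t D →
      Bd 𝓑 γ D (C5 * K * (t - s) ^ (1 - δ)) ∧ Bd 𝓑 (γ - α) D (C5 * K * (t - s) ^ α) ∧
      Bd 𝓑 (γ - 2 * α) D (C5 * K * (t - s) ^ (2 * α)) := by
  have hd := h.hδ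
  have hd1 := h.hδ1
  have hα := h.hα
  have hα2 := h.hα2
  have hC0 := h.C0
  refine ⟨C * C / (1 - δ), div_nonneg (by positivity) (by linarith), ?_⟩
  intro a b f K s t D ha hb hf has hst htb hD
  have hK := (hf s has (by linarith)).nonneg
  have sum := fun (θ κ : ℝ) (hθ : θ ∈ Lv α γ δ σ) (hκ0 : 0 ≤ κ) (hκ1 : κ < 1)
    (hθκ : θ = γ - δ + κ) => drift_sum_bd h ha hb hf hθ hκ0 hκ1 hθκ has htb hst
  have gen : ∀ θ κ e : ℝ, θ ∈ Lv α γ δ σ → 0 ≤ κ → κ ≤ δ → θ = γ - δ + κ → 0 ≤ e → e ≤ 1 - κ →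
      Bd 𝓑 θ D (C * C / (1 - δ) * K * (t - s) ^ e) := by
    intro θ κ e hθ hκ0 hκ1 hθκ he0 he1
    have := riemann_bd hst (θ := θ) (by linarith) hD
      (fun π => (sum γ δ Lv.g h.δ0.le h.hδ1 (by ring) π).1)
      (fun π => sum θ κ hθ hκ0 (by linarith) hθκ π)
    refine this.mono ?_
    have p1 := h.pw (t - s) (1 - κ) e (by linarith) (by linarith) he0 he1 (by linarith)
    have p0 : 0 ≤ (t - s) ^ e := Real.rpow_nonneg (by linarith) _
    calc C * K * ((t - s) ^ (1 - κ) / (1 - κ)) ≤ C * K * ((C * (t - s) ^ e) / (1 - δ)) := by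
          gcongr
      _ = _ := by ring
  exact ⟨gen γ δ (1 - δ) Lv.g h.δ0.le le_rfl (by ring) (by linarith) le_rfl,
    gen (γ - α) (δ - α) α Lv.ga (by linarith) (by linarith) (by ring) (by linarith) (by linarith),
    gen (γ - 2 * α) (δ - 2 * α) (2 * α) Lv.g2 (by linarith) (by linarith) (by ring) (by linarith)
      (by linarith)⟩

theorem drift_mem (h : Ctx 𝓑 Sg α β γ δ σ T X X2 C) (ha : 0 ≤ a) (hb : b ≤ T)
    (hf : ∀ r, a ≤ r → r ≤ b → Bd 𝓑 (γ - δ) (f r) K) {s t : ℝ} (has : a ≤ s) (htb : t ≤ b)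
    (hst : s < t) (π : RPartition s t) :
    𝓑.Mem γ (intRiemannSum 𝓑 (fun r => Sg.S (t - r) (f r)) π) :=
  (drift_sum_bd h ha hb hf Lv.g h.δ0.le h.hδ1 (by ring) has htb hst π).1

end Drift

end RPDE


namespace RPDE

/-- `w` is the sum of the drift integral and the rough convolution over `[s,t]`. -/
def Rep (𝓑 : BanachScale) (Sg : ScaleSemigroup 𝓑) (α γ : ℝ) (X : ℝ → ℝ) (X2 : ℝ → ℝ → ℝ)
    (s t : ℝ) (Y Y' f : ℝ → 𝓑.E) (w : 𝓑.E) : Prop :=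
  ∃ D Z : 𝓑.E, IsRiemannIntegral 𝓑 γ (fun r => Sg.S (t - r) (f r)) s t D ∧
    IsRoughConvolution 𝓑 Sg X X2 Y Y' (γ - 2 * α) s t Z ∧ w = D + Z

section Drv

variable {𝓑 : BanachScale} {Sg : ScaleSemigroup 𝓑} {α β γ δ σ T : ℝ}
    {X : ℝ → ℝ} {X2 : ℝ → ℝ → ℝ} {C : ℝ} {a b K K1 K2 : ℝ} {f f1 f2 Y Y' Y1 Y1' Y2 Y2' : ℝ → 𝓑.E}

theorem Rep.congr {s t : ℝ} {w : 𝓑.E} (hr : Rep 𝓑 Sg α γ X X2 s t Y1 Y1' f1 w)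
    (h1 : ∀ r, s ≤ r → r < t → Y2 r = Y1 r) (h2 : ∀ r, s ≤ r → r < t → Y2' r = Y1' r)
    (h3 : ∀ r, s ≤ r → r < t → f2 r = f1 r) : Rep 𝓑 Sg α γ X X2 s t Y2 Y2' f2 w := by
  obtain ⟨D, Z, hD, hZ, hw⟩ := hr
  refine ⟨D, Z, ⟨hD.1, fun ε hε => ?_⟩, ⟨hZ.1, fun ε hε => ?_⟩, hw⟩
  · obtain ⟨η, hη, hl⟩ := hD.2 ε hε
    refine ⟨η, hη, fun π hπ => ?_⟩
    convert hl π hπ using 3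
    refine Finset.sum_congr rfl fun i hi => ?_
    have hi := Finset.mem_range.mp hi
    simp only
    rw [h3 _ (part_ge π hi.le) (part_lt π hi)]
  · obtain ⟨η, hη, hl⟩ := hZ.2 ε hε
    refine ⟨η, hη, fun π hπ => ?_⟩
    convert hl π hπ using 3
    refine Finset.sum_congr rfl fun i hi => ?_
    have hi := Finset.mem_range.mp hi
    rw [h1 _ (part_ge π hi.le) (part_lt π hi), h2 _ (part_ge π hi.le) (part_lt π hi)]

theorem Rep.unique (h : Ctx 𝓑 Sg α β γ δ σ T X X2 C) (ha : 0 ≤ a) (hb : b ≤ T)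
    (hI : IB 𝓑 α β γ σ X a b Y Y' K1) (hf : ∀ r, a ≤ r → r ≤ b → Bd 𝓑 (γ - δ) (f r) K2)
    {s t : ℝ} (has : a ≤ s) (hst : s < t) (htb : t ≤ b) {w1 w2 : 𝓑.E}
    (h1 : Rep 𝓑 Sg α γ X X2 s t Y Y' f w1) (h2 : Rep 𝓑 Sg α γ X X2 s t Y Y' f w2) : w1 = w2 := by
  obtain ⟨D, Z, hD, hZ, rfl⟩ := h1
  obtain ⟨D', Z', hD', hZ', rfl⟩ := h2
  rw [lim_unique hst (fun π => drift_mem h ha hb hf has htb hst π) hD hD',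
    lim_unique hst (fun π => conv_sum_mem h hI has htb π) hZ hZ']

theorem lim_sub {θ s t : ℝ} {P Q R : RPartition s t → 𝓑.E} {I J : 𝓑.E}
    (hP : ∀ π, 𝓑.Mem θ (P π)) (hQ : ∀ π, 𝓑.Mem θ (Q π)) (hR : ∀ π, R π = P π - Q π)
    (hI : 𝓑.Mem θ I ∧ ∀ ε > (0:ℝ), ∃ δ > (0:ℝ), ∀ π : RPartition s t, π.mesh < δ →
      𝓑.N θ (P π - I) ≤ ε)
    (hJ : 𝓑.Mem θ J ∧ ∀ ε > (0:ℝ), ∃ δ > (0:ℝ), ∀ π : RPartition s t, π.mesh < δ →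
      𝓑.N θ (Q π - J) ≤ ε) :
    𝓑.Mem θ (I - J) ∧ ∀ ε > (0:ℝ), ∃ δ > (0:ℝ), ∀ π : RPartition s t, π.mesh < δ →
      𝓑.N θ (R π - (I - J)) ≤ ε := by
  refine ⟨mem_sub hI.1 hJ.1, fun ε hε => ?_⟩
  obtain ⟨η, hη, h1⟩ := hI.2 (ε / 2) (half_pos hε)
  obtain ⟨η', hη', h2⟩ := hJ.2 (ε / 2) (half_pos hε)
  refine ⟨min η η', lt_min hη hη', fun π hπ => ?_⟩
  have b1 : Bd 𝓑 θ (P π - I) (ε / 2) := ⟨mem_sub (hP π) hI.1, h1 π (hπ.trans_le (min_le_left _ _))⟩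
  have b2 : Bd 𝓑 θ (Q π - J) (ε / 2) := ⟨mem_sub (hQ π) hJ.1, h2 π (hπ.trans_le (min_le_right _ _))⟩
  have := (b1.sub b2).2
  rw [add_halves] at this
  rw [hR]
  convert this using 2
  abel

theorem Rep.sub (h : Ctx 𝓑 Sg α β γ δ σ T X X2 C) (ha : 0 ≤ a) (hb : b ≤ T)
    {L1 L2 : ℝ}
    (hI1 : IB 𝓑 α β γ σ X a b Y1 Y1' K1) (hf1 : ∀ r, a ≤ r → r ≤ b → Bd 𝓑 (γ - δ) (f1 r) L1)
    (hI2 : IB 𝓑 α β γ σ X a b Y2 Y2' K2) (hf2 : ∀ r, a ≤ r → r ≤ b → Bd 𝓑 (γ - δ) (f2 r) L2)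
    {s t : ℝ} (has : a ≤ s) (hst : s < t) (htb : t ≤ b) {w1 w2 : 𝓑.E}
    (h1 : Rep 𝓑 Sg α γ X X2 s t Y1 Y1' f1 w1) (h2 : Rep 𝓑 Sg α γ X X2 s t Y2 Y2' f2 w2) :
    Rep 𝓑 Sg α γ X X2 s t (fun r => Y1 r - Y2 r) (fun r => Y1' r - Y2' r)
      (fun r => f1 r - f2 r) (w1 - w2) := by
  obtain ⟨D, Z, hD, hZ, rfl⟩ := h1
  obtain ⟨D', Z', hD', hZ', rfl⟩ := h2
  refine ⟨D - D', Z - Z', ?_, ?_, by abel⟩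
  · refine lim_sub (fun π => drift_mem h ha hb hf1 has htb hst π)
      (fun π => drift_mem h ha hb hf2 has htb hst π) (fun π => ?_) hD hD'
    simp only [intRiemannSum, ← Finset.sum_sub_distrib]
    exact Finset.sum_congr rfl fun i _ => by rw [map_sub, smul_sub]
  · refine lim_sub (fun π => conv_sum_mem h hI1 has htb π)
      (fun π => conv_sum_mem h hI2 has htb π) (fun π => ?_) hZ hZ'
    simp only [convRiemannSum, ← Finset.sum_sub_distrib, ← map_sub]
    refine Finset.sum_congr rfl fun i _ => ?_
    congr 1
    module

theorem W_exists (h : Ctx 𝓑 Sg α β γ δ σ T X X2 C) (ha : 0 ≤ a) (hab : a ≤ b) (hb : b ≤ T)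
    (hI : IB 𝓑 α β γ σ X a b Y Y' K1) (hf : ∀ r, a ≤ r → r ≤ b → Bd 𝓑 (γ - δ) (f r) K2)
    (hc : CtsOn 𝓑 (γ - δ) a b f) : ∃ W : ℝ → ℝ → 𝓑.E,
      (∀ s u t, a ≤ s → s ≤ u → u ≤ t → t ≤ b → W s t = W u t + Sg.S (t - u) (W s u)) ∧
      (∀ s t, a ≤ s → s < t → t ≤ b → Rep 𝓑 Sg α γ X X2 s t Y Y' f (W s t)) ∧
      (∀ s, a ≤ s → s ≤ b → W s s = 0) := by
  obtain ⟨D, hD1, hD2, hD3⟩ := drift_exists h ha hb hf hc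
  obtain ⟨I, hI1, hI2⟩ := conv_exists h ha hab hb hI
  have hC0 := h.C0
  have hk := kap_pos h.hβ3
  have hcv : IsConv 𝓑 Sg α β γ σ X X2 a b Y Y' (kap (3 * β) * (5 * C ^ 5) * K1) I := ⟨hI1, hI2⟩
  refine ⟨fun s t => D s t + I s t, ?_, ?_, ?_⟩
  · intro s u t h1 h2 h3 h4
    simp only
    rw [hD1 s u t h1 h2 h3 h4, hI1 s u t h1 h2 h3 h4, map_add]
    abel
  · intro s t h1 h2 h3
    exact ⟨D s t, I s t, hD2 s t h1 h2 h3, hcv.isRough h (by positivity) ha hb hI h1 h2 h3, rfl⟩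
  · intro s h1 h2
    simp only [hD3, zero_add]
    have := hI1 s s s h1 le_rfl le_rfl h2
    rw [sub_self, Sg.S_id] at this
    simpa using this

/-- The three basic bounds of a two parameter increment. -/
def WB (𝓑 : BanachScale) (α γ ρ : ℝ) (X : ℝ → ℝ) (s t : ℝ) (Y : ℝ → 𝓑.E) (w : 𝓑.E) (c : ℝ) : Prop :=
  Bd 𝓑 γ w (c * (t - s) ^ ρ) ∧ Bd 𝓑 (γ - α) (w - (X t - X s) • Y s) (c * (t - s) ^ α) ∧
    Bd 𝓑 (γ - 2 * α) (w - (X t - X s) • Y s) (c * (t - s) ^ (2 * α))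

/-- The driver bound. -/
structure Drv (𝓑 : BanachScale) (Sg : ScaleSemigroup 𝓑) (α β γ δ σ T : ℝ)
    (X : ℝ → ℝ) (X2 : ℝ → ℝ → ℝ) (C ρ : ℝ) : Prop extends Ctx 𝓑 Sg α β γ δ σ T X X2 C where
  ρ0 : 0 < ρ
  ρ1 : ρ ≤ α - β
  wb : ∀ (a b : ℝ) (Y Y' f : ℝ → 𝓑.E) (K s t : ℝ) (w : 𝓑.E), 0 ≤ a → b ≤ T →
    IB 𝓑 α β γ σ X a b Y Y' K → (∀ r, a ≤ r → r ≤ b → Bd 𝓑 (γ - δ) (f r) K) →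
    a ≤ s → s < t → t ≤ b → Rep 𝓑 Sg α γ X X2 s t Y Y' f w → WB 𝓑 α γ ρ X s t Y w (C * K)

theorem Ctx.mono (h : Ctx 𝓑 Sg α β γ δ σ T X X2 C) {C' : ℝ} (hC : C ≤ C') :
    Ctx 𝓑 Sg α β γ δ σ T X X2 C' := by
  have hp : ∀ {d : ℝ} (e : ℝ), 0 ≤ d → 0 ≤ d ^ e := fun e hd => Real.rpow_nonneg hd e
  refine { h with one_le := h.one_le.trans hC, emb := ?_, sb := ?_, sm := ?_, hd := ?_, hX := ?_,
                  hX2 := ?_, pw := ?_ }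
  · intro θ₁ m1 θ₂ m2 hle x c hx
    exact (h.emb θ₁ m1 θ₂ m2 hle x c hx).mono (mul_le_mul_of_nonneg_right hC hx.nonneg)
  · intro θ m t x c h1 h2 hx
    exact (h.sb θ m t x c h1 h2 hx).mono (mul_le_mul_of_nonneg_right hC hx.nonneg)
  · intro θ₁ m1 θ₂ m2 κ h0 h1 he t x c h2 h3 hx
    refine (h.sm θ₁ m1 θ₂ m2 κ h0 h1 he t x c h2 h3 hx).mono ?_
    have := hx.nonneg
    gcongr
  · intro θ₁ m1 θ₂ m2 κ h0 h1 he t x c h2 h3 hx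
    refine (h.hd θ₁ m1 θ₂ m2 κ h0 h1 he t x c h2 h3 hx).mono ?_
    have := hx.nonneg
    gcongr
  · intro s t h1 h2 h3
    exact (h.hX s t h1 h2 h3).trans (mul_le_mul_of_nonneg_right hC (hp _ (by linarith)))
  · intro s t h1 h2 h3
    exact (h.hX2 s t h1 h2 h3).trans (mul_le_mul_of_nonneg_right hC (hp _ (by linarith)))
  · intro d e e' h1 h2 h3 h4 h5
    exact (h.pw d e e' h1 h2 h3 h4 h5).trans (mul_le_mul_of_nonneg_right hC (hp _ h1))

theorem exists_drv (h : Ctx 𝓑 Sg α β γ δ σ T X X2 C) : ∃ C' ρ, Drv 𝓑 Sg α β γ δ σ T X X2 C' ρ := by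
  obtain ⟨C5, hC5, hd⟩ := drift_bounds h
  have hC0 := h.C0
  have hk := kap_pos h.hβ3
  set ρ := min (α - β) (min (3 * β - 2 * α - σ) (1 - δ)) with hρ
  have hρ0 : 0 < ρ := lt_min (by linarith [h.hβ]) (lt_min (by linarith [h.hβz]) (by linarith [h.hδ1]))
  have hρ2 : ρ ≤ 3 * β - 2 * α - σ := (min_le_right _ _).trans (min_le_left _ _)
  have hρ3 : ρ ≤ 1 - δ := (min_le_right _ _).trans (min_le_right _ _)
  set c1 := kap (3 * β) * (5 * C ^ 5) with hc1
  have hc10 : 0 ≤ c1 := by positivity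
  obtain ⟨C4, hC4, hcb⟩ := conv_bounds h c1 ρ hc10 hρ0.le hρ2
  set C' := max C (C5 * C + C5 + C4) with hC'
  refine ⟨C', ρ, { h.mono (le_max_left C _) with ρ0 := hρ0, ρ1 := min_le_left _ _, wb := ?_ }⟩
  intro a b Y Y' f K s t w ha hb hI hf has hst htb hw
  obtain ⟨D, Z, hD, hZ, rfl⟩ := hw
  have hK := hI.nonneg (by linarith)
  obtain ⟨d1, d2, d3⟩ := hd a b f K s t D ha hb hf has hst htb hD
  obtain ⟨I, hI1, hI2⟩ := conv_exists h ha (by linarith) hb hI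
  have hcv : IsConv 𝓑 Sg α β γ σ X X2 a b Y Y' (c1 * K) I := ⟨hI1, hI2⟩
  have hZI : Z = I s t := lim_unique hst (fun π => conv_sum_mem h hI has htb π) hZ
    (hcv.isRough h hc10 ha hb hI has hst htb)
  rw [hZI]
  obtain ⟨z1, z2, z3⟩ := hcb a b Y Y' K I ha hb hI hcv s t has hst htb
  have hp : ∀ e : ℝ, 0 ≤ (t - s) ^ e := fun e => Real.rpow_nonneg (by linarith) e
  have hle : C5 * C + C5 + C4 ≤ C' := le_max_right _ _
  have fin : ∀ e : ℝ, C5 * K * (t - s) ^ e + C4 * K * (t - s) ^ e ≤ C' * K * (t - s) ^ e := by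
    intro e
    have : C5 + C4 ≤ C' := by nlinarith [mul_nonneg hC5 hC0]
    rw [← add_mul, ← add_mul]
    gcongr
  refine ⟨(d1.add z1).mono ?_, ((d2.add z2).congr (by abel)).mono (fin α),
    ((d3.add z3).congr (by abel)).mono (fin _)⟩
  have p1 := h.pw (t - s) (1 - δ) ρ (by linarith) (by linarith) hρ0.le hρ3 (by linarith [h.δ0])
  have : C5 * C + C4 ≤ C' := by linarith
  calc C5 * K * (t - s) ^ (1 - δ) + C4 * K * (t - s) ^ ρ
      ≤ C5 * K * (C * (t - s) ^ ρ) + C4 * K * (t - s) ^ ρ := by gcongr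
    _ = (C5 * C + C4) * K * (t - s) ^ ρ := by ring
    _ ≤ _ := by
      gcongr

end Drv

end RPDE


namespace RPDE

/-- Differentiability on `[0,1]` in `B_θ`. -/
def HD (𝓑 : BanachScale) (θ : ℝ) (f f' : ℝ → 𝓑.E) : Prop :=
  ∀ r ∈ Icc (0:ℝ) 1, ∀ ε > 0, ∃ η > 0, ∀ r' ∈ Icc (0:ℝ) 1, |r' - r| < η →
      Bd 𝓑 θ (f r' - f r - (r' - r) • f' r) (ε * |r' - r|)

/-- Smoothness of a map `B_θ → B_θ'` with bounds. -/
structure Sm (𝓑 : BanachScale) (θ θ' : ℝ) (G : 𝓑.E → 𝓑.E) (DG : 𝓑.E → 𝓑.E →ₗ[ℝ] 𝓑.E)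
    (D2G : 𝓑.E → 𝓑.E →ₗ[ℝ] 𝓑.E →ₗ[ℝ] 𝓑.E) (L : ℝ) : Prop where
  L0 : 0 ≤ L
  g : ∀ x, 𝓑.Mem θ x → 𝓑.Mem θ' (G x)
  d1 : ∀ x k c, 𝓑.Mem θ x → Bd 𝓑 θ k c → Bd 𝓑 θ' (DG x k) (L * c)
  d2 : ∀ x h k c d, 𝓑.Mem θ x → Bd 𝓑 θ h c → Bd 𝓑 θ k d → Bd 𝓑 θ' (D2G x h k) (L * (c * d))
  hd1 : ∀ x q, 𝓑.Mem θ x → 𝓑.Mem θ q → HD 𝓑 θ' (fun r => G (x + r • q)) (fun r => DG (x + r • q) q)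
  hd2 : ∀ x q k, 𝓑.Mem θ x → 𝓑.Mem θ q → 𝓑.Mem θ k →
    HD 𝓑 θ' (fun r => DG (x + r • q) k) (fun r => D2G (x + r • q) q k)
  l2 : ∀ x x' h k e c d, 𝓑.Mem θ x → 𝓑.Mem θ x' → Bd 𝓑 θ (x - x') e → Bd 𝓑 θ h c → Bd 𝓑 θ k d →
    Bd 𝓑 θ' (D2G x h k - D2G x' h k) (L * (e * (c * d)))

section Sm

variable {𝓑 : BanachScale} {θ θ' L : ℝ} {G : 𝓑.E → 𝓑.E} {DG : 𝓑.E → 𝓑.E →ₗ[ℝ] 𝓑.E}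
    {D2G : 𝓑.E → 𝓑.E →ₗ[ℝ] 𝓑.E →ₗ[ℝ] 𝓑.E}

theorem HD.mv {f f' : ℝ → 𝓑.E} {c : ℝ} (hd : HD 𝓑 θ f f')
    (hf : ∀ r ∈ Icc (0:ℝ) 1, 𝓑.Mem θ (f r)) (hf' : ∀ r ∈ Icc (0:ℝ) 1, Bd 𝓑 θ (f' r) c) :
    Bd 𝓑 θ (f 1 - f 0) c :=
  mean_value hf hf' fun r hr ε hε => by
    obtain ⟨η, hη, hl⟩ := hd r hr ε hε
    exact ⟨η, hη, fun r' hr' h => (hl r' hr' h).2⟩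

theorem HD.sub {f f' g g' : ℝ → 𝓑.E} (hf : HD 𝓑 θ f f') (hg : HD 𝓑 θ g g') :
    HD 𝓑 θ (fun r => f r - g r) (fun r => f' r - g' r) := by
  intro r hr ε hε
  obtain ⟨η, hη, h1⟩ := hf r hr (ε / 2) (half_pos hε)
  obtain ⟨η', hη', h2⟩ := hg r hr (ε / 2) (half_pos hε)
  refine ⟨min η η', lt_min hη hη', fun r' hr' h => ?_⟩
  refine (((h1 r' hr' (h.trans_le (min_le_left _ _))).sub
    (h2 r' hr' (h.trans_le (min_le_right _ _)))).congr ?_).mono (by linarith)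
  simp only [smul_sub]; abel

theorem HD.lin (v : 𝓑.E) : HD 𝓑 θ (fun r => r • v) (fun _ => v) := by
  intro r _ ε hε
  refine ⟨1, one_pos, fun r' _ _ => ?_⟩
  have : r' • v - r • v - (r' - r) • v = 0 := by module
  simp only [this]
  exact Bd.zero (by positivity)

/-- Differentiability along a line from a Frechet type estimate. -/
theorem HD.line {Φ : 𝓑.E → 𝓑.E} {D : 𝓑.E → 𝓑.E →ₗ[ℝ] 𝓑.E} {A : ℝ} (hA : 0 ≤ A)
    (hm : ∀ x, 𝓑.Mem θ x → 𝓑.Mem θ' (Φ x))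
    (hDm : ∀ x h, 𝓑.Mem θ x → 𝓑.Mem θ h → 𝓑.Mem θ' (D x h))
    (hD : ∀ x : 𝓑.E, 𝓑.Mem θ x → ∀ ε > (0:ℝ), ∃ δ > (0:ℝ), ∀ h : 𝓑.E, 𝓑.Mem θ h → 𝓑.N θ h < δ →
      𝓑.N θ' (Φ (x + h) - Φ x - D x h) ≤ ε * (𝓑.N θ h * A))
    {x q : 𝓑.E} (hx : 𝓑.Mem θ x) (hq : 𝓑.Mem θ q) :
    HD 𝓑 θ' (fun r => Φ (x + r • q)) (fun r => D (x + r • q) q) := by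
  intro r hr ε hε
  have hN := 𝓑.N_nonneg θ q
  have hmr : ∀ r : ℝ, 𝓑.Mem θ (x + r • q) := fun r => 𝓑.mem_add _ _ _ hx (𝓑.mem_smul _ _ _ hq)
  have hpos : 0 < 𝓑.N θ q * A + 1 := by positivity
  obtain ⟨δ, hδ, hl⟩ := hD (x + r • q) (hmr r) (ε / (𝓑.N θ q * A + 1)) (by positivity)
  refine ⟨δ / (𝓑.N θ q + 1), by positivity, fun r' hr' h => ?_⟩
  have hq' := 𝓑.mem_smul θ (r' - r) q hq
  have e1 : x + r' • q = x + r • q + (r' - r) • q := by module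
  have hlt : 𝓑.N θ ((r' - r) • q) < δ := by
    rw [𝓑.N_smul]
    rw [lt_div_iff₀ (by positivity)] at h
    nlinarith [abs_nonneg (r' - r)]
  have h1 := hl _ hq' hlt
  simp only [e1]
  refine ⟨mem_sub (mem_sub (hm _ (e1 ▸ hmr r')) (hm _ (hmr r)))
    (𝓑.mem_smul _ _ _ (hDm _ _ (hmr r) hq)), ?_⟩
  rw [map_smul] at h1
  refine h1.trans ?_
  rw [𝓑.N_smul]
  have : 𝓑.N θ q * A / (𝓑.N θ q * A + 1) ≤ 1 := by rw [div_le_one hpos]; linarith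
  calc ε / (𝓑.N θ q * A + 1) * (|r' - r| * 𝓑.N θ q * A)
      = ε * |r' - r| * (𝓑.N θ q * A / (𝓑.N θ q * A + 1)) := by ring
    _ ≤ ε * |r' - r| * 1 := by gcongr
    _ = _ := mul_one _

theorem line_mem {x q : 𝓑.E} (hx : 𝓑.Mem θ x) (hq : 𝓑.Mem θ q) (r : ℝ) : 𝓑.Mem θ (x + r • q) :=
  𝓑.mem_add _ _ _ hx (𝓑.mem_smul _ _ _ hq)

theorem Sm.lip (h : Sm 𝓑 θ θ' G DG D2G L) {x x' : 𝓑.E} {e : ℝ} (hx : 𝓑.Mem θ x)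
    (hx' : 𝓑.Mem θ x') (he : Bd 𝓑 θ (x - x') e) : Bd 𝓑 θ' (G x - G x') (L * e) := by
  have := (h.hd1 x' (x - x') hx' he.1).mv (c := L * e)
    (fun r _ => h.g _ (line_mem hx' he.1 r)) (fun r _ => h.d1 _ _ _ (line_mem hx' he.1 r) he)
  simpa using this

theorem Sm.lipD (h : Sm 𝓑 θ θ' G DG D2G L) {x x' k : 𝓑.E} {e d : ℝ} (hx : 𝓑.Mem θ x)
    (hx' : 𝓑.Mem θ x') (he : Bd 𝓑 θ (x - x') e) (hk : Bd 𝓑 θ k d) :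
    Bd 𝓑 θ' (DG x k - DG x' k) (L * (e * d)) := by
  have := (h.hd2 x' (x - x') k hx' he.1 hk.1).mv (c := L * (e * d))
    (fun r _ => (h.d1 _ _ _ (line_mem hx' he.1 r) hk).1)
    (fun r _ => h.d2 _ _ _ _ _ (line_mem hx' he.1 r) he hk)
  simpa using this

theorem line_diff {a a' w w' : 𝓑.E} {e f r : ℝ} (hr : r ∈ Icc (0:ℝ) 1) (ha : Bd 𝓑 θ (a - a') e)
    (hw : Bd 𝓑 θ (w - w') f) : Bd 𝓑 θ (a + r • w - (a' + r • w')) (e + f) := by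
  have h1 : Bd 𝓑 θ (r • (w - w')) (1 * f) := hw.smul (by rw [abs_of_nonneg hr.1]; exact hr.2)
  rw [one_mul] at h1
  exact (ha.add h1).congr (by module)

theorem Sm.four (h : Sm 𝓑 θ θ' G DG D2G L) {a a' w w' : 𝓑.E} {e f w0 : ℝ} (ha : 𝓑.Mem θ a)
    (ha' : 𝓑.Mem θ a') (hw : 𝓑.Mem θ w) (hw' : Bd 𝓑 θ w' w0) (hea : Bd 𝓑 θ (a - a') e)
    (hew : Bd 𝓑 θ (w - w') f) :
    Bd 𝓑 θ' (G (a + w) - G a - (G (a' + w') - G a')) (L * (f + (e + f) * w0)) := by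
  have := ((h.hd1 a w ha hw).sub (h.hd1 a' w' ha' hw'.1)).mv (c := L * (f + (e + f) * w0))
    (fun r _ => mem_sub (h.g _ (line_mem ha hw r)) (h.g _ (line_mem ha' hw'.1 r)))
    (fun r hr => by
      refine (((h.d1 (a + r • w) _ _ (line_mem ha hw r) hew).add
        (h.lipD (line_mem ha hw r) (line_mem ha' hw'.1 r) (line_diff hr hea hew) hw')).congr ?_).mono
        (le_of_eq (by ring))
      simp only [map_sub]; abel)
  refine this.congr ?_
  simp only [one_smul, zero_smul, add_zero]; abel

theorem Sm.fourD (h : Sm 𝓑 θ θ' G DG D2G L) {a a' w w' k : 𝓑.E} {e f w0 d : ℝ} (ha : 𝓑.Mem θ a)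
    (ha' : 𝓑.Mem θ a') (hw : 𝓑.Mem θ w) (hw' : Bd 𝓑 θ w' w0) (hea : Bd 𝓑 θ (a - a') e)
    (hew : Bd 𝓑 θ (w - w') f) (hk : Bd 𝓑 θ k d) :
    Bd 𝓑 θ' (DG (a + w) k - DG a k - (DG (a' + w') k - DG a' k)) (L * (f + (e + f) * w0) * d) := by
  have := ((h.hd2 a w k ha hw hk.1).sub (h.hd2 a' w' k ha' hw'.1 hk.1)).mv
    (c := L * (f + (e + f) * w0) * d)
    (fun r _ => mem_sub (h.d1 _ _ _ (line_mem ha hw r) hk).1 (h.d1 _ _ _ (line_mem ha' hw'.1 r) hk).1)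
    (fun r hr => by
      refine (((h.d2 (a + r • w) _ k _ _ (line_mem ha hw r) hew hk).add
        (h.l2 _ _ _ k _ _ _ (line_mem ha hw r) (line_mem ha' hw'.1 r)
          (line_diff hr hea hew) hw' hk)).congr ?_).mono
        (le_of_eq (by ring))
      simp only [map_sub, LinearMap.sub_apply]; abel)
  refine this.congr ?_
  simp only [one_smul, zero_smul, add_zero]; abel

theorem smul_le {w : 𝓑.E} {c r : ℝ} (hr : r ∈ Icc (0:ℝ) 1) (h : Bd 𝓑 θ w c) : Bd 𝓑 θ (r • w) c := by
  have := h.smul (d := 1) (r := r) (by rw [abs_of_nonneg hr.1]; exact hr.2)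
  rwa [one_mul] at this

/-- Second order Taylor remainder. -/
theorem Sm.taylor (h : Sm 𝓑 θ θ' G DG D2G L) {a w : 𝓑.E} {w0 : ℝ} (ha : 𝓑.Mem θ a)
    (hw : Bd 𝓑 θ w w0) : Bd 𝓑 θ' (G (a + w) - G a - DG a w) (L * (w0 * w0)) := by
  have := ((h.hd1 a w ha hw.1).sub (HD.lin (DG a w))).mv (c := L * (w0 * w0))
    (fun r _ => mem_sub (h.g _ (line_mem ha hw.1 r)) (𝓑.mem_smul _ _ _ (h.d1 _ _ _ ha hw).1))
    (fun r hr => h.lipD (line_mem ha hw.1 r) ha ((smul_le hr hw).congr (by abel)) hw)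
  refine this.congr ?_
  simp only [one_smul, zero_smul, add_zero]; abel

theorem Sm.taylor2 (h : Sm 𝓑 θ θ' G DG D2G L) {a a' w w' : 𝓑.E} {e f w0 w1 : ℝ} (ha : 𝓑.Mem θ a)
    (ha' : 𝓑.Mem θ a') (hw : Bd 𝓑 θ w w1) (hw' : Bd 𝓑 θ w' w0) (hea : Bd 𝓑 θ (a - a') e)
    (hew : Bd 𝓑 θ (w - w') f) :
    Bd 𝓑 θ' (G (a + w) - G a - DG a w - (G (a' + w') - G a' - DG a' w'))
      (L * (w1 * f) + L * (f + (e + f) * w0) * w0) := by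
  have hf0 := hew.nonneg
  have he0 := hea.nonneg
  have hw0 := hw'.nonneg
  have hL := h.L0
  have := (((h.hd1 a w ha hw.1).sub (HD.lin (DG a w))).sub
    ((h.hd1 a' w' ha' hw'.1).sub (HD.lin (DG a' w')))).mv
    (c := L * (w1 * f) + L * (f + (e + f) * w0) * w0)
    (fun r _ => mem_sub (mem_sub (h.g _ (line_mem ha hw.1 r)) (𝓑.mem_smul _ _ _ (h.d1 _ _ _ ha hw).1))
      (mem_sub (h.g _ (line_mem ha' hw'.1 r)) (𝓑.mem_smul _ _ _ (h.d1 _ _ _ ha' hw').1)))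
    (fun r hr => by
      have e1 := h.lipD (line_mem ha hw.1 r) ha ((smul_le hr hw).congr
        (by abel : a + r • w - a = r • w)) hew
      have e2 := h.fourD ha ha' (smul_le hr hw).1 (smul_le hr hw') hea
        ((smul_le hr hew).congr (by module : r • w - r • w' = r • (w - w'))) hw'
      refine (e1.add e2).congr ?_
      simp only [map_sub]; abel)
  refine this.congr ?_
  simp only [one_smul, zero_smul, add_zero]; abel

end Sm

end RPDE


namespace RPDE

/-- All standing assumptions with one constant. -/
structure Eqn (𝓑 : BanachScale) (Sg : ScaleSemigroup 𝓑) (α β γ δ σ T : ℝ)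
    (X : ℝ → ℝ) (X2 : ℝ → ℝ → ℝ) (F G : 𝓑.E → 𝓑.E) (DG : 𝓑.E → 𝓑.E →ₗ[ℝ] 𝓑.E)
    (D2G : 𝓑.E → 𝓑.E →ₗ[ℝ] 𝓑.E →ₗ[ℝ] 𝓑.E) (C ρ : ℝ) : Prop
    extends Drv 𝓑 Sg α β γ δ σ T X X2 C ρ where
  s0 : Sm 𝓑 γ (γ - σ) G DG D2G C
  s1 : Sm 𝓑 (γ - α) (γ - α - σ) G DG D2G C
  s2 : Sm 𝓑 (γ - 2 * α) (γ - 2 * α - σ) G DG D2G C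
  dgg : ∀ x x' e, 𝓑.Mem (γ - α) x → 𝓑.Mem (γ - α) x' → Bd 𝓑 (γ - α) (x - x') e →
    Bd 𝓑 (γ - 2 * α - σ) (DG x (G x) - DG x' (G x')) (C * e)
  g0 : Bd 𝓑 (γ - σ) (G 0) C
  fl : ∀ R > 0, ∃ L ≥ 0, ∀ x y e, Bd 𝓑 γ x R → Bd 𝓑 γ y R → Bd 𝓑 γ (x - y) e →
    Bd 𝓑 (γ - δ) (F x - F y) (L * e)
  fg : ∀ x c, Bd 𝓑 γ x c → Bd 𝓑 (γ - δ) (F x) (C * (1 + c))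

section

variable {𝓑 : BanachScale} {Sg : ScaleSemigroup 𝓑} {α β γ δ σ T : ℝ}
    {X : ℝ → ℝ} {X2 : ℝ → ℝ → ℝ} {F G : 𝓑.E → 𝓑.E} {DG : 𝓑.E → 𝓑.E →ₗ[ℝ] 𝓑.E}
    {D2G : 𝓑.E → 𝓑.E →ₗ[ℝ] 𝓑.E →ₗ[ℝ] 𝓑.E} {D3G : 𝓑.E → 𝓑.E →ₗ[ℝ] 𝓑.E →ₗ[ℝ] 𝓑.E →ₗ[ℝ] 𝓑.E}
    {C ρ : ℝ}

theorem Drv.mono (h : Drv 𝓑 Sg α β γ δ σ T X X2 C ρ) {C' : ℝ} (hC : C ≤ C') :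
    Drv 𝓑 Sg α β γ δ σ T X X2 C' ρ := by
  refine { h.toCtx.mono hC with ρ0 := h.ρ0, ρ1 := h.ρ1, wb := ?_ }
  intro a b Y Y' f K s t w ha hb hI hf has hst htb hw
  have hK := hI.nonneg (by linarith)
  obtain ⟨h1, h2, h3⟩ := h.wb a b Y Y' f K s t w ha hb hI hf has hst htb hw
  have fin : ∀ e : ℝ, C * K * (t - s) ^ e ≤ C' * K * (t - s) ^ e := by
    intro e
    have := Real.rpow_nonneg (show 0 ≤ t - s by linarith) e
    gcongr
  exact ⟨h1.mono (fin _), h2.mono (fin _), h3.mono (fin _)⟩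

theorem Sm.mono {θ θ' L L' : ℝ} (h : Sm 𝓑 θ θ' G DG D2G L) (hL : L ≤ L') :
    Sm 𝓑 θ θ' G DG D2G L' := by
  refine { h with L0 := h.L0.trans hL, d1 := ?_, d2 := ?_, l2 := ?_ }
  · intro x k c hx hk
    exact (h.d1 x k c hx hk).mono (mul_le_mul_of_nonneg_right hL hk.nonneg)
  · intro x k l c d hx hk hl
    exact (h.d2 x k l c d hx hk hl).mono
      (mul_le_mul_of_nonneg_right hL (mul_nonneg hk.nonneg hl.nonneg))
  · intro x x' k l e c d hx hx' he hk hl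
    exact (h.l2 x x' k l e c d hx hx' he hk hl).mono
      (mul_le_mul_of_nonneg_right hL (mul_nonneg he.nonneg (mul_nonneg hk.nonneg hl.nonneg)))

theorem exists_sm (hG : AssumptionG 𝓑 α σ γ G DG D2G D3G) {θ : ℝ}
    (hθ : θ ∈ ({0, α, 2 * α} : Set ℝ)) : ∃ L, Sm 𝓑 (γ - θ) (γ - θ - σ) G DG D2G L := by
  obtain ⟨C1, h1⟩ := hG.DG_bound θ hθ
  obtain ⟨C2, h2⟩ := hG.D2G_bound θ hθ
  obtain ⟨C3, h3⟩ := hG.D3G_bound θ hθ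
  set L := max 0 (max C1 (max C2 C3)) with hL
  have hL0 : 0 ≤ L := le_max_left _ _
  have hL1 : C1 ≤ L := (le_max_left _ _).trans (le_max_right _ _)
  have hL2 : C2 ≤ L := (le_max_left _ _).trans ((le_max_right _ _).trans (le_max_right _ _))
  have hL3 : C3 ≤ L := (le_max_right _ _).trans ((le_max_right _ _).trans (le_max_right _ _))
  have nn := 𝓑.N_nonneg
  refine ⟨L, hL0, hG.maps θ hθ, ?_, ?_, ?_, ?_, ?_⟩
  · intro x k c hx hk
    refine ⟨hG.DG_maps θ hθ x k hx hk.1, (h1 x k hx hk.1).trans ?_⟩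
    exact mul_le_mul hL1 hk.2 (nn _ _) hL0
  · intro x k l c d hx hk hl
    refine ⟨hG.D2G_maps θ hθ x k l hx hk.1 hl.1, (h2 x k l hx hk.1 hl.1).trans ?_⟩
    exact mul_le_mul hL2 (mul_le_mul hk.2 hl.2 (nn _ _) hk.nonneg)
      (mul_nonneg (nn _ _) (nn _ _)) hL0
  · intro x q hx hq
    refine HD.line (A := 1) zero_le_one (hG.maps θ hθ) (hG.DG_maps θ hθ) ?_ hx hq
    simpa using hG.DG_isDeriv θ hθ
  · intro x q k hx hq hk
    refine HD.line (Φ := fun x => DG x k) (D := fun x => (D2G x).flip k) (nn (γ - θ) k)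
      (fun x hx => hG.DG_maps θ hθ x k hx hk) (fun x h hx hh => hG.D2G_maps θ hθ x h k hx hh hk)
      ?_ hx hq
    intro x hx ε hε
    obtain ⟨η, hη, hl⟩ := hG.D2G_isDeriv θ hθ x hx ε hε
    exact ⟨η, hη, fun h hh hlt => hl h hh hlt k hk⟩
  · intro x x' k l e c d hx hx' he hk hl
    have hd : HD 𝓑 (γ - θ - σ) (fun r => D2G (x' + r • (x - x')) k l)
        (fun r => D3G (x' + r • (x - x')) (x - x') k l) := by
      refine HD.line (Φ := fun x => D2G x k l) (D := fun x => ((D3G x).flip k).flip l)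
        (A := 𝓑.N (γ - θ) k * 𝓑.N (γ - θ) l) (mul_nonneg (nn _ _) (nn _ _))
        (fun x hx => hG.D2G_maps θ hθ x k l hx hk.1 hl.1)
        (fun x h hx hh => hG.D3G_maps θ hθ x h k l hx hh hk.1 hl.1) ?_ hx' he.1
      intro x hx ε hε
      obtain ⟨η, hη, hl'⟩ := hG.D3G_isDeriv θ hθ x hx ε hε
      exact ⟨η, hη, fun h hh hlt => hl' h hh hlt k l hk.1 hl.1⟩
    have := hd.mv (c := L * (e * (c * d)))
      (fun r _ => hG.D2G_maps θ hθ _ k l (line_mem hx' he.1 r) hk.1 hl.1) (fun r _ => by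
        refine ⟨hG.D3G_maps θ hθ _ _ k l (line_mem hx' he.1 r) he.1 hk.1 hl.1,
          (h3 _ _ k l (line_mem hx' he.1 r) he.1 hk.1 hl.1).trans ?_⟩
        exact mul_le_mul hL3 (mul_le_mul he.2 (mul_le_mul hk.2 hl.2 (nn _ _) hk.nonneg)
          (mul_nonneg (nn _ _) (nn _ _)) he.nonneg)
          (mul_nonneg (nn _ _) (mul_nonneg (nn _ _) (nn _ _))) hL0)
    simpa using this

theorem exists_eqn (h : Drv 𝓑 Sg α β γ δ σ T X X2 C ρ) {δ' : ℝ} (hδ' : δ' ≤ δ)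
    (hF : AssumptionF 𝓑 γ δ' F) (hG : AssumptionG 𝓑 α σ γ G DG D2G D3G) :
    ∃ C', Eqn 𝓑 Sg α β γ δ σ T X X2 F G DG D2G C' ρ := by
  have hα := h.hα
  have hσα := h.hσα
  obtain ⟨L0, h0⟩ := exists_sm hG (θ := 0) (by simp)
  obtain ⟨L1, h1⟩ := exists_sm hG (θ := α) (by simp)
  obtain ⟨L2, h2⟩ := exists_sm hG (θ := 2 * α) (by simp)
  rw [sub_zero] at h0
  obtain ⟨Lg, Cg, hg1, hg2⟩ := hG.DGG_deriv_bounded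
  obtain ⟨Ce, hCe1, hCe⟩ := Bd.emb (show γ - δ ≤ γ - δ' by linarith) 𝓑
  obtain ⟨Cf, hCf⟩ := hF.linGrowth
  have hm0 : 𝓑.Mem (γ - σ) (G 0) := h0.g 0 (𝓑.mem_zero γ)
  set C' := max C (max L0 (max L1 (max L2 (max (max Cg 0) (max (𝓑.N (γ - σ) (G 0))
    (Ce * max Cf 0)))))) with hC'
  have l1 : C ≤ C' := le_max_left _ _
  have l2 : L0 ≤ C' := by simp [hC']
  have l3 : L1 ≤ C' := by simp [hC']
  have l4 : L2 ≤ C' := by simp [hC']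
  have l5 : max Cg 0 ≤ C' := by
    simp only [hC']; exact le_max_of_le_right (le_max_of_le_right (le_max_of_le_right
      (le_max_of_le_right (le_max_left _ _))))
  have l6 : 𝓑.N (γ - σ) (G 0) ≤ C' := by simp [hC']
  have l7 : Ce * max Cf 0 ≤ C' := by
    simp only [hC']; exact le_max_of_le_right (le_max_of_le_right (le_max_of_le_right
      (le_max_of_le_right (le_max_of_le_right (le_max_right _ _)))))
  refine ⟨C', { h.mono l1 with s0 := h0.mono l2, s1 := h1.mono l3, s2 := h2.mono l4, dgg := ?_,
                               g0 := ⟨hm0, l6⟩, fl := ?_, fg := ?_ }⟩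
  · intro x x' e hx hx' he
    have hdm : ∀ x, 𝓑.Mem (γ - α) x → 𝓑.Mem (γ - 2 * α - σ) (DG x (G x)) := fun x hx =>
      (h2.d1 x (G x) _ (𝓑.mem_mono (by linarith) _ hx)
        (Bd.of_mem (𝓑.mem_mono (by linarith) _ (h1.g x hx)))).1
    have hd : HD 𝓑 (γ - 2 * α - σ) (fun r => DG (x' + r • (x - x')) (G (x' + r • (x - x'))))
        (fun r => Lg (x' + r • (x - x')) (x - x')) := by
      refine HD.line (Φ := fun x => DG x (G x)) (A := 1) zero_le_one hdm
        (fun x h hx hh => (hg1 x h hx hh).1) ?_ hx' he.1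
      simpa using hg2
    have := hd.mv (c := C' * e) (fun r _ => hdm _ (line_mem hx' he.1 r)) (fun r _ => by
      obtain ⟨m1, m2⟩ := hg1 _ _ (line_mem hx' he.1 r) he.1
      refine ⟨m1, m2.trans ?_⟩
      exact mul_le_mul ((le_max_left _ _).trans l5) he.2 (𝓑.N_nonneg _ _)
        ((le_max_right _ _).trans l5))
    simpa using this
  · intro R hR
    obtain ⟨L, hL⟩ := hF.locLip R hR
    refine ⟨Ce * max L 0, by positivity, fun x y e hx hy he => ?_⟩
    have m := mem_sub (hF.maps x hx.1) (hF.maps y hy.1)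
    have := hCe _ _ ⟨m, (hL x y hx.1 hy.1 hx.2 hy.2).trans
      (mul_le_mul (le_max_left L 0) he.2 (𝓑.N_nonneg _ _) (le_max_right _ _))⟩
    exact this.mono (le_of_eq (by ring))
  · intro x c hx
    have hc := hx.nonneg
    have := hCe _ _ ⟨hF.maps x hx.1, (hCf x hx.1).trans
      (mul_le_mul (le_max_left Cf 0) (show 1 + 𝓑.N γ x ≤ 1 + c by linarith [hx.2])
        (by linarith [𝓑.N_nonneg γ x]) (le_max_right _ _))⟩
    refine this.mono ?_
    rw [← mul_assoc]
    exact mul_le_mul_of_nonneg_right l7 (by linarith)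

end

end RPDE


namespace RPDE

/-- Controlled-path class with exponent `β`. -/
structure CB (𝓑 : BanachScale) (α β γ : ℝ) (X : ℝ → ℝ) (a b : ℝ) (p p' : ℝ → 𝓑.E) (M M' : ℝ) :
    Prop where
  y : ∀ t, a ≤ t → t ≤ b → Bd 𝓑 γ (p t) M
  y' : ∀ t, a ≤ t → t ≤ b → Bd 𝓑 (γ - α) (p' t) M'
  hy' : ∀ s t, a ≤ s → s ≤ t → t ≤ b → Bd 𝓑 (γ - 2 * α) (p' t - p' s) (M' * (t - s) ^ β)
  r1 : ∀ s t, a ≤ s → s ≤ t → t ≤ b →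
    Bd 𝓑 (γ - α) (gubRemainder 𝓑 X p p' s t) (M * (t - s) ^ β)
  r2 : ∀ s t, a ≤ s → s ≤ t → t ≤ b →
    Bd 𝓑 (γ - 2 * α) (gubRemainder 𝓑 X p p' s t) (M * (t - s) ^ (2 * β))

section

variable {𝓑 : BanachScale} {Sg : ScaleSemigroup 𝓑} {α β γ δ σ T : ℝ}
    {X : ℝ → ℝ} {X2 : ℝ → ℝ → ℝ} {F G : 𝓑.E → 𝓑.E} {DG : 𝓑.E → 𝓑.E →ₗ[ℝ] 𝓑.E}
    {D2G : 𝓑.E → 𝓑.E →ₗ[ℝ] 𝓑.E →ₗ[ℝ] 𝓑.E}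
    {C ρ a b M M' N N' M0 e e' τ : ℝ} {y y' z z' : ℝ → 𝓑.E}

theorem CB.mono (hc : CB 𝓑 α β γ X a b y y' M M') (h1 : M ≤ N) (h2 : M' ≤ N') :
    CB 𝓑 α β γ X a b y y' N N' := by
  have fin : ∀ {A B : ℝ} (s t e : ℝ), A ≤ B → s ≤ t → A * (t - s) ^ e ≤ B * (t - s) ^ e :=
    fun s t e hAB hst => mul_le_mul_of_nonneg_right hAB (Real.rpow_nonneg (by linarith) e)
  exact ⟨fun t h h' => (hc.y t h h').mono h1, fun t h h' => (hc.y' t h h').mono h2,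
    fun s t h h' h'' => (hc.hy' s t h h' h'').mono (fin _ _ _ h2 h'),
    fun s t h h' h'' => (hc.r1 s t h h' h'').mono (fin _ _ _ h1 h'),
    fun s t h h' h'' => (hc.r2 s t h h' h'').mono (fin _ _ _ h1 h')⟩

theorem CB.restrict (hc : CB 𝓑 α β γ X a b y y' M M') {a2 b2 : ℝ} (h1 : a ≤ a2) (h2 : b2 ≤ b) :
    CB 𝓑 α β γ X a2 b2 y y' M M' :=
  ⟨fun t h h' => hc.y t (h1.trans h) (h'.trans h2), fun t h h' => hc.y' t (h1.trans h) (h'.trans h2),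
    fun s t h h' h'' => hc.hy' s t (h1.trans h) h' (h''.trans h2),
    fun s t h h' h'' => hc.r1 s t (h1.trans h) h' (h''.trans h2),
    fun s t h h' h'' => hc.r2 s t (h1.trans h) h' (h''.trans h2)⟩

theorem CB.sub (hc : CB 𝓑 α β γ X a b y y' M M') (hd : CB 𝓑 α β γ X a b z z' N N') :
    CB 𝓑 α β γ X a b (fun t => y t - z t) (fun t => y' t - z' t) (M + N) (M' + N') := by
  have hg : ∀ s t, gubRemainder 𝓑 X (fun t => y t - z t) (fun t => y' t - z' t) s t
      = gubRemainder 𝓑 X y y' s t - gubRemainder 𝓑 X z z' s t := by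
    intro s t; simp only [gubRemainder]; module
  refine ⟨fun t h h' => (hc.y t h h').sub (hd.y t h h'), fun t h h' => (hc.y' t h h').sub (hd.y' t h h'),
    fun s t h h' h'' => ?_, fun s t h h' h'' => ?_, fun s t h h' h'' => ?_⟩
  · exact (((hc.hy' s t h h' h'').sub (hd.hy' s t h h' h'')).congr (by module)).mono
      (le_of_eq (by ring))
  · exact (((hc.r1 s t h h' h'').sub (hd.r1 s t h h' h'')).congr (hg s t)).mono
      (le_of_eq (by ring))
  · exact (((hc.r2 s t h h' h'').sub (hd.r2 s t h h' h'')).congr (hg s t)).mono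
      (le_of_eq (by ring))

/-- Increment bound. -/
theorem CB.incr (h : Ctx 𝓑 Sg α β γ δ σ T X X2 C) (ha : 0 ≤ a) (hb : b ≤ T)
    (hc : CB 𝓑 α β γ X a b y y' M M') (hτ : ∀ d, 0 ≤ d → d ≤ b - a → d ^ α ≤ τ * d ^ β)
    {s t : ℝ} (has : a ≤ s) (hst : s ≤ t) (htb : t ≤ b) :
    Bd 𝓑 (γ - α) (y t - y s) ((M + C * τ * M') * (t - s) ^ β) := by
  have hM' := (hc.y' s has (by linarith)).nonneg
  have hX : |X t - X s| ≤ C * (τ * (t - s) ^ β) :=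
    (h.hX s t (by linarith) hst (by linarith)).trans
      (mul_le_mul_of_nonneg_left (hτ _ (by linarith) (by linarith)) h.C0)
  have := (hc.r1 s t has hst htb).add ((hc.y' s has (by linarith)).smul hX)
  refine (this.congr ?_).mono (le_of_eq (by ring))
  simp only [gubRemainder]; abel

theorem rp2 {d β : ℝ} (hd : 0 ≤ d) (hβ : 0 < β) : d ^ (2 * β) = d ^ β * d ^ β := by
  rw [two_mul, Real.rpow_add_of_nonneg hd hβ.le hβ.le]

theorem Ctx.tauC (h : Ctx 𝓑 Sg α β γ δ σ T X X2 C) (ha : 0 ≤ a) (hb : b ≤ T) :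
    ∀ d, 0 ≤ d → d ≤ b - a → d ^ α ≤ C * d ^ β := fun d h0 h1 =>
  h.pw d α β h0 (by linarith) h.β0.le h.hβ.le (by linarith [h.hα2])

set_option maxHeartbeats 1000000 in
theorem comp_diff (h : Eqn 𝓑 Sg α β γ δ σ T X X2 F G DG D2G C ρ) (hM0 : 0 ≤ M0) :
    ∃ P ≥ 1, ∀ (a b : ℝ) (y y' z z' : ℝ → 𝓑.E) (e e' : ℝ), 0 ≤ a → a ≤ b → b ≤ T →
      CB 𝓑 α β γ X a b y y' M0 M0 → CB 𝓑 α β γ X a b z z' M0 M0 →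
      CB 𝓑 α β γ X a b (fun t => y t - z t) (fun t => y' t - z' t) e e' →
      IB 𝓑 α β γ σ X a b (fun t => G (y t) - G (z t))
        (fun t => DG (y t) (y' t) - DG (z t) (z' t)) (P * (e + e')) ∧
      (∀ t, a ≤ t → t ≤ b → Bd 𝓑 (γ - δ) (F (y t) - F (z t)) (P * (e + e'))) ∧
      ∀ τ, (∀ d, 0 ≤ d → d ≤ b - a → d ^ α ≤ τ * d ^ β) → 0 ≤ τ →
        (∀ t, a ≤ t → t ≤ b → Bd 𝓑 (γ - α) (G (y t) - G (z t)) (P * (e + τ * e'))) ∧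
        (∀ s t, a ≤ s → s ≤ t → t ≤ b →
          Bd 𝓑 (γ - 2 * α) (G (y t) - G (z t) - (G (y s) - G (z s)))
            (P * (e + τ * e') * (t - s) ^ β)) := by
  obtain ⟨L, hL0, hL⟩ := h.fl (M0 + 1) (by linarith)
  have hα0 : 0 < α := by linarith [h.hα]
  have hσ := h.hσ
  have hσα := h.hσα
  have hC1 := h.one_le
  have hC0 := h.C0
  set Q := (C * C + 1) * C * (M0 + 1) with hQ
  have hCC : 1 ≤ C * C + 1 := by nlinarith
  have hCCC : C ≤ (C * C + 1) * C := by nlinarith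
  have hCQ : C ≤ Q := by
    calc C ≤ (C * C + 1) * C * 1 := by linarith
      _ ≤ _ := by rw [hQ]; gcongr; linarith
  have hQ1 : 1 ≤ Q := hC1.trans hCQ
  have hQ0 : 0 ≤ Q := by linarith
  have hQC2 : (C * C + 1) * C ≤ Q := by
    calc (C * C + 1) * C = (C * C + 1) * C * 1 := by ring
      _ ≤ _ := by rw [hQ]; gcongr; linarith
  have hQM : (C * C + 1) * C * M0 ≤ Q := by rw [hQ]; gcongr; linarith
  have hQM1 : C * M0 ≤ Q := le_trans (by gcongr) hQM
  have hQM2 : M0 ≤ Q := le_trans (by nlinarith) hQM1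
  have q1 : Q ≤ Q ^ 5 := le_self_pow₀ hQ1 (by norm_num)
  have q2 : Q ^ 2 ≤ Q ^ 5 := pow_le_pow_right₀ hQ1 (by norm_num)
  have q3 : Q ^ 3 ≤ Q ^ 5 := pow_le_pow_right₀ hQ1 (by norm_num)
  have q4 : Q ^ 4 ≤ Q ^ 5 := pow_le_pow_right₀ hQ1 (by norm_num)
  have q5 : 1 ≤ Q ^ 5 := one_le_pow₀ hQ1
  have hs0 := h.s0.mono hCQ
  have hs1 := h.s1.mono hCQ
  have hs2 := h.s2.mono hCQ
  have em : ∀ {x : 𝓑.E} {c : ℝ}, Bd 𝓑 γ x c → Bd 𝓑 (γ - α) x (C * c) := fun hx =>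
    h.emb _ Lv.ga _ Lv.g (by linarith) _ _ hx
  have em2 : ∀ {x : 𝓑.E} {c : ℝ}, Bd 𝓑 γ x c → Bd 𝓑 (γ - 2 * α) x (C * c) := fun hx =>
    h.emb _ Lv.g2 _ Lv.g (by linarith) _ _ hx
  have ea2 : ∀ {x : 𝓑.E} {c : ℝ}, Bd 𝓑 (γ - α) x c → Bd 𝓑 (γ - 2 * α) x (C * c) := fun hx =>
    h.emb _ Lv.g2 _ Lv.ga (by linarith) _ _ hx
  refine ⟨6 * Q ^ 5 + L, by linarith, ?_⟩
  intro a b y y' z z' e e' ha hab hb hy hz hd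
  have he : 0 ≤ e := (hd.y a le_rfl hab).nonneg
  have he' : 0 ≤ e' := (hd.y' a le_rfl hab).nonneg
  set E := e + e' with hE
  have heE : e ≤ E := by linarith
  have heE' : e' ≤ E := by linarith
  have hE0 : 0 ≤ E := by linarith
  have P6 : 6 * Q ^ 5 ≤ 6 * Q ^ 5 + L := by linarith
  have hP0 : 0 ≤ 6 * Q ^ 5 + L := by positivity
  -- raw facts
  have my : ∀ t, a ≤ t → t ≤ b → 𝓑.Mem (γ - 2 * α) (y t) := fun t h1 h2 => (em2 (hy.y t h1 h2)).1
  have mz : ∀ t, a ≤ t → t ≤ b → 𝓑.Mem (γ - 2 * α) (z t) := fun t h1 h2 => (em2 (hz.y t h1 h2)).1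
  have hD0 : ∀ s t : ℝ, s ≤ t → 0 ≤ (t - s) ^ β := fun s t hst => Real.rpow_nonneg (by linarith) _
  have hDQ : ∀ s t, a ≤ s → s ≤ t → t ≤ b → (t - s) ^ β ≤ Q := by
    intro s t h1 h2 h3
    have := h.pw (t - s) β 0 (by linarith) (by linarith) le_rfl h.β0.le (by linarith [h.hβ, h.hα2])
    rw [Real.rpow_zero, mul_one] at this
    exact this.trans hCQ
  have iw : ∀ {u u' : ℝ → 𝓑.E}, CB 𝓑 α β γ X a b u u' M0 M0 → ∀ s t, a ≤ s → s ≤ t → t ≤ b →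
      Bd 𝓑 (γ - α) (u t - u s) (Q * (t - s) ^ β) ∧
      Bd 𝓑 (γ - 2 * α) (u t - u s) (Q * (t - s) ^ β) := by
    intro u u' hu s t h1 h2 h3
    have := hu.incr h.toCtx ha hb (h.toCtx.tauC ha hb) h1 h2 h3
    have hD := hD0 s t h2
    refine ⟨this.mono ?_, (ea2 this).mono ?_⟩
    · calc (M0 + C * C * M0) * (t - s) ^ β = 1 * ((C * C + 1) * M0) * (t - s) ^ β := by ring
        _ ≤ C * ((C * C + 1) * M0) * (t - s) ^ β := by gcongr
        _ = (C * C + 1) * C * M0 * (t - s) ^ β := by ring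
        _ ≤ _ := by gcongr
    · calc C * ((M0 + C * C * M0) * (t - s) ^ β) = (C * C + 1) * C * M0 * (t - s) ^ β := by ring
        _ ≤ _ := by gcongr
  have dw : ∀ s t, a ≤ s → s ≤ t → t ≤ b →
      Bd 𝓑 (γ - 2 * α) (y t - y s - (z t - z s)) (Q * E * (t - s) ^ β) := by
    intro s t h1 h2 h3
    have := ea2 (hd.incr h.toCtx ha hb (h.toCtx.tauC ha hb) h1 h2 h3)
    have hD := hD0 s t h2
    refine (this.congr (by abel)).mono ?_
    calc C * ((e + C * C * e') * (t - s) ^ β) ≤ C * ((E + C * C * E) * (t - s) ^ β) := by gcongr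
      _ = (C * C + 1) * C * E * (t - s) ^ β := by ring
      _ ≤ _ := by gcongr
  have dy : ∀ t, a ≤ t → t ≤ b → Bd 𝓑 γ (y t - z t) e := hd.y
  have dy1 : ∀ t, a ≤ t → t ≤ b → Bd 𝓑 (γ - α) (y t - z t) (Q * e) := fun t h1 h2 =>
    (em (hd.y t h1 h2)).mono (by gcongr)
  have dy2 : ∀ t, a ≤ t → t ≤ b → Bd 𝓑 (γ - 2 * α) (y t - z t) (Q * E) := fun t h1 h2 =>
    (em2 (hd.y t h1 h2)).mono (by gcongr)
  have k2 : ∀ t, a ≤ t → t ≤ b → Bd 𝓑 (γ - 2 * α) (z' t) Q := fun t h1 h2 =>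
    (ea2 (hz.y' t h1 h2)).mono hQM1
  have ad : ∀ u v : 𝓑.E, u + (v - u) = v := fun u v => by abel
  refine ⟨⟨?_, ?_, ?_, ?_⟩, ?_, ?_⟩
  · intro t h1 h2
    refine (hs0.lip (hy.y t h1 h2).1 (hz.y t h1 h2).1 (dy t h1 h2)).mono ?_
    have : Q ≤ 6 * Q ^ 5 + L := by linarith
    gcongr
  · intro t h1 h2
    have A1 := hs1.d1 (y t) (y' t - z' t) _ (em (hy.y t h1 h2)).1 (hd.y' t h1 h2)
    have A2 := hs1.lipD (em (hy.y t h1 h2)).1 (em (hz.y t h1 h2)).1 (dy1 t h1 h2)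
      ((hz.y' t h1 h2).mono hQM2)
    refine ((A1.add A2).congr ?_).mono ?_
    · simp only [map_sub]; abel
    · calc Q * e' + Q * (Q * e * Q) ≤ Q * E + Q * (Q * E * Q) := by gcongr
        _ = (Q + Q ^ 3) * E := by ring
        _ ≤ (6 * Q ^ 5 + L) * E := mul_le_mul_of_nonneg_right (by linarith) hE0
  · intro s t h1 h2 h3
    have hs : s ≤ b := by linarith
    have ht : a ≤ t := by linarith
    set D := (t - s) ^ β with hD
    have D0 : 0 ≤ D := hD0 s t h2
    have DQ : D ≤ Q := hDQ s t h1 h2 h3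
    have A1 := hs2.d1 (y t) (y' t - z' t - (y' s - z' s)) _ (my t ht h3) (hd.hy' s t h1 h2 h3)
    have A2 := hs2.lipD (my t ht h3) (mz t ht h3) (dy2 t ht h3) (hz.hy' s t h1 h2 h3)
    have A3 := hs2.lipD (my t ht h3) (my s h1 hs) (iw hy s t h1 h2 h3).2 (ea2 (hd.y' s h1 hs))
    have A4 := hs2.fourD (my s h1 hs) (mz s h1 hs) (iw hy s t h1 h2 h3).2.1 (iw hz s t h1 h2 h3).2
      (dy2 s h1 hs) (dw s t h1 h2 h3) (k2 s h1 hs)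
    rw [ad, ad] at A4
    refine ((A1.add (A2.add (A3.add A4))).congr ?_).mono ?_
    · simp only [map_sub]; abel
    · rw [← hD]
      calc Q * (e' * D) + (Q * (Q * E * (M0 * D)) + (Q * (Q * D * (C * e'))
            + Q * (Q * E * D + (Q * E + Q * E * D) * (Q * D)) * Q))
          ≤ Q * (E * D) + (Q * (Q * E * (Q * D)) + (Q * (Q * D * (Q * E))
            + Q * (Q * E * D + (Q * E + Q * E * Q) * (Q * D)) * Q)) := by gcongr
        _ = (Q + 3 * Q ^ 3 + Q ^ 4 + Q ^ 5) * E * D := by ring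
        _ ≤ (6 * Q ^ 5 + L) * E * D :=
            mul_le_mul_of_nonneg_right (mul_le_mul_of_nonneg_right (by linarith) hE0) D0
  · intro s t h1 h2 h3
    have hs : s ≤ b := by linarith
    have ht : a ≤ t := by linarith
    have r1 := hd.r2 s t h1 h2 h3
    have r2 := hz.r2 s t h1 h2 h3
    rw [rp2 (by linarith) h.toCtx.β0] at r1 r2 ⊢
    set D := (t - s) ^ β with hD
    have D0 : 0 ≤ D := hD0 s t h2
    have DQ : D ≤ Q := hDQ s t h1 h2 h3
    have A1 := hs2.taylor2 (my s h1 hs) (mz s h1 hs) (iw hy s t h1 h2 h3).2 (iw hz s t h1 h2 h3).2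
      (dy2 s h1 hs) (dw s t h1 h2 h3)
    rw [ad, ad] at A1
    have A2 := hs2.d1 (y s) _ _ (my s h1 hs) r1
    have A3 := hs2.lipD (my s h1 hs) (mz s h1 hs) (dy2 s h1 hs) r2
    refine ((A1.add (A2.add A3)).congr ?_).mono ?_
    · simp only [gubRemainder, map_sub, map_smul]; module
    · rw [← hD]
      calc Q * (Q * D * (Q * E * D)) + Q * (Q * E * D + (Q * E + Q * E * D) * (Q * D)) * (Q * D)
            + (Q * (e * (D * D)) + Q * (Q * E * (M0 * (D * D))))
          ≤ Q * (Q * D * (Q * E * D)) + Q * (Q * E * D + (Q * E + Q * E * Q) * (Q * D)) * (Q * D)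
            + (Q * (E * (D * D)) + Q * (Q * E * (Q * (D * D)))) := by gcongr
        _ = (Q + 3 * Q ^ 3 + Q ^ 4 + Q ^ 5) * E * (D * D) := by ring
        _ ≤ (6 * Q ^ 5 + L) * E * (D * D) :=
            mul_le_mul_of_nonneg_right (mul_le_mul_of_nonneg_right (by linarith) hE0) (mul_nonneg D0 D0)
  · intro t h1 h2
    refine (hL _ _ _ ((hy.y t h1 h2).mono (by linarith)) ((hz.y t h1 h2).mono (by linarith))
      (dy t h1 h2)).mono ?_
    have : L ≤ 6 * Q ^ 5 + L := by linarith
    gcongr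
  · intro τ hτ hτ0
    set E1 := e + τ * e' with hE1
    have hE10 : 0 ≤ E1 := by positivity
    have heE1 : e ≤ E1 := by rw [hE1]; linarith [mul_nonneg hτ0 he']
    constructor
    · intro t h1 h2
      have := h.emb (γ - α) Lv.ga (γ - σ) Lv.gs (by linarith) _ _
        (hs0.lip (hy.y t h1 h2).1 (hz.y t h1 h2).1 (dy t h1 h2))
      refine this.mono ?_
      calc C * (Q * e) ≤ Q * (Q * E1) := by gcongr
        _ = Q ^ 2 * E1 := by ring
        _ ≤ _ := by gcongr; linarith
    · intro s t h1 h2 h3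
      have hs : s ≤ b := by linarith
      have ht : a ≤ t := by linarith
      set D := (t - s) ^ β with hD
      have D0 : 0 ≤ D := hD0 s t h2
      have DQ : D ≤ Q := hDQ s t h1 h2 h3
      have dw1 : Bd 𝓑 (γ - α) (y t - y s - (z t - z s)) (Q * E1 * D) := by
        refine ((hd.incr h.toCtx ha hb hτ h1 h2 h3).congr (by abel)).mono ?_
        rw [← hD]
        have : e + C * τ * e' ≤ Q * E1 := by
          rw [hE1]
          have : 0 ≤ τ * e' := by positivity
          nlinarith
        gcongr
      have A := hs1.four (em (hy.y s h1 hs)).1 (em (hz.y s h1 hs)).1 (iw hy s t h1 h2 h3).1.1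
        (iw hz s t h1 h2 h3).1 (dy1 s h1 hs) dw1
      rw [ad, ad] at A
      have := h.emb (γ - 2 * α) Lv.g2 (γ - α - σ) Lv.gas (by linarith) _ _ A
      refine (this.congr (by abel)).mono ?_
      rw [← hD]
      calc C * (Q * (Q * E1 * D + (Q * e + Q * E1 * D) * (Q * D)))
          ≤ Q * (Q * (Q * E1 * D + (Q * E1 + Q * E1 * Q) * (Q * D))) := by gcongr
        _ = (Q ^ 3 + Q ^ 4 + Q ^ 5) * E1 * D := by ring
        _ ≤ (6 * Q ^ 5 + L) * E1 * D :=
            mul_le_mul_of_nonneg_right (mul_le_mul_of_nonneg_right (by linarith) hE10) D0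

end

end RPDE


namespace RPDE

section

variable {𝓑 : BanachScale} {Sg : ScaleSemigroup 𝓑} {α β γ δ σ T : ℝ}
    {X : ℝ → ℝ} {X2 : ℝ → ℝ → ℝ} {F G : 𝓑.E → 𝓑.E} {DG : 𝓑.E → 𝓑.E →ₗ[ℝ] 𝓑.E}
    {D2G : 𝓑.E → 𝓑.E →ₗ[ℝ] 𝓑.E →ₗ[ℝ] 𝓑.E}
    {C ρ a b M M' N N' M0 e e' τ : ℝ} {y y' z z' : ℝ → 𝓑.E}

theorem CB.zero : CB 𝓑 α β γ X a b (fun _ => 0) (fun _ => 0) 0 0 := by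
  refine ⟨fun _ _ _ => Bd.zero le_rfl, fun _ _ _ => Bd.zero le_rfl, fun _ _ _ _ _ => ?_,
    fun _ _ _ _ _ => ?_, fun _ _ _ _ _ => ?_⟩
  · rw [sub_zero, zero_mul]; exact Bd.zero le_rfl
  · simp only [gubRemainder, sub_zero, smul_zero, zero_mul]; exact Bd.zero le_rfl
  · simp only [gubRemainder, sub_zero, smul_zero, zero_mul]; exact Bd.zero le_rfl

theorem Gy_bd (h : Eqn 𝓑 Sg α β γ δ σ T X X2 F G DG D2G C ρ) {x : 𝓑.E} (hx : Bd 𝓑 γ x M) :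
    Bd 𝓑 (γ - σ) (G x) (C + C * M) := by
  have := (h.s0.lip hx.1 (𝓑.mem_zero γ) (hx.congr (sub_zero x))).add h.g0
  exact (this.congr (by abel)).mono (by linarith)

/-- Linear bounds for the new derivative. -/
theorem yp_lin (h : Eqn 𝓑 Sg α β γ δ σ T X X2 F G DG D2G C ρ) (ha : 0 ≤ a) (hb : b ≤ T)
    (hc : CB 𝓑 α β γ X a b y y' M M') (hτ : ∀ d, 0 ≤ d → d ≤ b - a → d ^ α ≤ τ * d ^ β) :
    (∀ t, a ≤ t → t ≤ b → Bd 𝓑 (γ - α) (G (y t)) (C * (C + C * M))) ∧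
    (∀ s t, a ≤ s → s ≤ t → t ≤ b →
      Bd 𝓑 (γ - 2 * α) (G (y t) - G (y s)) (C * (C * (M + C * τ * M')) * (t - s) ^ β)) := by
  have hσα := h.hσα
  have hα0 : 0 < α := by linarith [h.hα]
  constructor
  · intro t h1 h2
    exact h.emb _ Lv.ga _ Lv.gs (by linarith) _ _ (Gy_bd h (hc.y t h1 h2))
  · intro s t h1 h2 h3
    have em : ∀ {x : 𝓑.E} {c : ℝ}, Bd 𝓑 γ x c → 𝓑.Mem (γ - α) x := fun hx =>
      (h.emb _ Lv.ga _ Lv.g (by linarith) _ _ hx).1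
    have := h.s1.lip (em (hc.y t (by linarith) h3)) (em (hc.y s h1 (by linarith)))
      (hc.incr h.toCtx ha hb hτ h1 h2 h3)
    exact (h.emb _ Lv.g2 _ Lv.gas (by linarith) _ _ this).mono (le_of_eq (by ring))

/-- Rough composition bound. -/
theorem comp_bd (h : Eqn 𝓑 Sg α β γ δ σ T X X2 F G DG D2G C ρ) (hM0 : 0 ≤ M0) :
    ∃ P ≥ 1, ∀ (a b : ℝ) (y y' : ℝ → 𝓑.E), 0 ≤ a → a ≤ b → b ≤ T →
      CB 𝓑 α β γ X a b y y' M0 M0 →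
      IB 𝓑 α β γ σ X a b (fun t => G (y t)) (fun t => DG (y t) (y' t)) P ∧
      (∀ t, a ≤ t → t ≤ b → Bd 𝓑 (γ - δ) (F (y t)) P) := by
  obtain ⟨P, hP, hp⟩ := comp_diff h hM0
  have hC := h.one_le
  refine ⟨P * (M0 + M0) + C * (1 + M0), by nlinarith, fun a b y y' ha hab hb hy => ?_⟩
  obtain ⟨hI, -, -⟩ := hp a b y y' (fun _ => 0) (fun _ => 0) M0 M0 ha hab hb hy
    (CB.zero.mono hM0 hM0) (by simpa using hy)
  have hPP : P * (M0 + M0) ≤ P * (M0 + M0) + C * (1 + M0) := by nlinarith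
  have fin : ∀ s t e : ℝ, s ≤ t → P * (M0 + M0) * (t - s) ^ e
      ≤ (P * (M0 + M0) + C * (1 + M0)) * (t - s) ^ e :=
    fun s t e hst => mul_le_mul_of_nonneg_right hPP (Real.rpow_nonneg (by linarith) e)
  refine ⟨⟨fun t h1 h2 => ?_, fun t h1 h2 => ?_, fun s t h1 h2 h3 => ?_, fun s t h1 h2 h3 => ?_⟩,
    fun t h1 h2 => ?_⟩
  · exact (((hI.y t h1 h2).add h.g0).congr (by abel)).mono (by nlinarith)
  · exact ((hI.y' t h1 h2).congr (by simp)).mono hPP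
  · exact ((hI.hy' s t h1 h2 h3).congr (by simp)).mono (fin _ _ _ h2)
  · exact ((hI.r s t h1 h2 h3).congr (by simp [gubRemainder])).mono (fin _ _ _ h2)
  · exact (h.fg _ _ (hy.y t h1 h2)).mono (by nlinarith)

set_option maxHeartbeats 1000000 in
/-- Linear growth composition bound for solutions. -/
theorem comp_lin (h : Eqn 𝓑 Sg α β γ δ σ T X X2 F G DG D2G C ρ) :
    ∃ P ≥ 1, ∀ (a b M M' : ℝ) (y : ℝ → 𝓑.E), 0 ≤ a → a ≤ b → b ≤ T →
      CB 𝓑 α β γ X a b y (fun t => G (y t)) M M' →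
      IB 𝓑 α β γ σ X a b (fun t => G (y t)) (fun t => DG (y t) (G (y t))) (P * (1 + M + M')) ∧
      (∀ t, a ≤ t → t ≤ b → Bd 𝓑 (γ - δ) (F (y t)) (P * (1 + M + M'))) := by
  have hσα := h.hσα
  have hα0 : 0 < α := by linarith [h.hα]
  have hC1 := h.one_le
  have hC0 := h.C0
  set c2 := 1 + C * C with hc2
  have hc20 : 0 ≤ c2 := by positivity
  set P := C + C * c2 + C * C * (C * c2 + C * (C * (C * c2))) with hP
  have hP1 : C ≤ P := by rw [hP]; linarith [show 0 ≤ C * c2 + C * C * (C * c2 + C * (C * (C * c2))) by positivity]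
  have hP2 : C * c2 ≤ P := by rw [hP]; linarith [show 0 ≤ C * C * (C * c2 + C * (C * (C * c2))) by positivity]
  have hP3 : C + C * C * (C * c2 + C * (C * (C * c2))) ≤ P := by
    rw [hP]; linarith [show 0 ≤ C * c2 by positivity]
  have hP0 : 0 ≤ P := by linarith
  refine ⟨P, hC1.trans hP1, fun a b M M' y ha hab hb hy => ?_⟩
  have hM : 0 ≤ M := (hy.y a le_rfl hab).nonneg
  have hM' : 0 ≤ M' := (hy.y' a le_rfl hab).nonneg
  set U := 1 + M + M' with hU
  have hU0 : 0 ≤ U := by linarith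
  have em : ∀ t, a ≤ t → t ≤ b → 𝓑.Mem (γ - α) (y t) := fun t h1 h2 =>
    (h.emb _ Lv.ga _ Lv.g (by linarith) _ _ (hy.y t h1 h2)).1
  have em2 : ∀ t, a ≤ t → t ≤ b → 𝓑.Mem (γ - 2 * α) (y t) := fun t h1 h2 =>
    (h.emb _ Lv.g2 _ Lv.g (by linarith) _ _ (hy.y t h1 h2)).1
  have hD0 : ∀ s t : ℝ, s ≤ t → 0 ≤ (t - s) ^ β := fun s t hst => Real.rpow_nonneg (by linarith) _
  have iw : ∀ s t, a ≤ s → s ≤ t → t ≤ b → Bd 𝓑 (γ - α) (y t - y s) (c2 * U * (t - s) ^ β) := by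
    intro s t h1 h2 h3
    refine (hy.incr h.toCtx ha hb (h.toCtx.tauC ha hb) h1 h2 h3).mono ?_
    have hD := hD0 s t h2
    calc (M + C * C * M') * (t - s) ^ β ≤ (U + C * C * U) * (t - s) ^ β := by
          gcongr <;> linarith
      _ = _ := by rw [hc2]; ring
  refine ⟨⟨?_, ?_, ?_, ?_⟩, ?_⟩
  · intro t h1 h2
    refine (Gy_bd h (hy.y t h1 h2)).mono ?_
    calc C + C * M ≤ C * U := by rw [hU]; nlinarith
      _ ≤ _ := by gcongr
  · intro t h1 h2
    refine (h.s1.d1 _ _ _ (em t h1 h2) (hy.y' t h1 h2)).mono ?_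
    calc C * M' ≤ C * U := by gcongr; linarith
      _ ≤ _ := by gcongr
  · intro s t h1 h2 h3
    refine (h.dgg _ _ _ (em t (by linarith) h3) (em s h1 (by linarith)) (iw s t h1 h2 h3)).mono ?_
    have hD := hD0 s t h2
    calc C * (c2 * U * (t - s) ^ β) = C * c2 * U * (t - s) ^ β := by ring
      _ ≤ _ := by gcongr
  · intro s t h1 h2 h3
    have hs : s ≤ b := by linarith
    have ht : a ≤ t := by linarith
    have hr := hy.r2 s t h1 h2 h3
    have hi := iw s t h1 h2 h3
    have hX := (h.hX s t (by linarith) h2 (by linarith)).trans (mul_le_mul_of_nonneg_left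
      (h.toCtx.tauC ha hb (t - s) (by linarith) (by linarith)) hC0)
    have hD := hD0 s t h2
    rw [rp2 (by linarith) h.toCtx.β0] at hr ⊢
    set D := (t - s) ^ β with hDd
    set x := X t - X s with hx
    set v := y t - y s with hv
    set R := gubRemainder 𝓑 X y (fun t => G (y t)) s t with hR
    have hvR : v = R + x • G (y s) := by
      rw [hR, hv]; simp only [gubRemainder]; abel
    have hv2 : 𝓑.Mem (γ - 2 * α) v := mem_sub (em2 t ht h3) (em2 s h1 hs)
    have mG : 𝓑.Mem (γ - 2 * α) (G (y s)) :=
      (h.emb _ Lv.g2 _ Lv.ga (by linarith) _ _ (hy.y' s h1 hs)).1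
    have mDG : 𝓑.Mem (γ - 2 * α - σ) (DG (y s) (G (y s))) :=
      (h.s2.d1 _ _ _ (em2 s h1 hs) (Bd.of_mem mG)).1
    have key := ((h.s2.hd1 (y s) v (em2 s h1 hs) hv2).sub (HD.lin (x • DG (y s) (G (y s))))).mv
      (c := P * U * (D * D))
      (fun r _ => mem_sub (h.s2.g _ (line_mem (em2 s h1 hs) hv2 r))
        (𝓑.mem_smul _ _ _ (𝓑.mem_smul _ _ _ mDG)))
      (fun r hr1 => by
        have mz := line_mem (em s h1 hs) hi.1 r
        have mz2 := line_mem (em2 s h1 hs) hv2 r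
        set w := y s + r • v with hw
        have hwd : Bd 𝓑 (γ - α) (w - y s) (c2 * U * D) :=
          (smul_le hr1 hi).congr (by rw [hw]; abel)
        have A1 := h.s2.d1 w R _ mz2 hr
        have A2 := h.dgg _ _ _ mz (em s h1 hs) hwd
        have A3 := h.s2.d1 w _ _ mz2 (h.emb _ Lv.g2 _ Lv.gas (by linarith) _ _
          (h.s1.lip mz (em s h1 hs) hwd))
        refine ((A1.add ((A2.sub A3).smul hX)).congr ?_).mono ?_
        · rw [hvR]; simp only [map_add, map_smul, map_sub]; module
        · calc C * (M * (D * D)) + C * (C * D) * (C * (c2 * U * D) + C * (C * (C * (c2 * U * D))))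
              ≤ C * (U * (D * D)) + C * (C * D) * (C * (c2 * U * D) + C * (C * (C * (c2 * U * D)))) := by
                gcongr; linarith
            _ = (C + C * C * (C * c2 + C * (C * (C * c2)))) * U * (D * D) := by ring
            _ ≤ _ := by
              exact mul_le_mul_of_nonneg_right (mul_le_mul_of_nonneg_right hP3 hU0) (mul_nonneg hD hD))
    refine key.congr ?_
    simp only [gubRemainder, one_smul, zero_smul, add_zero, sub_zero, hv, hx]
    rw [add_sub_cancel]; abel
  · intro t h1 h2
    refine (h.fg _ _ (hy.y t h1 h2)).mono ?_
    calc C * (1 + M) ≤ C * U := by gcongr; linarith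
      _ ≤ _ := by gcongr

end

end RPDE


namespace RPDE

/-- Mild evolution on `[a,b]` driven by the data `Y, Y', f`. -/
def Evo (𝓑 : BanachScale) (Sg : ScaleSemigroup 𝓑) (α γ : ℝ) (X : ℝ → ℝ) (X2 : ℝ → ℝ → ℝ)
    (a b : ℝ) (u Y Y' f : ℝ → 𝓑.E) : Prop :=
  ∀ s t, a ≤ s → s < t → t ≤ b → ∃ w, Rep 𝓑 Sg α γ X X2 s t Y Y' f w ∧
    u t = Sg.S (t - s) (u s) + w

/-- `h` is short with smallness parameter `q`. -/
structure Sh (α β ρ h q : ℝ) : Prop where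
  q0 : 0 ≤ q
  q1 : q ≤ 1
  e1 : ∀ d, 0 ≤ d → d ≤ h → d ^ ρ ≤ q
  e2 : ∀ d, 0 ≤ d → d ≤ h → d ^ α ≤ q * d ^ β
  e3 : ∀ d, 0 ≤ d → d ≤ h → d ^ (2 * α) ≤ q * d ^ (2 * β)

section

variable {𝓑 : BanachScale} {Sg : ScaleSemigroup 𝓑} {α β γ δ σ T : ℝ}
    {X : ℝ → ℝ} {X2 : ℝ → ℝ → ℝ} {F G : 𝓑.E → 𝓑.E} {DG : 𝓑.E → 𝓑.E →ₗ[ℝ] 𝓑.E}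
    {D2G : 𝓑.E → 𝓑.E →ₗ[ℝ] 𝓑.E →ₗ[ℝ] 𝓑.E}
    {C ρ a b M M' N N' M0 e e' τ K K1 K2 q m : ℝ} {y y' z z' u Y Y' f : ℝ → 𝓑.E}

theorem Sh.mono {h h' : ℝ} (hs : Sh α β ρ h q) (hh : h' ≤ h) : Sh α β ρ h' q :=
  ⟨hs.q0, hs.q1, fun d h0 h1 => hs.e1 d h0 (h1.trans hh), fun d h0 h1 => hs.e2 d h0 (h1.trans hh),
    fun d h0 h1 => hs.e3 d h0 (h1.trans hh)⟩

theorem exists_sh (hβ : 0 < β) (hρ : 0 < ρ) (hρ1 : ρ ≤ α - β) (hq : 0 < q) (hq1 : q ≤ 1) :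
    ∃ h > 0, Sh α β ρ h q := by
  have hq' : 0 < q ^ (1 / ρ) := Real.rpow_pos_of_pos hq _
  have b1 : ∀ d, 0 ≤ d → d ≤ min 1 (q ^ (1 / ρ)) → ∀ e, ρ ≤ e → d ^ e ≤ q := by
    intro d h0 h1 e he
    have d1 : d ≤ 1 := h1.trans (min_le_left _ _)
    calc d ^ e ≤ d ^ ρ := Real.rpow_le_rpow_of_exponent_ge' h0 d1 hρ.le he
      _ ≤ (q ^ (1 / ρ)) ^ ρ := Real.rpow_le_rpow h0 (h1.trans (min_le_right _ _)) hρ.le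
      _ = q := by
        rw [← Real.rpow_mul hq.le, one_div_mul_cancel hρ.ne', Real.rpow_one]
  have b2 : ∀ d, 0 ≤ d → d ≤ min 1 (q ^ (1 / ρ)) → ∀ e e', 0 ≤ e' → ρ ≤ e - e' → d ^ e ≤ q * d ^ e' := by
    intro d h0 h1 e e' he' he
    have : d ^ e = d ^ (e - e') * d ^ e' := by
      rw [← Real.rpow_add_of_nonneg h0 (by linarith) he']; congr 1; ring
    rw [this]
    exact mul_le_mul_of_nonneg_right (b1 d h0 h1 _ he) (Real.rpow_nonneg h0 _)
  exact ⟨min 1 (q ^ (1 / ρ)), lt_min one_pos hq', hq.le, hq1, fun d h0 h1 => b1 d h0 h1 _ le_rfl,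
    fun d h0 h1 => b2 d h0 h1 _ _ hβ.le hρ1, fun d h0 h1 => b2 d h0 h1 _ _ (by linarith) (by linarith)⟩

theorem gub_self (y y' : ℝ → 𝓑.E) (s : ℝ) : gubRemainder 𝓑 X y y' s s = 0 := by
  simp [gubRemainder]

theorem Evo.restrict (he : Evo 𝓑 Sg α γ X X2 a b u Y Y' f) {a2 b2 : ℝ} (h1 : a ≤ a2) (h2 : b2 ≤ b) :
    Evo 𝓑 Sg α γ X X2 a2 b2 u Y Y' f :=
  fun s t h h' h'' => he s t (h1.trans h) h' (h''.trans h2)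

/-- Sup bound. -/
theorem Evo.sup (h : Drv 𝓑 Sg α β γ δ σ T X X2 C ρ) (ha : 0 ≤ a) (hb : b ≤ T)
    (hI : IB 𝓑 α β γ σ X a b Y Y' K) (hf : ∀ r, a ≤ r → r ≤ b → Bd 𝓑 (γ - δ) (f r) K)
    (he : Evo 𝓑 Sg α γ X X2 a b u Y Y' f) (hm : Bd 𝓑 γ (u a) m) (hq0 : 0 ≤ q)
    (hq : ∀ d, 0 ≤ d → d ≤ b - a → d ^ ρ ≤ q) (t : ℝ) (h1 : a ≤ t) (h2 : t ≤ b) :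
    Bd 𝓑 γ (u t) (C * m + C * K * q) := by
  have hK := hI.nonneg (h1.trans h2)
  have hm0 := hm.nonneg
  have hC0 := h.C0
  have hC1 := h.one_le
  rcases h1.eq_or_lt with rfl | hlt
  · refine hm.mono ?_
    have : 0 ≤ C * K * q := by positivity
    nlinarith
  · obtain ⟨w, hw, hu⟩ := he a t le_rfl hlt h2
    have := (h.sb _ Lv.g (t - a) _ _ (by linarith) (by linarith) hm).add
      (h.wb a b Y Y' f K a t w ha hb hI hf le_rfl hlt h2 hw).1
    refine (this.congr hu).mono ?_
    have := hq (t - a) (by linarith) (by linarith)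
    gcongr

/-- Remainder bounds with full regularity. -/
theorem Evo.rem (h : Drv 𝓑 Sg α β γ δ σ T X X2 C ρ) (ha : 0 ≤ a) (hb : b ≤ T)
    (hI : IB 𝓑 α β γ σ X a b Y Y' K) (hf : ∀ r, a ≤ r → r ≤ b → Bd 𝓑 (γ - δ) (f r) K)
    (he : Evo 𝓑 Sg α γ X X2 a b u Y Y' f) (hN : ∀ t, a ≤ t → t ≤ b → Bd 𝓑 γ (u t) N)
    (s t : ℝ) (h1 : a ≤ s) (h2 : s ≤ t) (h3 : t ≤ b) :
    Bd 𝓑 (γ - α) (gubRemainder 𝓑 X u Y s t) (C * (N + K) * (t - s) ^ α) ∧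
    Bd 𝓑 (γ - 2 * α) (gubRemainder 𝓑 X u Y s t) (C * (N + K) * (t - s) ^ (2 * α)) := by
  have hK := hI.nonneg (h1.trans (h2.trans h3))
  have hN0 := (hN s h1 (h2.trans h3)).nonneg
  have hC0 := h.C0
  have hα := h.hα
  have hα2 := h.hα2
  rcases h2.eq_or_lt with rfl | hlt
  · rw [gub_self, sub_self, Real.zero_rpow (by linarith), Real.zero_rpow (by linarith), mul_zero]
    exact ⟨Bd.zero le_rfl, Bd.zero le_rfl⟩
  · obtain ⟨w, hw, hu⟩ := he s t h1 hlt h3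
    obtain ⟨-, w1, w2⟩ := h.wb a b Y Y' f K s t w ha hb hI hf h1 hlt h3 hw
    have hg : gubRemainder 𝓑 X u Y s t = (Sg.S (t - s) (u s) - u s) + (w - (X t - X s) • Y s) := by
      simp only [gubRemainder]; rw [hu]; abel
    have hus := hN s h1 (by linarith)
    have A1 := h.hd (γ - α) Lv.ga γ Lv.g α (by linarith) (by linarith) (by ring) (t - s) _ _
      (by linarith) (by linarith) hus
    have A2 := h.hd (γ - 2 * α) Lv.g2 γ Lv.g (2 * α) (by linarith) (by linarith) (by ring) (t - s) _ _
      (by linarith) (by linarith) hus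
    exact ⟨((A1.add w1).congr hg).mono (le_of_eq (by ring)),
      ((A2.add w2).congr hg).mono (le_of_eq (by ring))⟩

/-- Output bound in the class `CB`. -/
theorem Evo.cb (h : Drv 𝓑 Sg α β γ δ σ T X X2 C ρ) (ha : 0 ≤ a) (hab : a ≤ b) (hb : b ≤ T)
    (hI : IB 𝓑 α β γ σ X a b Y Y' K) (hf : ∀ r, a ≤ r → r ≤ b → Bd 𝓑 (γ - δ) (f r) K)
    (he : Evo 𝓑 Sg α γ X X2 a b u Y Y' f) (hm : Bd 𝓑 γ (u a) m) (hs : Sh α β ρ (b - a) q)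
    (hY : ∀ t, a ≤ t → t ≤ b → Bd 𝓑 (γ - α) (Y t) M')
    (hY' : ∀ s t, a ≤ s → s ≤ t → t ≤ b → Bd 𝓑 (γ - 2 * α) (Y t - Y s) (M' * (t - s) ^ β)) :
    CB 𝓑 α β γ X a b u Y (3 * C * C * (m + K * q)) M' := by
  have hK := hI.nonneg hab
  have hm0 := hm.nonneg
  have hC0 := h.C0
  have hC1 := h.one_le
  have hq0 := hs.q0
  have hq1 := hs.q1
  have hsup := he.sup h ha hb hI hf hm hs.q0 hs.e1
  have hrem := he.rem h ha hb hI hf hsup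
  have hCC : C ≤ C * C := by nlinarith
  have hKq : 0 ≤ K * q := by positivity
  have k1 : C * m + C * K * q ≤ 3 * C * C * (m + K * q) := by
    calc C * m + C * K * q = C * (m + K * q) := by ring
      _ ≤ (C * C) * (m + K * q) := by gcongr
      _ ≤ _ := by nlinarith [mul_nonneg (mul_nonneg hC0 hC0) (add_nonneg hm0 hKq)]
  have k2 : C * (C * m + C * K * q + K) * q ≤ 3 * C * C * (m + K * q) := by
    calc C * (C * m + C * K * q + K) * q = (C * C) * (m * q) + (C * C) * (K * q * q) + C * (K * q) := by
          ring
      _ ≤ (C * C) * (m * 1) + (C * C) * (K * q * 1) + (C * C) * (K * q) := by gcongr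
      _ ≤ _ := by nlinarith [mul_nonneg (mul_nonneg hC0 hC0) (add_nonneg hm0 hKq), mul_nonneg (mul_nonneg hC0 hC0) hm0]
  have hA : 0 ≤ C * (C * m + C * K * q + K) := by positivity
  refine ⟨fun t h1 h2 => (hsup t h1 h2).mono k1, hY, hY', fun s t h1 h2 h3 => ?_,
    fun s t h1 h2 h3 => ?_⟩
  · refine (hrem s t h1 h2 h3).1.mono ?_
    have hp := Real.rpow_nonneg (show 0 ≤ t - s by linarith) β
    calc _ ≤ C * (C * m + C * K * q + K) * (q * (t - s) ^ β) :=
          mul_le_mul_of_nonneg_left (hs.e2 _ (by linarith) (by linarith)) hA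
      _ = C * (C * m + C * K * q + K) * q * (t - s) ^ β := by ring
      _ ≤ _ := mul_le_mul_of_nonneg_right k2 hp
  · refine (hrem s t h1 h2 h3).2.mono ?_
    have hp := Real.rpow_nonneg (show 0 ≤ t - s by linarith) (2 * β)
    calc _ ≤ C * (C * m + C * K * q + K) * (q * (t - s) ^ (2 * β)) :=
          mul_le_mul_of_nonneg_left (hs.e3 _ (by linarith) (by linarith)) hA
      _ = C * (C * m + C * K * q + K) * q * (t - s) ^ (2 * β) := by ring
      _ ≤ _ := mul_le_mul_of_nonneg_right k2 hp

theorem Evo.sub (h : Ctx 𝓑 Sg α β γ δ σ T X X2 C) (ha : 0 ≤ a) (hb : b ≤ T)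
    {L1 L2 : ℝ} {u1 u2 Y1 Y2 Y1' Y2' f1 f2 : ℝ → 𝓑.E}
    (hI1 : IB 𝓑 α β γ σ X a b Y1 Y1' K1) (hf1 : ∀ r, a ≤ r → r ≤ b → Bd 𝓑 (γ - δ) (f1 r) L1)
    (hI2 : IB 𝓑 α β γ σ X a b Y2 Y2' K2) (hf2 : ∀ r, a ≤ r → r ≤ b → Bd 𝓑 (γ - δ) (f2 r) L2)
    (h1 : Evo 𝓑 Sg α γ X X2 a b u1 Y1 Y1' f1) (h2 : Evo 𝓑 Sg α γ X X2 a b u2 Y2 Y2' f2) :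
    Evo 𝓑 Sg α γ X X2 a b (fun t => u1 t - u2 t) (fun r => Y1 r - Y2 r) (fun r => Y1' r - Y2' r)
      (fun r => f1 r - f2 r) := by
  intro s t has hst htb
  obtain ⟨w1, hw1, e1⟩ := h1 s t has hst htb
  obtain ⟨w2, hw2, e2⟩ := h2 s t has hst htb
  refine ⟨w1 - w2, Rep.sub h ha hb hI1 hf1 hI2 hf2 has hst htb hw1 hw2, ?_⟩
  simp only [e1, e2, map_sub]; abel

theorem Evo.exists (h : Ctx 𝓑 Sg α β γ δ σ T X X2 C) (ha : 0 ≤ a) (hab : a ≤ b) (hb : b ≤ T)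
    (hI : IB 𝓑 α β γ σ X a b Y Y' K1) (hf : ∀ r, a ≤ r → r ≤ b → Bd 𝓑 (γ - δ) (f r) K2)
    (hc : CtsOn 𝓑 (γ - δ) a b f) (ξ : 𝓑.E) :
    ∃ u : ℝ → 𝓑.E, u a = ξ ∧ Evo 𝓑 Sg α γ X X2 a b u Y Y' f := by
  obtain ⟨W, w1, w2, w3⟩ := W_exists h ha hab hb hI hf hc
  refine ⟨fun t => Sg.S (t - a) ξ + W a t, ?_, fun s t h1 h2 h3 => ⟨W s t, w2 s t h1 h2 h3, ?_⟩⟩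
  · simp [w3 a le_rfl hab, Sg.S_id]
  · simp only
    rw [w1 a s t le_rfl h1 h2.le h3, map_add, ← Sg.S_comp _ _ (by linarith) (by linarith)]
    rw [show t - s + (s - a) = t - a by ring]; abel

theorem Evo.cts (h : Drv 𝓑 Sg α β γ δ σ T X X2 C ρ) (ha : 0 ≤ a) (hb : b ≤ T)
    (hI : IB 𝓑 α β γ σ X a b Y Y' K) (hf : ∀ r, a ≤ r → r ≤ b → Bd 𝓑 (γ - δ) (f r) K)
    (he : Evo 𝓑 Sg α γ X X2 a b u Y Y' f) (hN : ∀ t, a ≤ t → t ≤ b → 𝓑.Mem γ (u t)) :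
    CtsOn 𝓑 γ a b u := by
  intro t ht1 ht2 ε hε
  have ht : a ≤ t ∧ t ≤ b := ⟨ht1, ht2⟩
  have hK := hI.nonneg (ht.1.trans ht.2)
  have hC0 := h.C0
  have hρ := h.ρ0
  -- choose η with `C K (2η)^ρ ≤ ε/3`
  obtain ⟨η, hη, hηb⟩ : ∃ η > 0, C * K * (2 * η) ^ ρ ≤ ε / 3 := by
    have hcK : 0 < C * K + 1 := by positivity
    refine ⟨(ε / 3 / (C * K + 1)) ^ (1 / ρ) / 2, by positivity, ?_⟩
    rw [mul_div_cancel₀ _ (two_ne_zero), ← Real.rpow_mul (by positivity), one_div_mul_cancel hρ.ne',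
      Real.rpow_one]
    rw [mul_div_assoc', div_le_iff₀ hcK]
    nlinarith
  set v := max a (t - η) with hv
  have hav : a ≤ v := le_max_left _ _
  have hvt : v ≤ t := max_le ht.1 (by linarith)
  have hvη : t - η ≤ v := le_max_right _ _
  obtain ⟨η', hη', horb⟩ := orbit_cont h.toCtx Lv.g (hN v hav (hvt.trans ht.2)) (show 0 < ε / 3 by linarith)
  have step : ∀ s, a ≤ s → s ≤ b → v ≤ s → s ≤ t + η → Bd 𝓑 γ (u s - Sg.S (s - v) (u v)) (ε / 3) := by
    intro s h1 h2 h3 h4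
    rcases h3.eq_or_lt with h3 | h3
    · rw [← h3, sub_self, Sg.S_id, sub_self]; exact Bd.zero (by linarith)
    · obtain ⟨w, hw, hu⟩ := he v s hav h3 h2
      have := (h.wb a b Y Y' f K v s w ha hb hI hf hav h3 h2 hw).1
      refine (this.congr (by rw [hu]; abel)).mono (le_trans ?_ hηb)
      have : s - v ≤ 2 * η := by linarith
      have : 0 ≤ s - v := by linarith
      gcongr
  refine ⟨min η η', lt_min hη hη', fun s hs1 hs2 hst => ?_⟩
  have hs : a ≤ s ∧ s ≤ b := ⟨hs1, hs2⟩
  have h1 := (abs_lt.mp (hst.trans_le (min_le_left _ _)))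
  have hvs : v ≤ s := max_le hs.1 (by linarith)
  have A := step s hs.1 hs.2 hvs (by linarith)
  have B := step t ht.1 ht.2 hvt (by linarith)
  have D := horb (s - v) (t - v) (by linarith) (by linarith [hs.2]) (by linarith) (by linarith [ht.2])
    (by rw [sub_sub_sub_cancel_right]; exact hst.trans_le (min_le_right _ _))
  exact (((A.sub B).add D).congr (by abel)).mono (by linarith)

theorem F_cts (h : Eqn 𝓑 Sg α β γ δ σ T X X2 F G DG D2G C ρ)
    (hN : ∀ t, a ≤ t → t ≤ b → Bd 𝓑 γ (y t) N) (hc : CtsOn 𝓑 γ a b y) :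
    CtsOn 𝓑 (γ - δ) a b (fun t => F (y t)) := by
  intro t ht1 ht2 ε hε
  have ht : a ≤ t ∧ t ≤ b := ⟨ht1, ht2⟩
  have hN0 := (hN t ht.1 ht.2).nonneg
  obtain ⟨L, hL0, hL⟩ := h.fl (N + 1) (by linarith)
  obtain ⟨η, hη, hl⟩ := hc t ht1 ht2 (ε / (L + 1)) (by positivity)
  refine ⟨η, hη, fun s hs1 hs2 hst => ?_⟩
  have hs : a ≤ s ∧ s ≤ b := ⟨hs1, hs2⟩
  refine (hL _ _ _ ((hN s hs.1 hs.2).mono (by linarith)) ((hN t ht.1 ht.2).mono (by linarith))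
    (hl s hs1 hs2 hst)).mono ?_
  rw [mul_div_assoc', div_le_iff₀ (by linarith)]
  nlinarith

end

end RPDE


namespace RPDE

/-- One Picard step. -/
def Step (𝓑 : BanachScale) (Sg : ScaleSemigroup 𝓑) (α γ : ℝ) (X : ℝ → ℝ) (X2 : ℝ → ℝ → ℝ)
    (F G : 𝓑.E → 𝓑.E) (DG : 𝓑.E → 𝓑.E →ₗ[ℝ] 𝓑.E)
    (a b : ℝ) (y y' u : ℝ → 𝓑.E) : Prop :=
  Evo 𝓑 Sg α γ X X2 a b u (fun t => G (y t)) (fun t => DG (y t) (y' t)) (fun t => F (y t))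

/-- A solution on `[a,b]` with bounds. -/
structure Sol (𝓑 : BanachScale) (Sg : ScaleSemigroup 𝓑) (α β γ : ℝ) (X : ℝ → ℝ) (X2 : ℝ → ℝ → ℝ)
    (F G : 𝓑.E → 𝓑.E) (DG : 𝓑.E → 𝓑.E →ₗ[ℝ] 𝓑.E)
    (a b : ℝ) (y : ℝ → 𝓑.E) (M M' : ℝ) : Prop where
  cb : CB 𝓑 α β γ X a b y (fun t => G (y t)) M M'
  ct : CtsOn 𝓑 γ a b y
  ev : Step 𝓑 Sg α γ X X2 F G DG a b y (fun t => G (y t)) y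

section

variable {𝓑 : BanachScale} {Sg : ScaleSemigroup 𝓑} {α β γ δ σ T : ℝ}
    {X : ℝ → ℝ} {X2 : ℝ → ℝ → ℝ} {F G : 𝓑.E → 𝓑.E} {DG : 𝓑.E → 𝓑.E →ₗ[ℝ] 𝓑.E}
    {D2G : 𝓑.E → 𝓑.E →ₗ[ℝ] 𝓑.E →ₗ[ℝ] 𝓑.E}
    {C ρ a b M M' N N' M0 e e' τ K K1 K2 q m : ℝ} {y y' z z' u Y Y' f : ℝ → 𝓑.E}

theorem Sh.monoq {h q' : ℝ} (hs : Sh α β ρ h q) (hq : q ≤ q') (hq1 : q' ≤ 1) : Sh α β ρ h q' :=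
  ⟨hs.q0.trans hq, hq1, fun d h0 h1 => (hs.e1 d h0 h1).trans hq,
    fun d h0 h1 => (hs.e2 d h0 h1).trans (mul_le_mul_of_nonneg_right hq (Real.rpow_nonneg h0 _)),
    fun d h0 h1 => (hs.e3 d h0 h1).trans (mul_le_mul_of_nonneg_right hq (Real.rpow_nonneg h0 _))⟩

theorem CB.nonneg (hc : CB 𝓑 α β γ X a b y y' M M') (hab : a ≤ b) : 0 ≤ M ∧ 0 ≤ M' :=
  ⟨(hc.y a le_rfl hab).nonneg, (hc.y' a le_rfl hab).nonneg⟩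

theorem CB.congr (hc : CB 𝓑 α β γ X a b y y' M M') (h1 : ∀ t, a ≤ t → t ≤ b → z t = y t)
    (h2 : ∀ t, a ≤ t → t ≤ b → z' t = y' t) : CB 𝓑 α β γ X a b z z' M M' := by
  refine ⟨fun t h h' => ?_, fun t h h' => ?_, fun s t h h' h'' => ?_, fun s t h h' h'' => ?_,
    fun s t h h' h'' => ?_⟩
  · rw [h1 t h h']; exact hc.y t h h'
  · rw [h2 t h h']; exact hc.y' t h h'
  · rw [h2 t (by linarith) h'', h2 s h (by linarith)]; exact hc.hy' s t h h' h''
  · simp only [gubRemainder]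
    rw [h1 t (by linarith) h'', h1 s h (by linarith), h2 s h (by linarith)]; exact hc.r1 s t h h' h''
  · simp only [gubRemainder]
    rw [h1 t (by linarith) h'', h1 s h (by linarith), h2 s h (by linarith)]; exact hc.r2 s t h h' h''

theorem CB.add (hc : CB 𝓑 α β γ X a b y y' M M') (hd : CB 𝓑 α β γ X a b z z' N N') :
    CB 𝓑 α β γ X a b (fun t => y t + z t) (fun t => y' t + z' t) (M + N) (M' + N') := by
  have h0 := (CB.zero (𝓑 := 𝓑) (α := α) (β := β) (γ := γ) (X := X) (a := a) (b := b)).sub hd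
  have := hc.sub h0
  refine (this.mono (by linarith) (by linarith)).congr (fun t _ _ => ?_) (fun t _ _ => ?_) <;>
  · simp

/-- Contraction of the Picard step. -/
theorem step_contr (h : Eqn 𝓑 Sg α β γ δ σ T X X2 F G DG D2G C ρ) (hM0 : 0 ≤ M0) :
    ∃ Λ ≥ 1, ∃ q > 0, q ≤ 1 ∧ ∀ (a b : ℝ) (y y' z z' u v : ℝ → 𝓑.E) (e : ℝ), 0 ≤ a → a ≤ b → b ≤ T →
      Sh α β ρ (b - a) q → CB 𝓑 α β γ X a b y y' M0 M0 → CB 𝓑 α β γ X a b z z' M0 M0 →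
      CB 𝓑 α β γ X a b (fun t => y t - z t) (fun t => y' t - z' t) e (Λ * e) →
      Step 𝓑 Sg α γ X X2 F G DG a b y y' u → Step 𝓑 Sg α γ X X2 F G DG a b z z' v → u a = v a →
      CB 𝓑 α β γ X a b (fun t => u t - v t) (fun t => G (y t) - G (z t)) (e / 2) (Λ * (e / 2)) := by
  obtain ⟨P, hP, hp⟩ := comp_diff h hM0
  obtain ⟨P2, hP2, hp2⟩ := comp_bd h hM0
  have hC1 := h.one_le
  have hC0 := h.C0
  have hCC : 1 ≤ C * C := by nlinarith
  have hPP : 4 * P ≤ 6 * (C * C) * P * (1 + 4 * P) := by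
    have : 1 * P ≤ (C * C) * P := by gcongr
    nlinarith [mul_nonneg (mul_nonneg hC0 hC0) (show 0 ≤ P by linarith)]
  have hB : 0 < 6 * (C * C) * P * (1 + 4 * P) := by linarith
  refine ⟨4 * P, by linarith, 1 / (6 * (C * C) * P * (1 + 4 * P)), by positivity, ?_, ?_⟩
  · rw [div_le_one hB]; linarith
  intro a b y y' z z' u v e ha hab hb hs hy hz hyz hu hv huv
  have he := (hyz.nonneg hab).1
  obtain ⟨d1, d2, d3⟩ := hp a b y y' z z' e _ ha hab hb hy hz hyz
  obtain ⟨d3, d4⟩ := d3 _ hs.e2 hs.q0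
  obtain ⟨y1, y2⟩ := hp2 a b y y' ha hab hb hy
  obtain ⟨z1, z2⟩ := hp2 a b z z' ha hab hb hz
  have hev := Evo.sub h.toCtx ha hb y1 y2 z1 z2 hu hv
  have := Evo.cb (m := 0) h.toDrv ha hab hb d1 d2 hev
    (by simp only [huv, sub_self]; exact Bd.zero le_rfl) hs d3 d4
  refine this.mono (le_of_eq ?_) ?_
  · field_simp; ring
  · have : 1 / (6 * (C * C) * P * (1 + 4 * P)) * (4 * P) ≤ 1 := by
      rw [one_div_mul_eq_div, div_le_one hB]; exact hPP
    have h2 : 1 / (6 * (C * C) * P * (1 + 4 * P)) * (4 * P * e) ≤ e := by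
      rw [← mul_assoc]; nlinarith
    nlinarith

/-- Local uniqueness. -/
theorem local_unique (h : Eqn 𝓑 Sg α β γ δ σ T X X2 F G DG D2G C ρ) (hM0 : 0 ≤ M0) :
    ∃ l > 0, ∀ (a b : ℝ) (y z : ℝ → 𝓑.E), 0 ≤ a → a ≤ b → b ≤ T → b - a ≤ l →
      Sol 𝓑 Sg α β γ X X2 F G DG a b y M0 M0 → Sol 𝓑 Sg α β γ X X2 F G DG a b z M0 M0 →
      y a = z a → ∀ t, a ≤ t → t ≤ b → y t = z t := by
  obtain ⟨Λ, hΛ, q, hq, hq1, hc⟩ := step_contr h hM0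
  obtain ⟨l, hl, hs⟩ := exists_sh h.β0 h.ρ0 h.ρ1 hq hq1
  refine ⟨l, hl, fun a b y z ha hab hb hbl hy hz hyz => ?_⟩
  have key : ∀ n : ℕ, CB 𝓑 α β γ X a b (fun t => y t - z t) (fun t => G (y t) - G (z t))
      (2 * M0 * (1 / 2) ^ n) (Λ * (2 * M0 * (1 / 2) ^ n)) := by
    intro n
    induction n with
    | zero => exact (hy.cb.sub hz.cb).mono (by simp; linarith) (by simp; nlinarith)
    | succ n ih =>
      have := hc a b _ _ _ _ _ _ _ ha hab hb (hs.mono hbl) hy.cb hz.cb ih hy.ev hz.ev hyz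
      refine this.mono (le_of_eq (by rw [pow_succ]; ring)) (le_of_eq (by rw [pow_succ]; ring))
  intro t h1 h2
  have ht : Filter.Tendsto (fun n : ℕ => 2 * M0 * (1 / 2 : ℝ) ^ n) Filter.atTop (nhds 0) := by
    have := (tendsto_pow_atTop_nhds_zero_of_lt_one (r := (1 / 2 : ℝ)) (by norm_num)
      (by norm_num)).const_mul (2 * M0)
    simpa using this
  exact sub_eq_zero.mp (Bd.tendsto_zero ht fun n => (key n).y t h1 h2)

/-- Invariance of a ball under the Picard step. -/
theorem step_inv (h : Eqn 𝓑 Sg α β γ δ σ T X X2 F G DG D2G C ρ) (hm : 0 ≤ m) :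
    ∃ M M' : ℝ, 3 * C * C * m ≤ M ∧ 0 ≤ M' ∧ ∃ q > 0, q ≤ 1 ∧ ∀ (a b : ℝ) (y y' u : ℝ → 𝓑.E),
      0 ≤ a → a ≤ b → b ≤ T → Sh α β ρ (b - a) q → CB 𝓑 α β γ X a b y y' M M' →
      Step 𝓑 Sg α γ X X2 F G DG a b y y' u → Bd 𝓑 γ (u a) m →
      CB 𝓑 α β γ X a b u (fun t => G (y t)) M M' := by
  have hC1 := h.one_le
  have hC0 := h.C0
  obtain ⟨M, hM⟩ : ∃ M, M = 3 * C * C * m + 1 := ⟨_, rfl⟩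
  have hM0 : 0 ≤ M := by rw [hM]; positivity
  obtain ⟨M', hM'⟩ : ∃ M', M' = C * (C + C * M) + C * (C * (M + C)) := ⟨_, rfl⟩
  have hM0' : 0 ≤ M' := by rw [hM']; positivity
  obtain ⟨P, hP, hp⟩ := comp_bd h (M0 := max M M') (hM0.trans (le_max_left _ _))
  have hB : 1 ≤ 3 * C * C * P + M' + 1 := by
    have : 0 ≤ 3 * C * C * P := by positivity
    linarith
  refine ⟨M, M', by linarith, hM0', 1 / (3 * C * C * P + M' + 1), by positivity, ?_, ?_⟩
  · rw [div_le_one (by linarith)]; exact hB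
  intro a b y y' u ha hab hb hs hy hu hm'
  obtain ⟨i1, i2⟩ := hp a b y y' ha hab hb (hy.mono (le_max_left _ _) (le_max_right _ _))
  obtain ⟨p1, p2⟩ := yp_lin h ha hb hy hs.e2
  have q1 : 3 * C * C * P * (1 / (3 * C * C * P + M' + 1)) ≤ 1 := by
    rw [mul_one_div, div_le_one (by linarith)]; linarith
  have q2 : (1 / (3 * C * C * P + M' + 1)) * M' ≤ 1 := by
    have : 0 ≤ 3 * C * C * P := by positivity
    rw [one_div_mul_eq_div, div_le_one (by linarith)]; linarith
  refine (Evo.cb (M' := M') h.toDrv ha hab hb i1 i2 hu hm' hs (fun t h1 h2 => (p1 t h1 h2).mono ?_)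
    (fun s t h1 h2 h3 => (p2 s t h1 h2 h3).mono ?_)).mono ?_ le_rfl
  · rw [hM']; have : 0 ≤ C * (C * (M + C)) := by positivity
    linarith
  · refine mul_le_mul_of_nonneg_right ?_ (Real.rpow_nonneg (by linarith) _)
    have k : C * (C * (M + C * (1 / (3 * C * C * P + M' + 1)) * M')) ≤ C * (C * (M + C * 1)) := by
      rw [mul_assoc C (1 / _) M']; gcongr
    have : 0 ≤ C * (C + C * M) := by positivity
    rw [mul_one] at k
    linarith
  · rw [hM]; linarith

end

end RPDE


namespace RPDE

section

variable {𝓑 : BanachScale} {Sg : ScaleSemigroup 𝓑} {α β γ δ σ T : ℝ}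
    {X : ℝ → ℝ} {X2 : ℝ → ℝ → ℝ} {F G : 𝓑.E → 𝓑.E} {DG : 𝓑.E → 𝓑.E →ₗ[ℝ] 𝓑.E}
    {D2G : 𝓑.E → 𝓑.E →ₗ[ℝ] 𝓑.E →ₗ[ℝ] 𝓑.E}
    {C ρ a b M M' N N' M0 e e' τ K K1 K2 q m : ℝ} {y y' z z' u Y Y' f : ℝ → 𝓑.E}

theorem CB.lim (h : Ctx 𝓑 Sg α β γ δ σ T X X2 C) {p p' : ℕ → ℝ → 𝓑.E} {ε : ℕ → ℝ}
    (hε : Filter.Tendsto ε Filter.atTop (nhds 0))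
    (hc : ∀ n, CB 𝓑 α β γ X a b (p n) (p' n) M M')
    (h1 : ∀ n t, a ≤ t → t ≤ b → Bd 𝓑 γ (p n t - y t) (ε n))
    (h2 : ∀ n t, a ≤ t → t ≤ b → Bd 𝓑 (γ - α) (p' n t - y' t) (ε n)) :
    CB 𝓑 α β γ X a b y y' M M' := by
  have hα := h.hα
  have hg : ∀ n s t, gubRemainder 𝓑 X (p n) (p' n) s t - gubRemainder 𝓑 X y y' s t
      = (p n t - y t) - (p n s - y s) - (X t - X s) • (p' n s - y' s) := by
    intro n s t; simp only [gubRemainder]; module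
  have t1 : ∀ c : ℝ, Filter.Tendsto (fun n => c * ε n) Filter.atTop (nhds 0) := fun c => by
    simpa using hε.const_mul c
  refine ⟨fun t a1 a2 => Bd.lim hε (fun n => (hc n).y t a1 a2) (fun n => h1 n t a1 a2),
    fun t a1 a2 => Bd.lim hε (fun n => (hc n).y' t a1 a2) (fun n => h2 n t a1 a2),
    fun s t a1 a2 a3 => Bd.lim (t1 (2 * C)) (fun n => (hc n).hy' s t a1 a2 a3) (fun n => ?_),
    fun s t a1 a2 a3 => Bd.lim (t1 (2 * C + |X t - X s|)) (fun n => (hc n).r1 s t a1 a2 a3) (fun n => ?_),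
    fun s t a1 a2 a3 => Bd.lim (t1 (2 * C + |X t - X s| * C)) (fun n => (hc n).r2 s t a1 a2 a3) (fun n => ?_)⟩
  · have e1 := h.emb (γ - 2 * α) Lv.g2 _ Lv.ga (by linarith) _ _ (h2 n t (by linarith) a3)
    have e2 := h.emb (γ - 2 * α) Lv.g2 _ Lv.ga (by linarith) _ _ (h2 n s a1 (by linarith))
    exact ((e1.sub e2).congr (by abel)).mono (le_of_eq (by ring))
  · have e1 := h.emb (γ - α) Lv.ga _ Lv.g (by linarith) _ _ (h1 n t (by linarith) a3)
    have e2 := h.emb (γ - α) Lv.ga _ Lv.g (by linarith) _ _ (h1 n s a1 (by linarith))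
    exact (((e1.sub e2).sub ((h2 n s a1 (by linarith)).smul le_rfl)).congr (hg n s t)).mono
      (le_of_eq (by ring))
  · have e1 := h.emb (γ - 2 * α) Lv.g2 _ Lv.g (by linarith) _ _ (h1 n t (by linarith) a3)
    have e2 := h.emb (γ - 2 * α) Lv.g2 _ Lv.g (by linarith) _ _ (h1 n s a1 (by linarith))
    have e3 := h.emb (γ - 2 * α) Lv.g2 _ Lv.ga (by linarith) _ _ (h2 n s a1 (by linarith))
    exact (((e1.sub e2).sub (e3.smul le_rfl)).congr (hg n s t)).mono
      (le_of_eq (by ring))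

theorem CtsOn.lim {p : ℕ → ℝ → 𝓑.E} {ε : ℕ → ℝ} {θ : ℝ}
    (hε : Filter.Tendsto ε Filter.atTop (nhds 0)) (hc : ∀ n, CtsOn 𝓑 θ a b (p n))
    (h1 : ∀ n t, a ≤ t → t ≤ b → Bd 𝓑 θ (p n t - y t) (ε n)) : CtsOn 𝓑 θ a b y := by
  intro t a1 a2 e he
  obtain ⟨n, hn⟩ := (hε.eventually (gt_mem_nhds (show 0 < e / 3 by linarith))).exists
  obtain ⟨η, hη, hl⟩ := hc n t a1 a2 (e / 3) (by linarith)
  refine ⟨η, hη, fun s b1 b2 hst => ?_⟩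
  exact ((((hl s b1 b2 hst).sub (h1 n s b1 b2)).add (h1 n t a1 a2)).congr (by abel)).mono (by linarith)

theorem Evo.congr_u (he : Evo 𝓑 Sg α γ X X2 a b u Y Y' f) (h : ∀ t, a ≤ t → t ≤ b → z t = u t) :
    Evo 𝓑 Sg α γ X X2 a b z Y Y' f := by
  intro s t h1 h2 h3
  obtain ⟨w, hw, hu⟩ := he s t h1 h2 h3
  exact ⟨w, hw, by rw [h t (by linarith) h3, h s h1 (by linarith), hu]⟩

theorem IB.zero : IB 𝓑 α β γ σ X a b (fun _ => 0) (fun _ => 0) 0 := by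
  refine ⟨fun _ _ _ => Bd.zero le_rfl, fun _ _ _ => Bd.zero le_rfl, fun _ _ _ _ _ => ?_,
    fun _ _ _ _ _ => ?_⟩
  · rw [sub_zero, zero_mul]; exact Bd.zero le_rfl
  · simp only [gubRemainder, sub_zero, smul_zero, zero_mul]; exact Bd.zero le_rfl

theorem G_lip (h : Eqn 𝓑 Sg α β γ δ σ T X X2 F G DG D2G C ρ) {x x' : 𝓑.E} (hx : 𝓑.Mem γ x)
    (hx' : 𝓑.Mem γ x') (hd : Bd 𝓑 γ (x - x') e) : Bd 𝓑 (γ - α) (G x - G x') (C * (C * e)) :=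
  h.emb _ Lv.ga _ Lv.gs (by linarith [h.hσα]) _ _ (h.s0.lip hx hx' hd)

/-- Local existence. -/
theorem local_exists (h : Eqn 𝓑 Sg α β γ δ σ T X X2 F G DG D2G C ρ) (hm : 0 ≤ m) :
    ∃ l > 0, ∃ M M' : ℝ, ∀ (a b : ℝ) (ξ : 𝓑.E), 0 ≤ a → a ≤ b → b ≤ T → b - a ≤ l →
      Bd 𝓑 γ ξ m → ∃ y : ℝ → 𝓑.E, y a = ξ ∧ Sol 𝓑 Sg α β γ X X2 F G DG a b y M M' := by
  have hC1 := h.one_le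
  have hC0 := h.C0
  have hα := h.hα
  obtain ⟨M, M', hM, hM0', q1, hq1, hq1', hinv⟩ := step_inv h hm
  have hM0 : 0 ≤ M := le_trans (by positivity) hM
  obtain ⟨M0, hM0d⟩ : ∃ M0, M0 = max M M' := ⟨_, rfl⟩
  have hMM : M ≤ M0 := hM0d ▸ le_max_left _ _
  have hMM' : M' ≤ M0 := hM0d ▸ le_max_right _ _
  have hM00 : 0 ≤ M0 := hM0.trans hMM
  obtain ⟨Λ, hΛ, q2, hq2, hq2', hcon⟩ := step_contr h hM00
  obtain ⟨P, hP, hp⟩ := comp_bd h hM00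
  obtain ⟨l, hl, hs⟩ := exists_sh h.β0 h.ρ0 h.ρ1 (lt_min hq1 hq2) ((min_le_left _ _).trans hq1')
  refine ⟨l, hl, M, M', fun a b ξ ha hab hb hbl hξ => ?_⟩
  have hs1 := (hs.mono hbl).monoq (min_le_left _ _) hq1'
  have hs2 := (hs.mono hbl).monoq (min_le_right _ _) hq2'
  -- good pairs
  let Good : (ℝ → 𝓑.E) × (ℝ → 𝓑.E) → Prop := fun p =>
    CB 𝓑 α β γ X a b p.1 p.2 M M' ∧ CtsOn 𝓑 γ a b p.1 ∧ p.1 a = ξ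
  have hstep : ∀ p, Good p → ∃ u, Step 𝓑 Sg α γ X X2 F G DG a b p.1 p.2 u ∧
      Good (u, fun t => G (p.1 t)) := by
    intro p hgp
    obtain ⟨g1, g2, g3⟩ := hgp
    obtain ⟨i1, i2⟩ := hp a b _ _ ha hab hb (g1.mono hMM hMM')
    obtain ⟨u, hu0, hu⟩ := Evo.exists h.toCtx ha hab hb i1 i2 (F_cts h g1.y g2) ξ
    have hcb := hinv a b _ _ _ ha hab hb hs1 g1 hu (by rw [hu0]; exact hξ)
    exact ⟨u, hu, hcb, hu.cts h.toDrv ha hb i1 i2 fun t h1 h2 => (hcb.y t h1 h2).1, hu0⟩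
  obtain ⟨u0, hu0⟩ : ∃ u0, Good (u0, fun _ => 0) := by
    have i2 : ∀ r, a ≤ r → r ≤ b → Bd 𝓑 (γ - δ) ((fun _ => 0 : ℝ → 𝓑.E) r) 0 := fun _ _ _ => Bd.zero le_rfl
    obtain ⟨u, hu0, hu⟩ := Evo.exists h.toCtx ha hab hb IB.zero i2
      (fun t _ _ ε hε => ⟨1, one_pos, fun s _ _ _ => by simpa using Bd.zero hε.le⟩) ξ
    have hcb := Evo.cb (m := m) (M' := 0) h.toDrv ha hab hb IB.zero i2 hu (by rw [hu0]; exact hξ) hs1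
      (fun _ _ _ => Bd.zero le_rfl) (fun _ _ _ _ _ => by simpa using Bd.zero le_rfl)
    have hcb' := hcb.mono (N := M) (N' := M') (by simpa using hM) hM0'
    exact ⟨u, hcb', hu.cts h.toDrv ha hb IB.zero i2 fun t h1 h2 => (hcb.y t h1 h2).1, hu0⟩
  let nxt : {p // Good p} → {p // Good p} := fun p =>
    ⟨_, (Classical.choose_spec (hstep p.1 p.2)).2⟩
  let sq : ℕ → {p // Good p} := fun n => Nat.rec ⟨_, hu0⟩ (fun _ p => nxt p) n
  obtain ⟨v, hv⟩ : ∃ v : ℕ → ℝ → 𝓑.E, v = fun n => (sq n).1.1 := ⟨_, rfl⟩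
  obtain ⟨v', hv'⟩ : ∃ v' : ℕ → ℝ → 𝓑.E, v' = fun n => (sq n).1.2 := ⟨_, rfl⟩
  have vS : ∀ n, Step 𝓑 Sg α γ X X2 F G DG a b (v n) (v' n) (v (n + 1)) := by
    intro n; rw [hv, hv']; exact (Classical.choose_spec (hstep (sq n).1 (sq n).2)).1
  have vD : ∀ n, v' (n + 1) = fun t => G (v n t) := by
    intro n; rw [hv, hv']
  have vG : ∀ n, Good (v n, v' n) := by
    intro n; rw [hv, hv']; exact (sq n).2
  have vC : ∀ n, CB 𝓑 α β γ X a b (v n) (v' n) M M' := fun n => (vG n).1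
  have vT : ∀ n, CtsOn 𝓑 γ a b (v n) := fun n => (vG n).2.1
  have v0 : ∀ n, v n a = ξ := fun n => (vG n).2.2
  have vC0 : ∀ n, CB 𝓑 α β γ X a b (v n) (v' n) M0 M0 := fun n => (vC n).mono hMM hMM'
  clear_value sq nxt
  clear vG hstep hu0 hv hv'
  obtain ⟨ε, hε⟩ : ∃ ε : ℕ → ℝ, ε = fun n => 2 * (2 * M0) * (1 / 2) ^ n := ⟨_, rfl⟩
  have εp : ∀ n, 0 ≤ ε n := fun n => by rw [hε]; positivity
  have εs : ∀ n, ε (n + 1) = ε n / 2 := fun n => by simp only [hε, pow_succ]; ring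
  have εt : Filter.Tendsto ε Filter.atTop (nhds 0) := by
    have := (tendsto_pow_atTop_nhds_zero_of_lt_one (r := (1 / 2 : ℝ)) (by norm_num)
      (by norm_num)).const_mul (2 * (2 * M0))
    rw [hε]; simpa using this
  have εm : ∀ c : ℝ, Filter.Tendsto (fun n => c * ε n) Filter.atTop (nhds 0) := fun c => by
    simpa using εt.const_mul c
  have d1 : ∀ n, CB 𝓑 α β γ X a b (fun t => v (n + 1) t - v n t) (fun t => v' (n + 1) t - v' n t)
      (ε n / 2) (Λ * (ε n / 2)) := by
    intro n
    induction n with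
    | zero =>
      have hz : ε 0 / 2 = M0 + M0 := by rw [hε]; simp; ring
      rw [hz]
      exact ((vC0 1).sub (vC0 0)).mono le_rfl (by nlinarith)
    | succ n ih =>
      have := hcon a b _ _ _ _ _ _ _ ha hab hb hs2 (vC0 (n + 1)) (vC0 n) ih (vS (n + 1)) (vS n)
        (by rw [v0, v0])
      rw [εs, vD (n + 1), vD n]
      exact this
  have d2 : ∀ n k, CB 𝓑 α β γ X a b (fun t => v (n + k) t - v n t) (fun t => v' (n + k) t - v' n t)
      (ε n - ε (n + k)) (Λ * (ε n - ε (n + k))) := by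
    intro n k
    induction k with
    | zero =>
      have := CB.zero (𝓑 := 𝓑) (α := α) (β := β) (γ := γ) (X := X) (a := a) (b := b)
      simpa using this
    | succ k ih =>
      refine ((ih.add (d1 (n + k))).congr (fun t _ _ => ?_) (fun t _ _ => ?_)).mono ?_ ?_
      · rw [← add_assoc]; abel
      · rw [← add_assoc]; abel
      · rw [← add_assoc, εs]; linarith
      · rw [← add_assoc, εs]; linarith
  have d3 : ∀ n k, CB 𝓑 α β γ X a b (fun t => v (n + k) t - v n t) (fun t => v' (n + k) t - v' n t)
      (ε n) (Λ * ε n) := fun n k =>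
    (d2 n k).mono (by linarith [εp (n + k)]) (by nlinarith [εp (n + k)])
  have hex : ∀ t, ∃ x, a ≤ t → t ≤ b → 𝓑.Mem γ x ∧ ∀ n, Bd 𝓑 γ (v n t - x) (ε n) := by
    intro t
    by_cases ht : a ≤ t ∧ t ≤ b
    · obtain ⟨x, hx⟩ := Bd.complete (u := fun n => v n t) εt (fun n => ((vC n).y t ht.1 ht.2).1)
        (fun n k hk => by
          obtain ⟨j, rfl⟩ := Nat.exists_eq_add_of_le hk
          exact (d3 n j).y t ht.1 ht.2)
      exact ⟨x, fun _ _ => hx⟩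
    · exact ⟨0, fun h1 h2 => absurd ⟨h1, h2⟩ ht⟩
  choose y hy using hex
  have c1 : ∀ n t, a ≤ t → t ≤ b → Bd 𝓑 γ (v n t - y t) (ε n) := fun n t h1 h2 => (hy t h1 h2).2 n
  have c2 : ∀ n t, a ≤ t → t ≤ b → Bd 𝓑 (γ - α) (v' (n + 1) t - G (y t)) (C * (C * ε n)) := by
    intro n t h1 h2
    rw [vD n]
    exact G_lip h ((vC n).y t h1 h2).1 (hy t h1 h2).1 (c1 n t h1 h2)
  have hCC : 1 ≤ C * C := by nlinarith
  have c1' : ∀ n t, a ≤ t → t ≤ b → Bd 𝓑 γ (v (n + 1) t - y t) (C * C * ε n) := fun n t h1 h2 =>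
    (c1 (n + 1) t h1 h2).mono (by rw [εs]; nlinarith [εp n])
  have c2' : ∀ n t, a ≤ t → t ≤ b → Bd 𝓑 (γ - α) (v' (n + 1) t - G (y t)) (C * C * ε n) :=
    fun n t h1 h2 => (c2 n t h1 h2).mono (le_of_eq (by ring))
  have yC : CB 𝓑 α β γ X a b y (fun t => G (y t)) M M' :=
    CB.lim h.toCtx (εm (C * C)) (fun n => vC (n + 1)) c1' c2'
  have yT : CtsOn 𝓑 γ a b y := CtsOn.lim εt vT c1
  have yD : ∀ n, CB 𝓑 α β γ X a b (fun t => y t - v n t) (fun t => G (y t) - v' n t)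
      (ε n) (Λ * ε n) := by
    intro n
    refine CB.lim h.toCtx (p := fun k t => v (n + k + 1) t - v n t)
      (p' := fun k t => v' (n + k + 1) t - v' n t) (ε := fun k => C * C * ε (n + k))
      ?_ (fun k => d3 n (k + 1)) ?_ ?_
    · have := (εm (C * C)).comp (Filter.tendsto_add_atTop_nat n)
      refine this.congr fun k => ?_
      simp only [Function.comp]; rw [add_comm]
    · intro k t h1 h2
      exact (c1' (n + k) t h1 h2).congr (by abel)
    · intro k t h1 h2
      exact (c2' (n + k) t h1 h2).congr (by abel)
  obtain ⟨i1, i2⟩ := hp a b _ _ ha hab hb (yC.mono hMM hMM')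
  obtain ⟨u, hu0, hu⟩ := Evo.exists h.toCtx ha hab hb i1 i2 (F_cts h yC.y yT) ξ
  have yu : ∀ t, a ≤ t → t ≤ b → y t = u t := by
    intro t h1 h2
    symm
    refine sub_eq_zero.mp (Bd.tendsto_zero (θ := γ) εt fun n => ?_)
    have := hcon a b _ _ _ _ _ _ _ ha hab hb hs2 (yC.mono hMM hMM') (vC0 n) (yD n) hu (vS n)
      (by rw [hu0, v0])
    exact (((this.y t h1 h2).add (c1 (n + 1) t h1 h2)).congr (by abel)).mono
      (by rw [εs]; linarith)
  exact ⟨y, by rw [yu a le_rfl hab, hu0], yC, yT, hu.congr_u yu⟩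

end

end RPDE


namespace RPDE

section

variable {𝓑 : BanachScale} {Sg : ScaleSemigroup 𝓑} {α β γ δ σ T : ℝ}
    {X : ℝ → ℝ} {X2 : ℝ → ℝ → ℝ} {F G : 𝓑.E → 𝓑.E} {DG : 𝓑.E → 𝓑.E →ₗ[ℝ] 𝓑.E}
    {D2G : 𝓑.E → 𝓑.E →ₗ[ℝ] 𝓑.E →ₗ[ℝ] 𝓑.E}
    {C ρ a b c M M' N N' M0 M1 M1' M2 M2' e e' τ K K1 K2 q m : ℝ} {y y' z z' u Y Y' f : ℝ → 𝓑.E}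

theorem Sol.restrict (hy : Sol 𝓑 Sg α β γ X X2 F G DG a b y M M') {a2 b2 : ℝ} (h1 : a ≤ a2)
    (h2 : b2 ≤ b) : Sol 𝓑 Sg α β γ X X2 F G DG a2 b2 y M M' := by
  refine ⟨hy.cb.restrict h1 h2, fun t a1 a3 ε hε => ?_, Evo.restrict hy.ev h1 h2⟩
  obtain ⟨η, hη, hl⟩ := hy.ct t (h1.trans a1) (a3.trans h2) ε hε
  exact ⟨η, hη, fun s s1 s2 => hl s (h1.trans s1) (s2.trans h2)⟩

theorem Sol.mono (hy : Sol 𝓑 Sg α β γ X X2 F G DG a b y M M') (h1 : M ≤ N) (h2 : M' ≤ N') :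
    Sol 𝓑 Sg α β γ X X2 F G DG a b y N N' := ⟨hy.cb.mono h1 h2, hy.ct, hy.ev⟩

theorem Sol.congr (hy : Sol 𝓑 Sg α β γ X X2 F G DG a b y M M') (h : ∀ t, a ≤ t → t ≤ b → z t = y t) :
    Sol 𝓑 Sg α β γ X X2 F G DG a b z M M' := by
  refine ⟨hy.cb.congr h fun t h1 h2 => by rw [h t h1 h2], fun t a1 a2 ε hε => ?_, fun s t a1 a2 a3 => ?_⟩
  · obtain ⟨η, hη, hl⟩ := hy.ct t a1 a2 ε hε
    refine ⟨η, hη, fun s s1 s2 s3 => ?_⟩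
    rw [h s s1 s2, h t a1 a2]; exact hl s s1 s2 s3
  · obtain ⟨w, hw, hu⟩ := hy.ev s t a1 a2 a3
    refine ⟨w, hw.congr (fun r h1 h2 => ?_) (fun r h1 h2 => ?_) (fun r h1 h2 => ?_), ?_⟩
    · rw [h r (by linarith) (by linarith)]
    · simp only [h r (by linarith) (by linarith)]
    · rw [h r (by linarith) (by linarith)]
    · rw [h t (by linarith) a3, h s a1 (by linarith), hu]

/-- A priori bound on short intervals. -/
theorem apriori (h : Eqn 𝓑 Sg α β γ δ σ T X X2 F G DG D2G C ρ) :
    ∃ l > 0, ∃ A ≥ 1, ∀ (a b M M' m : ℝ) (y : ℝ → 𝓑.E), 0 ≤ a → a ≤ b → b ≤ T → b - a ≤ l →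
      Sol 𝓑 Sg α β γ X X2 F G DG a b y M M' → Bd 𝓑 γ (y a) m →
      ∀ t, a ≤ t → t ≤ b → Bd 𝓑 γ (y t) (A * (m + 1)) := by
  have hC1 := h.one_le
  have hC0 := h.C0
  obtain ⟨P, hP, hp⟩ := comp_lin h
  obtain ⟨Λ, hΛ⟩ : ∃ Λ, Λ = 2 * (C * C + 1) := ⟨_, rfl⟩
  have hΛ1 : 1 ≤ Λ := by nlinarith
  have hB : 1 ≤ 6 * C * C * P * (1 + Λ) + C * C * C * Λ + 1 := by
    have : 0 ≤ 6 * C * C * P * (1 + Λ) + C * C * C * Λ := by positivity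
    linarith
  obtain ⟨q, hq⟩ : ∃ q, q = 1 / (6 * C * C * P * (1 + Λ) + C * C * C * Λ + 1) := ⟨_, rfl⟩
  have hq0 : 0 < q := by rw [hq]; positivity
  have hq1 : q ≤ 1 := by rw [hq, div_le_one (by linarith)]; exact hB
  have q1 : 6 * C * C * P * (1 + Λ) * q ≤ 1 := by
    have : 0 ≤ C * C * C * Λ := by positivity
    rw [hq, mul_one_div, div_le_one (by linarith)]; linarith
  have q2 : C * C * C * Λ * q ≤ 1 := by
    have : 0 ≤ 6 * C * C * P * (1 + Λ) := by positivity
    rw [hq, mul_one_div, div_le_one (by linarith)]; linarith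
  obtain ⟨l, hl, hs⟩ := exists_sh h.β0 h.ρ0 h.ρ1 hq0 hq1
  refine ⟨l, hl, 6 * C * C + 1, by nlinarith, fun a b M M' m y ha hab hb hbl hy hm => ?_⟩
  have hm0 := hm.nonneg
  have hs' := hs.mono hbl
  obtain ⟨A0, hA0⟩ : ∃ A0, A0 = 6 * C * C * m + 1 := ⟨_, rfl⟩
  have hA00 : 0 ≤ A0 := by rw [hA0]; positivity
  have hMn := hy.cb.nonneg hab
  obtain ⟨B, hBd⟩ : ∃ B, B = max M M' := ⟨_, rfl⟩
  have hB0 : 0 ≤ B := hMn.1.trans (hBd ▸ le_max_left _ _)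
  have one : ∀ N, CB 𝓑 α β γ X a b y (fun t => G (y t)) N (Λ * (1 + N)) →
      CB 𝓑 α β γ X a b y (fun t => G (y t)) (A0 / 2 + N / 2) (Λ * (1 + (A0 / 2 + N / 2))) := by
    intro N hc
    have hN := (hc.nonneg hab).1
    obtain ⟨i1, i2⟩ := hp a b _ _ _ ha hab hb hc
    obtain ⟨p1, p2⟩ := yp_lin h ha hb hc hs'.e2
    have k0 : C * C * (1 + N) + (1 + N) ≤ Λ * (1 + (A0 / 2 + N / 2)) := by
      rw [hΛ]; nlinarith [mul_nonneg (mul_nonneg hC0 hC0) hA00]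
    refine (Evo.cb (M' := Λ * (1 + (A0 / 2 + N / 2))) h.toDrv ha hab hb i1 i2 hy.ev hm hs'
      (fun t h1 h2 => (p1 t h1 h2).mono ?_) (fun s t h1 h2 h3 => (p2 s t h1 h2 h3).mono ?_)).mono ?_ le_rfl
    · have : C * (C + C * N) = C * C * (1 + N) := by ring
      linarith
    · refine mul_le_mul_of_nonneg_right ?_ (Real.rpow_nonneg (by linarith) _)
      have e1 : C * (C * (N + C * q * (Λ * (1 + N)))) = C * C * N + (C * C * C * Λ * q) * (1 + N) := by
        ring
      have e2 : (C * C * C * Λ * q) * (1 + N) ≤ 1 * (1 + N) := by gcongr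
      rw [e1]
      nlinarith
    · have e1 : 3 * C * C * (m + P * (1 + N + Λ * (1 + N)) * q)
          = 3 * C * C * m + (6 * C * C * P * (1 + Λ) * q) * (1 + N) / 2 := by ring
      have e2 : (6 * C * C * P * (1 + Λ) * q) * (1 + N) ≤ 1 * (1 + N) := by gcongr
      rw [e1, hA0]; linarith
  have key : ∀ n : ℕ, CB 𝓑 α β γ X a b y (fun t => G (y t)) (A0 + B * (1 / 2) ^ n)
      (Λ * (1 + (A0 + B * (1 / 2) ^ n))) := by
    intro n
    induction n with
    | zero =>
      refine hy.cb.mono ?_ ?_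
      · have := hBd ▸ le_max_left M M'
        simp; linarith
      · have := hBd ▸ le_max_right M M'
        simp; nlinarith
    | succ n ih =>
      have := one _ ih
      have e : A0 / 2 + (A0 + B * (1 / 2) ^ n) / 2 = A0 + B * (1 / 2) ^ (n + 1) := by
        rw [pow_succ]; ring
      rwa [e] at this
  intro t h1 h2
  have ht : Filter.Tendsto (fun n : ℕ => A0 + B * (1 / 2 : ℝ) ^ n) Filter.atTop (nhds A0) := by
    have := ((tendsto_pow_atTop_nhds_zero_of_lt_one (r := (1 / 2 : ℝ)) (by norm_num)
      (by norm_num)).const_mul B).const_add A0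
    simpa using this
  refine (Bd.tendsto_le ht fun n => (key n).y t h1 h2).mono ?_
  rw [hA0]; nlinarith

/-- Global a priori bound. -/
theorem apriori_global (h : Eqn 𝓑 Sg α β γ δ σ T X X2 F G DG D2G C ρ) (hm : 0 ≤ m) :
    ∃ R ≥ 0, ∀ (b M M' : ℝ) (y : ℝ → 𝓑.E), 0 ≤ b → b ≤ T →
      Sol 𝓑 Sg α β γ X X2 F G DG 0 b y M M' → Bd 𝓑 γ (y 0) m →
      ∀ t, 0 ≤ t → t ≤ b → Bd 𝓑 γ (y t) R := by
  obtain ⟨l, hl, A, hA, hap⟩ := apriori h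
  have key : ∀ n : ℕ, ∃ R ≥ 0, ∀ (b M M' : ℝ) (y : ℝ → 𝓑.E), 0 ≤ b → b ≤ T →
      Sol 𝓑 Sg α β γ X X2 F G DG 0 b y M M' → Bd 𝓑 γ (y 0) m →
      ∀ t, 0 ≤ t → t ≤ b → t ≤ n * l → Bd 𝓑 γ (y t) R := by
    intro n
    induction n with
    | zero =>
      refine ⟨m, hm, fun b M M' y hb hbT hy h0 t h1 h2 h3 => ?_⟩
      have : t = 0 := by simp at h3; linarith
      rw [this]; exact h0
    | succ n ih =>
      obtain ⟨R, hR, hr⟩ := ih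
      refine ⟨A * (R + 1), by positivity, fun b M M' y hb hbT hy h0 t h1 h2 h3 => ?_⟩
      push_cast at h3
      have hnl : 0 ≤ (n : ℝ) * l := by positivity
      by_cases ht : t ≤ n * l
      · exact (hr b M M' y hb hbT hy h0 t h1 h2 ht).mono (by nlinarith)
      · have hn := hr b M M' y hb hbT hy h0 (n * l) hnl (by linarith) le_rfl
        exact hap (n * l) t M M' R y hnl (by linarith) (by linarith) (by linarith)
          (hy.restrict hnl h2) hn t (by linarith) le_rfl
  obtain ⟨n, hn⟩ := exists_nat_ge (T / l)
  obtain ⟨R, hR, hr⟩ := key n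
  refine ⟨R, hR, fun b M M' y hb hbT hy h0 t h1 h2 => hr b M M' y hb hbT hy h0 t h1 h2 ?_⟩
  rw [div_le_iff₀ hl] at hn
  linarith

theorem CB.glue (h : Ctx 𝓑 Sg α β γ δ σ T X X2 C) (ha : 0 ≤ a) (hac : a ≤ c) (hcb : c ≤ b) (hb : b ≤ T)
    (h1 : CB 𝓑 α β γ X a c y y' M1 M1') (h2 : CB 𝓑 α β γ X c b y y' M2 M2') :
    CB 𝓑 α β γ X a b y y' (M1 + M2 + 2 * (C * C) * M1') (M1' + M2') := by
  have hC0 := h.C0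
  have n1 := h1.nonneg hac
  have n2 := h2.nonneg hcb
  have hβ0 := h.β0
  have hK : 0 ≤ 2 * (C * C) * M1' := by have := n1.2; positivity
  have pm : ∀ (s t s' t' e : ℝ), s ≤ s' → s' ≤ t' → t' ≤ t → 0 ≤ e → (t' - s') ^ e ≤ (t - s) ^ e :=
    fun s t s' t' e q1 q2 q3 he => Real.rpow_le_rpow (by linarith) (by linarith) he
  have hX : ∀ s t, a ≤ s → s ≤ c → c ≤ t → t ≤ b → |X t - X c| ≤ C * C * (t - s) ^ β := by
    intro s t a1 a2 a3 a4
    have := (h.hX c t (by linarith) a3 (by linarith)).trans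
      (mul_le_mul_of_nonneg_left (h.tauC (ha.trans hac) hb (t - c) (by linarith) (by linarith)) hC0)
    refine this.trans ?_
    rw [← mul_assoc]
    exact mul_le_mul_of_nonneg_left (pm s t c t β a2 a3 le_rfl hβ0.le) (by positivity)
  have hg : ∀ s t, gubRemainder 𝓑 X y y' s t = gubRemainder 𝓑 X y y' s c + gubRemainder 𝓑 X y y' c t
      + (X t - X c) • (y' c - y' s) := by
    intro s t; simp only [gubRemainder]; module
  refine ⟨fun t a1 a2 => ?_, fun t a1 a2 => ?_, fun s t a1 a2 a3 => ?_, fun s t a1 a2 a3 => ?_,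
    fun s t a1 a2 a3 => ?_⟩
  · rcases le_total t c with hc | hc
    · exact (h1.y t a1 hc).mono (by linarith [n2.1])
    · exact (h2.y t hc a2).mono (by linarith [n1.1])
  · rcases le_total t c with hc | hc
    · exact (h1.y' t a1 hc).mono (by linarith [n2.2])
    · exact (h2.y' t hc a2).mono (by linarith [n1.2])
  all_goals
    have hp := Real.rpow_nonneg (show 0 ≤ t - s by linarith) β
    have hp2 := Real.rpow_nonneg (show 0 ≤ t - s by linarith) (2 * β)
  · rcases le_total t c with hc | hc
    · exact (h1.hy' s t a1 a2 hc).mono (mul_le_mul_of_nonneg_right (by linarith [n2.2]) hp)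
    rcases le_total c s with hc' | hc'
    · exact (h2.hy' s t hc' a2 a3).mono (mul_le_mul_of_nonneg_right (by linarith [n1.2]) hp)
    refine (((h1.hy' s c a1 hc' le_rfl).add (h2.hy' c t le_rfl hc a3)).congr (by abel)).mono ?_
    have k1 := mul_le_mul_of_nonneg_left (pm s t s c β le_rfl hc' hc hβ0.le) n1.2
    have k2 := mul_le_mul_of_nonneg_left (pm s t c t β hc' hc le_rfl hβ0.le) n2.2
    linarith
  · rcases le_total t c with hc | hc
    · exact (h1.r1 s t a1 a2 hc).mono (mul_le_mul_of_nonneg_right (by linarith [n2.1]) hp)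
    rcases le_total c s with hc' | hc'
    · exact (h2.r1 s t hc' a2 a3).mono (mul_le_mul_of_nonneg_right (by linarith [n1.1]) hp)
    refine ((((h1.r1 s c a1 hc' le_rfl).add (h2.r1 c t le_rfl hc a3)).add
      (((h1.y' c hac le_rfl).sub (h1.y' s a1 hc')).smul (hX s t a1 hc' hc a3))).congr (hg s t)).mono ?_
    have k1 := mul_le_mul_of_nonneg_left (pm s t s c β le_rfl hc' hc hβ0.le) n1.1
    have k2 := mul_le_mul_of_nonneg_left (pm s t c t β hc' hc le_rfl hβ0.le) n2.1
    linarith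
  · rcases le_total t c with hc | hc
    · exact (h1.r2 s t a1 a2 hc).mono (mul_le_mul_of_nonneg_right (by linarith [n2.1]) hp2)
    rcases le_total c s with hc' | hc'
    · exact (h2.r2 s t hc' a2 a3).mono (mul_le_mul_of_nonneg_right (by linarith [n1.1]) hp2)
    refine ((((h1.r2 s c a1 hc' le_rfl).add (h2.r2 c t le_rfl hc a3)).add
      ((h1.hy' s c a1 hc' le_rfl).smul (hX s t a1 hc' hc a3))).congr (hg s t)).mono ?_
    have k1 := mul_le_mul_of_nonneg_left (pm s t s c (2 * β) le_rfl hc' hc (by linarith)) n1.1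
    have k2 := mul_le_mul_of_nonneg_left (pm s t c t (2 * β) hc' hc le_rfl (by linarith)) n2.1
    have k3 : C * C * (t - s) ^ β * (M1' * (c - s) ^ β) ≤ C * C * (t - s) ^ β * (M1' * (t - s) ^ β) :=
      mul_le_mul_of_nonneg_left
        (mul_le_mul_of_nonneg_left (pm s t s c β le_rfl hc' hc hβ0.le) n1.2) (by positivity)
    have k4 : C * C * (t - s) ^ β * (M1' * (t - s) ^ β) = C * C * M1' * (t - s) ^ (2 * β) := by
      rw [rp2 (by linarith) hβ0]; ring
    have k5 : 0 ≤ C * C * M1' * (t - s) ^ (2 * β) := by have := n1.2; positivity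
    linarith

theorem CtsOn.glue {θ : ℝ} (h1 : CtsOn 𝓑 θ a c y) (h2 : CtsOn 𝓑 θ c b y) : CtsOn 𝓑 θ a b y := by
  intro t a1 a2 ε hε
  rcases lt_trichotomy t c with hc | hc | hc
  · obtain ⟨η, hη, hl⟩ := h1 t a1 hc.le ε hε
    refine ⟨min η (c - t), lt_min hη (by linarith), fun s s1 s2 s3 => ?_⟩
    have := (abs_lt.mp (s3.trans_le (min_le_right _ _))).2
    exact hl s s1 (by linarith) (s3.trans_le (min_le_left _ _))
  · subst hc
    obtain ⟨η, hη, hl⟩ := h1 t a1 le_rfl ε hε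
    obtain ⟨η', hη', hl'⟩ := h2 t le_rfl a2 ε hε
    refine ⟨min η η', lt_min hη hη', fun s s1 s2 s3 => ?_⟩
    rcases le_total s t with hs | hs
    · exact hl s s1 hs (s3.trans_le (min_le_left _ _))
    · exact hl' s hs s2 (s3.trans_le (min_le_right _ _))
  · obtain ⟨η, hη, hl⟩ := h2 t hc.le a2 ε hε
    refine ⟨min η (t - c), lt_min hη (by linarith), fun s s1 s2 s3 => ?_⟩
    have := (abs_lt.mp (s3.trans_le (min_le_right _ _))).1
    exact hl s (by linarith) s2 (s3.trans_le (min_le_left _ _))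

theorem Sol.glue (h : Eqn 𝓑 Sg α β γ δ σ T X X2 F G DG D2G C ρ) (ha : 0 ≤ a) (hac : a ≤ c)
    (hcb : c ≤ b) (hb : b ≤ T)
    (h1 : Sol 𝓑 Sg α β γ X X2 F G DG a c y M1 M1') (h2 : Sol 𝓑 Sg α β γ X X2 F G DG c b y M2 M2') :
    Sol 𝓑 Sg α β γ X X2 F G DG a b y (M1 + M2 + 2 * (C * C) * M1') (M1' + M2') := by
  have hcb' := CB.glue h.toCtx ha hac hcb hb h1.cb h2.cb
  have hct := h1.ct.glue h2.ct
  refine ⟨hcb', hct, fun s t a1 a2 a3 => ?_⟩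
  rcases le_or_gt t c with hc | hc
  · exact h1.ev s t a1 a2 hc
  rcases le_or_gt c s with hc' | hc'
  · exact h2.ev s t hc' a2 a3
  obtain ⟨P, hP, hp⟩ := comp_lin h
  obtain ⟨i1, i2⟩ := hp a b _ _ _ ha (hac.trans hcb) hb hcb'
  obtain ⟨W, w1, w2, w3⟩ := W_exists h.toCtx ha (hac.trans hcb) hb i1 i2 (F_cts h hcb'.y hct)
  obtain ⟨p, hp1, hp2⟩ := h1.ev s c a1 hc' le_rfl
  obtain ⟨r, hr1, hr2⟩ := h2.ev c t le_rfl hc a3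
  refine ⟨W s t, w2 s t a1 a2 a3, ?_⟩
  rw [hr2, hp2, Rep.unique h.toCtx ha hb i1 i2 a1 hc' hcb hp1 (w2 s c a1 hc' hcb),
    Rep.unique h.toCtx ha hb i1 i2 hac hc a3 hr1 (w2 c t hac hc a3),
    w1 s c t a1 hc'.le hc.le a3, map_add, ← Sg.S_comp _ _ (by linarith) (by linarith)]
  rw [show t - c + (c - s) = t - s by ring]; abel

/-- Global existence. -/
theorem global_exists (h : Eqn 𝓑 Sg α β γ δ σ T X X2 F G DG D2G C ρ) {ξ : 𝓑.E} (hξ : 𝓑.Mem γ ξ) :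
    ∃ (y : ℝ → 𝓑.E) (M M' : ℝ), y 0 = ξ ∧ Sol 𝓑 Sg α β γ X X2 F G DG 0 T y M M' := by
  have hT := h.hT
  obtain ⟨R, hR, hr⟩ := apriori_global h (𝓑.N_nonneg γ ξ)
  obtain ⟨l, hl, M2, M2', hloc⟩ := local_exists h hR
  have hξb : Bd 𝓑 γ ξ (𝓑.N γ ξ) := ⟨hξ, le_rfl⟩
  obtain ⟨R0, hR0⟩ : ∃ R0, R0 = 𝓑.N γ ξ := ⟨_, rfl⟩
  obtain ⟨l0, hl0, M0, M0', hloc0⟩ := local_exists h (𝓑.N_nonneg γ ξ)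
  have key : ∀ n : ℕ, ∃ (y : ℝ → 𝓑.E) (M M' : ℝ), y 0 = ξ ∧
      Sol 𝓑 Sg α β γ X X2 F G DG 0 (min T (n * l)) y M M' := by
    intro n
    induction n with
    | zero =>
      obtain ⟨y, hy0, hy⟩ := hloc0 0 0 ξ le_rfl le_rfl hT.le (by linarith) hξb
      refine ⟨y, M0, M0', hy0, ?_⟩
      simpa [hT.le] using hy
    | succ n ih =>
      obtain ⟨y, M, M', hy0, hy⟩ := ih
      set c := min T (n * l) with hc
      have hc0 : 0 ≤ c := le_min hT.le (by positivity)
      have hcT : c ≤ T := min_le_left _ _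
      set b := min T ((n + 1 : ℕ) * l) with hbd
      have hcb : c ≤ b := min_le_min le_rfl (by push_cast; nlinarith)
      have hbT : b ≤ T := min_le_left _ _
      have hbl : b - c ≤ l := by
        have e1 : b ≤ (n + 1 : ℕ) * l := min_le_right _ _
        push_cast at e1
        rcases le_total T (n * l) with h1 | h1
        · have : c = T := min_eq_left h1
          linarith
        · have : c = n * l := min_eq_right h1
          linarith
      obtain ⟨z, hz0, hz⟩ := hloc c b (y c) hc0 hcb hbT hbl
        (hr c M M' y hc0 hcT hy (by rw [hy0]; exact hξb) c hc0 le_rfl)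
      refine ⟨fun t => if t ≤ c then y t else z t, _, _, ?_,
        Sol.glue h le_rfl hc0 hcb hbT (hy.congr fun t h1 h2 => if_pos h2) (hz.congr fun t h1 h2 => ?_)⟩
      · simp [hc0, hy0]
      · rcases h1.eq_or_lt with h1 | h1
        · rw [← h1, if_pos le_rfl, hz0]
        · exact if_neg (not_le.mpr h1)
  obtain ⟨n, hn⟩ := exists_nat_ge (T / l)
  rw [div_le_iff₀ hl] at hn
  have := key n
  rwa [min_eq_left hn] at this

/-- Global uniqueness. -/
theorem global_unique (h : Eqn 𝓑 Sg α β γ δ σ T X X2 F G DG D2G C ρ)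
    (hy : Sol 𝓑 Sg α β γ X X2 F G DG 0 T y M1 M1') (hz : Sol 𝓑 Sg α β γ X X2 F G DG 0 T z M2 M2')
    (h0 : y 0 = z 0) : ∀ t, 0 ≤ t → t ≤ T → y t = z t := by
  have hT := h.hT
  have n1 := hy.cb.nonneg hT.le
  have n2 := hz.cb.nonneg hT.le
  obtain ⟨B, hB⟩ : ∃ B, B = M1 + M1' + M2 + M2' := ⟨_, rfl⟩
  have hy' := hy.mono (N := B) (N' := B) (by linarith) (by linarith)
  have hz' := hz.mono (N := B) (N' := B) (by linarith) (by linarith)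
  obtain ⟨l, hl, hu⟩ := local_unique h (M0 := B) (by linarith)
  have key : ∀ n : ℕ, ∀ t, 0 ≤ t → t ≤ T → t ≤ n * l → y t = z t := by
    intro n
    induction n with
    | zero =>
      intro t h1 h2 h3
      have : t = 0 := by simp at h3; linarith
      rw [this, h0]
    | succ n ih =>
      intro t h1 h2 h3
      push_cast at h3
      have hnl : 0 ≤ (n : ℝ) * l := by positivity
      by_cases ht : t ≤ n * l
      · exact ih t h1 h2 ht
      · exact hu (n * l) t y z hnl (by linarith) h2 (by linarith) (hy'.restrict hnl h2)
          (hz'.restrict hnl h2) (ih _ hnl (by linarith) le_rfl) t (by linarith) le_rfl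
  obtain ⟨n, hn⟩ := exists_nat_ge (T / l)
  rw [div_le_iff₀ hl] at hn
  exact fun t h1 h2 => key n t h1 h2 (by linarith)

end

end RPDE


namespace RPDE

section

variable {𝓑 : BanachScale} {Sg : ScaleSemigroup 𝓑} {α β γ δ σ T : ℝ}
    {X : ℝ → ℝ} {X2 : ℝ → ℝ → ℝ} {F G : 𝓑.E → 𝓑.E} {DG : 𝓑.E → 𝓑.E →ₗ[ℝ] 𝓑.E}
    {D2G : 𝓑.E → 𝓑.E →ₗ[ℝ] 𝓑.E →ₗ[ℝ] 𝓑.E}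
    {C ρ a b c M M' N N' M0 : ℝ} {y y' z z' u Y Y' f : ℝ → 𝓑.E}

theorem CtsOn.bdd {θ : ℝ} (hm : ∀ t, a ≤ t → t ≤ b → 𝓑.Mem θ (y t)) (hc : CtsOn 𝓑 θ a b y) :
    ∃ R, ∀ t, a ≤ t → t ≤ b → Bd 𝓑 θ (y t) R := by
  have hcont : ContinuousOn (fun t => 𝓑.N θ (y t)) (Icc a b) := by
    rw [Metric.continuousOn_iff]
    intro t ht ε hε
    obtain ⟨η, hη, hl⟩ := hc t ht.1 ht.2 (ε / 2) (by linarith)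
    refine ⟨η, hη, fun s hs hst => ?_⟩
    have hb := hl s hs.1 hs.2 (by rwa [Real.dist_eq] at hst)
    have e1 := 𝓑.N_add θ (y s - y t) (y t) hb.1 (hm t ht.1 ht.2)
    have e2 := 𝓑.N_add θ (y t - y s) (y s) hb.symm.1 (hm s hs.1 hs.2)
    rw [sub_add_cancel] at e1 e2
    have f1 := hb.2
    have f2 := hb.symm.2
    rw [Real.dist_eq, abs_lt]
    constructor <;> linarith
  obtain ⟨R, hR⟩ := isCompact_Icc.exists_bound_of_continuousOn hcont
  exact ⟨R, fun t h1 h2 => ⟨hm t h1 h2, (le_abs_self _).trans (hR t ⟨h1, h2⟩)⟩⟩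

theorem sol_of_isSolution (h : Eqn 𝓑 Sg α β γ δ σ T X X2 F G DG D2G C ρ) {ξ : 𝓑.E}
    (hs : IsSolution 𝓑 Sg α γ X X2 F G DG ξ T y) :
    ∃ M M', Sol 𝓑 Sg α β γ X X2 F G DG 0 T y M M' := by
  have hT := h.hT
  have hC0 := h.C0
  have hα := h.hα
  have hα2 := h.hα2
  have hβ0 := h.β0
  have hβ := h.hβ
  have hc := hs.controlled
  have hct : CtsOn 𝓑 γ 0 T y := by
    intro t h1 h2 ε hε
    obtain ⟨η, hη, hl⟩ := hc.cont_y t h1 h2 ε hε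
    exact ⟨η, hη, fun s s1 s2 s3 => ⟨mem_sub (hc.mem_y s s1 s2) (hc.mem_y t h1 h2), (hl s s1 s2 s3).le⟩⟩
  obtain ⟨R, hR⟩ := hct.bdd hc.mem_y
  have hR0 := (hR 0 le_rfl hT.le).nonneg
  have hGy : ∀ t, 0 ≤ t → t ≤ T → Bd 𝓑 (γ - α) (G (y t)) (C * (C + C * R)) := fun t h1 h2 =>
    h.emb _ Lv.ga _ Lv.gs (by linarith [h.hσα]) _ _ (Gy_bd h (hR t h1 h2))
  obtain ⟨c1, hc1⟩ := hc.holder_y'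
  obtain ⟨c2, hc2⟩ := hc.rem_alpha
  obtain ⟨c3, hc3⟩ := hc.rem_two_alpha
  have up : ∀ (c x s t e e' : ℝ), s ≤ t → 0 ≤ s → t ≤ T → 0 ≤ e' → e' ≤ e → e ≤ 3 →
      x ≤ c * (t - s) ^ e → x ≤ |c| * C * (t - s) ^ e' := by
    intro c x s t e e' h1 h2 h3 h4 h5 h6 hx
    have p := h.pw (t - s) e e' (by linarith) (by linarith) h4 h5 h6
    calc x ≤ c * (t - s) ^ e := hx
      _ ≤ |c| * (t - s) ^ e :=
        mul_le_mul_of_nonneg_right (le_abs_self c) (Real.rpow_nonneg (by linarith) _)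
      _ ≤ |c| * (C * (t - s) ^ e') := mul_le_mul_of_nonneg_left p (abs_nonneg c)
      _ = _ := by ring
  have lift : ∀ (θ : ℝ), θ ≤ γ - α → ∀ s t, 0 ≤ s → s ≤ T → 0 ≤ t → t ≤ T →
      𝓑.Mem θ (G (y t) - G (y s)) ∧ 𝓑.Mem θ (gubRemainder 𝓑 X y (fun t => G (y t)) s t) := by
    intro θ hθ s t s1 s2 t1 t2
    have m1 := hc.mem_y' s s1 s2
    have m2 := hc.mem_y' t t1 t2
    have m3 := 𝓑.mem_mono (show γ - α ≤ γ by linarith) _ (hc.mem_y s s1 s2)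
    have m4 := 𝓑.mem_mono (show γ - α ≤ γ by linarith) _ (hc.mem_y t t1 t2)
    exact ⟨𝓑.mem_mono hθ _ (mem_sub m2 m1),
      𝓑.mem_mono hθ _ (mem_sub (mem_sub m4 m3) (𝓑.mem_smul _ _ _ m1))⟩
  have hcb : CB 𝓑 α β γ X 0 T y (fun t => G (y t)) (R + |c2| * C + |c3| * C)
      (C * (C + C * R) + |c1| * C) := by
    have p1 : 0 ≤ |c1| * C := by positivity
    have p2 : 0 ≤ |c2| * C := by positivity
    have p3 : 0 ≤ |c3| * C := by positivity
    have p4 : 0 ≤ C * (C + C * R) := by positivity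
    refine ⟨fun t h1 h2 => (hR t h1 h2).mono (by linarith), fun t h1 h2 => (hGy t h1 h2).mono (by linarith),
      fun s t h1 h2 h3 => ⟨(lift _ (by linarith) s t h1 (by linarith) (by linarith) h3).1, ?_⟩,
      fun s t h1 h2 h3 => ⟨(lift _ le_rfl s t h1 (by linarith) (by linarith) h3).2, ?_⟩,
      fun s t h1 h2 h3 => ⟨(lift _ (by linarith) s t h1 (by linarith) (by linarith) h3).2, ?_⟩⟩
    · refine (up c1 _ s t α β h2 h1 h3 hβ0.le hβ.le (by linarith) (hc1 s t h1 h2 h3)).trans ?_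
      exact mul_le_mul_of_nonneg_right (by linarith) (Real.rpow_nonneg (by linarith) _)
    · refine (up c2 _ s t α β h2 h1 h3 hβ0.le hβ.le (by linarith) (hc2 s t h1 h2 h3)).trans ?_
      exact mul_le_mul_of_nonneg_right (by linarith) (Real.rpow_nonneg (by linarith) _)
    · refine (up c3 _ s t (2 * α) (2 * β) h2 h1 h3 (by linarith) (by linarith) (by linarith)
        (hc3 s t h1 h2 h3)).trans ?_
      exact mul_le_mul_of_nonneg_right (by linarith) (Real.rpow_nonneg (by linarith) _)
  refine ⟨_, _, hcb, hct, ?_⟩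
  obtain ⟨P, hP, hp⟩ := comp_lin h
  obtain ⟨i1, i2⟩ := hp 0 T _ _ _ le_rfl hT.le le_rfl hcb
  obtain ⟨W, w1, w2, w3⟩ := W_exists h.toCtx le_rfl hT.le le_rfl i1 i2 (F_cts h hR hct)
  have base : ∀ t, 0 ≤ t → t ≤ T → y t = Sg.S t ξ + W 0 t := by
    intro t h1 h2
    rcases h1.eq_or_lt with rfl | h1
    · rw [hs.init, w3 0 le_rfl hT.le, Sg.S_id, add_zero]
    · obtain ⟨D, Z, hD, hZ, e⟩ := hs.mild t h1 h2
      rw [e, add_assoc, Rep.unique h.toCtx le_rfl le_rfl i1 i2 le_rfl h1 h2 (w2 0 t le_rfl h1 h2)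
        ⟨D, Z, hD, hZ, rfl⟩]
  intro s t h1 h2 h3
  refine ⟨W s t, w2 s t h1 h2 h3, ?_⟩
  rw [base t (by linarith) h3, base s h1 (by linarith), map_add, ← Sg.S_comp _ _ (by linarith) h1,
    sub_add_cancel, w1 0 s t le_rfl h1 h2.le h3]
  abel

theorem isSolution_of_sol (h : Eqn 𝓑 Sg α β γ δ σ T X X2 F G DG D2G C ρ) {ξ : 𝓑.E} (h0 : y 0 = ξ)
    (hs : Sol 𝓑 Sg α β γ X X2 F G DG 0 T y M M') : IsSolution 𝓑 Sg α γ X X2 F G DG ξ T y := by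
  have hT := h.hT
  have hC0 := h.C0
  have hC1 := h.one_le
  have hα := h.hα
  have hσα := h.hσα
  obtain ⟨P, hP, hp⟩ := comp_lin h
  obtain ⟨i1, i2⟩ := hp 0 T _ _ _ le_rfl hT.le le_rfl hs.cb
  have hrem := Evo.rem h.toDrv le_rfl le_rfl i1 i2 hs.ev hs.cb.y
  refine ⟨⟨fun t h1 h2 => (hs.cb.y t h1 h2).1, fun t h1 h2 => (hs.cb.y' t h1 h2).1, ?_, ?_, ?_,
    ⟨_, fun s t h1 h2 h3 => (hrem s t h1 h2 h3).1.2⟩, ⟨_, fun s t h1 h2 h3 => (hrem s t h1 h2 h3).2.2⟩⟩, h0, ?_⟩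
  · intro t h1 h2 ε hε
    obtain ⟨η, hη, hl⟩ := hs.ct t h1 h2 (ε / 2) (by linarith)
    exact ⟨η, hη, fun s s1 s2 s3 => (hl s s1 s2 s3).2.trans_lt (by linarith)⟩
  · intro t h1 h2 ε hε
    have hCp : 0 < C * C := by positivity
    obtain ⟨η, hη, hl⟩ := hs.ct t h1 h2 (ε / (2 * (C * C))) (by positivity)
    refine ⟨η, hη, fun s s1 s2 s3 => ?_⟩
    refine (G_lip h (hs.cb.y s s1 s2).1 (hs.cb.y t h1 h2).1 (hl s s1 s2 s3)).2.trans_lt ?_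
    have : C * (C * (ε / (2 * (C * C)))) = ε / 2 := by
      field_simp
    linarith
  · refine ⟨C * (C * (C * (M + P * (1 + M + M')) + C * M')), fun s t h1 h2 h3 => ?_⟩
    suffices hh : Bd 𝓑 (γ - 2 * α) (G (y t) - G (y s))
        (C * (C * (C * (M + P * (1 + M + M')) + C * M')) * (t - s) ^ α) from hh.2
    have e1 := (hrem s t h1 h2 h3).1.add ((hs.cb.y' s h1 (by linarith)).smul (h.hX s t h1 h2 h3))
    have e2 : Bd 𝓑 (γ - α) (y t - y s) ((C * (M + P * (1 + M + M')) + C * M') * (t - s) ^ α) :=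
      (e1.congr (by simp only [gubRemainder]; abel)).mono (le_of_eq (by ring))
    have m : ∀ t, 0 ≤ t → t ≤ T → 𝓑.Mem (γ - α) (y t) := fun t h1 h2 =>
      𝓑.mem_mono (by linarith) _ (hs.cb.y t h1 h2).1
    have e3 := h.s1.lip (m t (by linarith) h3) (m s h1 (by linarith)) e2
    exact (h.emb (γ - 2 * α) Lv.g2 _ Lv.gas (by linarith) _ _ e3).mono (le_of_eq (by ring))
  · intro t h1 h2
    obtain ⟨w, ⟨D, Z, hD, hZ, hw⟩, hu⟩ := hs.ev 0 t le_rfl h1 h2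
    exact ⟨D, Z, hD, hZ, by rw [hu, hw, h0, sub_zero, add_assoc]⟩

end

theorem main (α T γ δ σ : ℝ) (hα : 1/3 < α) (hα' : α < 1/2) (hT : 0 < T)
    (hδ : 0 ≤ δ) (hδ' : δ < 1) (hσ : 0 ≤ σ) (hσα : σ < α)
    (𝓑 : BanachScale) (Sg : ScaleSemigroup 𝓑) (RP : RoughPath α T)
    (F G : 𝓑.E → 𝓑.E) (DG : 𝓑.E → 𝓑.E →ₗ[ℝ] 𝓑.E)
    (D2G : 𝓑.E → 𝓑.E →ₗ[ℝ] 𝓑.E →ₗ[ℝ] 𝓑.E)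
    (D3G : 𝓑.E → 𝓑.E →ₗ[ℝ] 𝓑.E →ₗ[ℝ] 𝓑.E →ₗ[ℝ] 𝓑.E)
    (hF : AssumptionF 𝓑 γ δ F) (hG : AssumptionG 𝓑 α σ γ G DG D2G D3G)
    (y₀ : 𝓑.E) (hy₀ : 𝓑.Mem γ y₀) :
    ∃ y : ℝ → 𝓑.E,
      IsSolution 𝓑 Sg α γ RP.X RP.X2 F G DG y₀ T y ∧
      ∀ z : ℝ → 𝓑.E, IsSolution 𝓑 Sg α γ RP.X RP.X2 F G DG y₀ T z →
        ∀ t : ℝ, 0 ≤ t → t ≤ T → z t = y t := by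
  obtain ⟨β, hβ1, hβ⟩ := exists_between (show max (1 / 3) ((2 * α + σ) / 3) < α from
    max_lt hα (by linarith))
  have b1 : 1 / 3 < β := (le_max_left _ _).trans_lt hβ1
  have b2 : (2 * α + σ) / 3 < β := (le_max_right _ _).trans_lt hβ1
  obtain ⟨C1, h1⟩ := exists_ctx (γ := γ) (δ := max δ (2 * α)) Sg RP hα hα' hσ hσα hT (le_max_right _ _)
    (max_lt hδ' (by linarith)) hβ (by linarith) (by linarith)
  obtain ⟨C2, ρ, h2⟩ := exists_drv h1
  obtain ⟨C, h⟩ := exists_eqn h2 (le_max_left δ (2 * α)) hF hG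
  obtain ⟨y, M, M', hy0, hy⟩ := global_exists h hy₀
  refine ⟨y, isSolution_of_sol h hy0 hy, fun z hz => ?_⟩
  obtain ⟨N, N', hz'⟩ := sol_of_isSolution h hz
  exact global_unique h hz' hy (by rw [hy0, hz.init])

end RPDE


/-- **global well-posedness, main theorem.** Under assumptions (F) and (G),
for every `y₀ ∈ B_γ` there exists a unique global-in-time solution
`(y, G(y)) ∈ D^{2α}_{X,γ}([0,T])` of the rough evolution equation
`dy_t = (Ay_t + F(y_t))dt + G(y_t)d𝐗_t`, `y(0) = y₀`, i.e. a unique controlled rough path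
on `[0,T]` satisfying the mild formulation
`y_t = S(t)y₀ + ∫₀ᵗ S(t-s)F(y_s)ds + ∫₀ᵗ S(t-s)G(y_s)d𝐗_s` for all `t ∈ [0,T]`. -/
theorem statement16 (α T γ δ σ : ℝ) (hα : 1/3 < α) (hα' : α < 1/2) (hT : 0 < T)
    (hδ : 0 ≤ δ) (hδ' : δ < 1) (hσ : 0 ≤ σ) (hσα : σ < α)
    (𝓑 : BanachScale) (Sg : ScaleSemigroup 𝓑) (RP : RoughPath α T)
    (F G : 𝓑.E → 𝓑.E) (DG : 𝓑.E → 𝓑.E →ₗ[ℝ] 𝓑.E)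
    (D2G : 𝓑.E → 𝓑.E →ₗ[ℝ] 𝓑.E →ₗ[ℝ] 𝓑.E)
    (D3G : 𝓑.E → 𝓑.E →ₗ[ℝ] 𝓑.E →ₗ[ℝ] 𝓑.E →ₗ[ℝ] 𝓑.E)
    (hF : AssumptionF 𝓑 γ δ F) (hG : AssumptionG 𝓑 α σ γ G DG D2G D3G)
    (y₀ : 𝓑.E) (hy₀ : 𝓑.Mem γ y₀) :
    ∃ y : ℝ → 𝓑.E,
      IsSolution 𝓑 Sg α γ RP.X RP.X2 F G DG y₀ T y ∧
      ∀ z : ℝ → 𝓑.E, IsSolution 𝓑 Sg α γ RP.X RP.X2 F G DG y₀ T z →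
        ∀ t : ℝ, 0 ≤ t → t ≤ T → z t = y t := by
  exact RPDE.main α T γ δ σ hα hα' hT hδ hδ' hσ hσα 𝓑 Sg RP F G DG D2G D3G hF hG y₀ hy₀
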